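/- arXiv:1507.04085 — 12 statements merged into one kernel-verified Lean document; each statement's English description precedes it below -/
import Mathlib

section
/- Let f = (f_1,…,f_n) : 𝔽_q^n → 𝔽_q^n be a polynomial map that involves all n variables. If |V_f| < q^n, then |V_f| ≤ q^n − ω_f. -/
open MvPolynomial

/-- Rescaling the variables rescales the coefficients. -/
theorem coeff_aeval_C_mul_X {R ι : Type*} [CommRing R] [Fintype ι] (c : ι → R)
    (p : MvPolynomial ι R) (m : ι →₀ ℕ) :
    coeff m (aeval (fun j => C (c j) * X j) p) = (∏ j, c j ^ m j) * coeff m p := by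
  classical
  induction p using MvPolynomial.induction_on' with
  | monomial u a =>
    have h : aeval (fun j => C (c j) * X j) (monomial u a)
        = monomial u ((∏ j, c j ^ u j) * a) := by
      rw [aeval_monomial, Finsupp.prod_fintype _ _ (by simp)]
      simp only [mul_pow, Finset.prod_mul_distrib]
      rw [mul_comm _ a, C_mul_monomial.symm, monomial_eq, Finsupp.prod_fintype _ _ (by simp)]
      simp [map_prod, algebraMap_eq]
    rw [h, coeff_monomial, coeff_monomial]
    split_ifs with hm
    · rw [hm]
    · simp
  | add p q hp hq => rw [map_add, coeff_add, hp, hq, coeff_add, mul_add]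

/-- In characteristic `p`, the monomials of a `p ^ s`-th power have exponents divisible by
`p ^ s`. -/
theorem pow_dvd_of_coeff_pow_char_pow_ne_zero {R ι : Type*} [CommRing R] (p : ℕ) [ExpChar R p]
    (s : ℕ) (P : MvPolynomial ι R) (m : ι →₀ ℕ) (hm : coeff m (P ^ p ^ s) ≠ 0) (j : ι) :
    p ^ s ∣ m j := by
  classical
  rw [P.as_sum, sum_pow_char_pow p s, coeff_sum] at hm
  obtain ⟨d, -, hd⟩ := Finset.exists_ne_zero_of_sum_ne_zero hm
  rw [monomial_pow, coeff_monomial] at hd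
  split_ifs at hd with h
  · rw [← h]; simp
  · exact absurd rfl hd

/-- The product of the values, at all points of `F ^ n`, of the generic polynomial with exponent
vectors `D j` and indeterminate coefficients. -/
noncomputable def genericProd (F : Type*) [Field F] [Fintype F] {n : ℕ} {ι : Type*} [Fintype ι]
    (D : ι → Fin n → ℕ) : MvPolynomial ι F :=
  ∏ x : Fin n → F, ∑ j, C (∏ i, x i ^ D j i) * X j

section genericProd

variable {F : Type*} [Field F] [Fintype F] {n : ℕ} {ι : Type*} [Fintype ι] (D : ι → Fin n → ℕ)

theorem genericProd_isHomogeneous :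
    (genericProd F D).IsHomogeneous (Fintype.card F ^ n) := by
  have h := MvPolynomial.IsHomogeneous.prod (Finset.univ : Finset (Fin n → F))
    (fun x => ∑ j, C (∏ i, x i ^ D j i) * (X j : MvPolynomial ι F)) (fun _ => 1) (fun x _ =>
      MvPolynomial.IsHomogeneous.sum _ _ _ fun j _ => isHomogeneous_C_mul_X _ _)
  simpa [genericProd] using h

theorem card_sub_one_dvd_of_coeff_genericProd_ne_zero (m : ι →₀ ℕ)
    (hm : coeff m (genericProd F D) ≠ 0) (i : Fin n) :
    Fintype.card F - 1 ∣ ∑ j, m j * D j i := by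
  classical
  obtain ⟨u, hu⟩ := IsCyclic.exists_generator (α := Fˣ)
  have hord : orderOf u = Fintype.card F - 1 := by
    rw [orderOf_eq_card_of_forall_mem_zpowers hu, Nat.card_eq_fintype_card, Fintype.card_units]
  let v : Fin n → Fˣ := Pi.mulSingle i u
  let e : (Fin n → F) ≃ (Fin n → F) := Equiv.piCongrRight fun l => (v l).mulLeft
  have hv (d : Fin n → ℕ) : ∏ l, (v l : F) ^ d l = (u : F) ^ d i := by
    rw [Finset.prod_eq_single i (fun l _ hl => by simp [v, Pi.mulSingle_eq_of_ne hl]) (by simp)]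
    simp [v]
  have hφ : aeval (fun j => C ((u : F) ^ D j i) * X j) (genericProd F D) = genericProd F D := by
    rw [genericProd, map_prod]
    conv_rhs => rw [← Equiv.prod_comp e]
    refine Finset.prod_congr rfl fun x _ => ?_
    rw [map_sum]
    refine Finset.sum_congr rfl fun j _ => ?_
    have : ∏ l, e x l ^ D j l = (u : F) ^ D j i * ∏ l, x l ^ D j l := by
      rw [← hv, ← Finset.prod_mul_distrib]
      exact Finset.prod_congr rfl fun l _ => by simp [e, mul_pow]
    rw [this, map_mul, aeval_X, aeval_C, algebraMap_eq, C_mul]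
    ring
  have hc := coeff_aeval_C_mul_X (fun j => (u : F) ^ D j i) (genericProd F D) m
  rw [hφ] at hc
  have h1 : (u : F) ^ (∑ j, m j * D j i) = 1 := by
    rw [← Finset.prod_pow_eq_pow_sum]
    have := mul_right_cancel₀ hm ((one_mul _).trans hc)
    rw [this]
    exact Finset.prod_congr rfl fun j _ => by rw [← pow_mul, mul_comm]
  rw [← hord]
  exact orderOf_dvd_of_pow_eq_one (Units.ext (by simpa using h1))

theorem card_pow_dvd_of_coeff_genericProd_ne_zero (m : ι →₀ ℕ)
    (hm : coeff m (genericProd F D) ≠ 0) (Z : Finset (Fin n))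
    (hZ : ∀ i ∈ Z, ∀ j, m j * D j i = 0) (j : ι) :
    Fintype.card F ^ Z.card ∣ m j := by
  classical
  let c : ι → F := fun j => if ∃ i ∈ Z, D j i ≠ 0 then 0 else 1
  have hc : ∏ j, c j ^ m j = 1 := by
    refine Finset.prod_eq_one fun j _ => ?_
    by_cases h : ∃ i ∈ Z, D j i ≠ 0
    · obtain ⟨i, hi, hij⟩ := h
      have : m j = 0 := by simpa [hij] using hZ i hi j
      simp [this]
    · simp [c, if_neg h]
  have h1 := coeff_aeval_C_mul_X c (genericProd F D) m
  rw [hc, one_mul] at h1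
  let P : MvPolynomial ι F := ∏ y : {i // i ∉ Z} → F,
    ∑ j, C (c j * ∏ i : {i // i ∉ Z}, y i ^ D j i) * X j
  have hP : aeval (fun j => C (c j) * X j) (genericProd F D) = P ^ Fintype.card F ^ Z.card := by
    rw [genericProd, map_prod,
      ← Equiv.prod_comp (Equiv.piEquivPiSubtypeProd (fun i => i ∈ Z) (fun _ => F)).symm,
      Fintype.prod_prod_type]
    have : ∀ z : {i // i ∈ Z} → F, ∏ y : {i // i ∉ Z} → F,
        aeval (fun j => C (c j) * X j) (∑ j, C (∏ i,
          (Equiv.piEquivPiSubtypeProd (fun i => i ∈ Z) (fun _ => F)).symm (z, y) i ^ D j i)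
            * (X j : MvPolynomial ι F)) = P := by
      intro z
      refine Finset.prod_congr rfl fun y _ => ?_
      rw [map_sum]
      refine Finset.sum_congr rfl fun j _ => ?_
      rw [map_mul, aeval_X, aeval_C, algebraMap_eq, ← mul_assoc, ← C_mul, mul_comm (∏ i, _)]
      congr 2
      by_cases h : ∃ i ∈ Z, D j i ≠ 0
      · simp [c, if_pos h]
      · congr 1
        rw [← Fintype.prod_subtype_mul_prod_subtype (fun i => i ∈ Z)]
        push Not at h
        rw [Finset.prod_eq_one (fun i _ => by rw [h i.1 i.2, pow_zero]), one_mul]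
        exact Finset.prod_congr rfl fun i _ => by simp [i.2]
    rw [Finset.prod_congr rfl fun z _ => this z]
    simp
  rw [hP] at h1
  obtain ⟨p, hp⟩ := CharP.exists F
  obtain ⟨r, hpr, hr⟩ := FiniteField.card F p
  have : Fact p.Prime := ⟨hpr⟩
  rw [← h1, hr, ← pow_mul] at hm
  rw [hr, ← pow_mul]
  exact pow_dvd_of_coeff_pow_char_pow_ne_zero p _ P m hm j

end genericProd

/-- The quantities whose infimum is the integral dilation factor. -/
def dilationSums (N n : ℕ) (E : Finset (Fin n →₀ ℕ)) : Set ℕ :=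
  {s : ℕ | ∃ k : (Fin n →₀ ℕ) → ℕ,
    (∀ D ∈ E, k D ≤ N) ∧
    (∀ i : Fin n, ∃ c : ℕ, 0 < c ∧ ∑ D ∈ E, k D * D i = c * N) ∧
    s = ∑ D ∈ E, k D}

/-- Every natural number is congruent modulo `N` to one in `[0, N]` that is at most as large and
that vanishes only if the number does. -/
theorem exists_reduced_modEq (N : ℕ) (hN : 0 < N) (a : ℕ) :
    ∃ b, b ≤ N ∧ b ≤ a ∧ (0 < a → 0 < b) ∧ b ≡ a [MOD N] := by
  obtain _ | a := a
  · exact ⟨0, by simp, le_rfl, id, rfl⟩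
  · exact ⟨a % N + 1, Nat.mod_lt _ hN, by have := Nat.mod_le a N; omega, fun _ => by omega,
      (Nat.mod_modEq a N).add_right 1⟩

theorem sInf_dilationSums_le {N n : ℕ} (hN : 0 < N) (E : Finset (Fin n →₀ ℕ))
    (hall : ∀ i : Fin n, ∃ D ∈ E, 0 < D i) (Z : Finset (Fin n)) (k : (Fin n →₀ ℕ) → ℕ)
    (hdvd : ∀ i, N ∣ ∑ D ∈ E, k D * D i)
    (hpos : ∀ i ∉ Z, ∃ D ∈ E, 0 < k D * D i)
    (hZ : ∀ i ∈ Z, ∀ D ∈ E, k D * D i = 0) :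
    sInf (dilationSums N n E) ≤ ∑ D ∈ E, k D + Z.card * N := by
  classical
  choose d hdE hd using hall
  choose r hrN hra hr0 hr using exists_reduced_modEq N hN
  let k' : (Fin n →₀ ℕ) → ℕ := fun D => if D ∈ Z.image d then N else r (k D)
  have hk0 : ∀ D ∈ Z.image d, k D = 0 := by
    intro D hD
    obtain ⟨i, hi, rfl⟩ := Finset.mem_image.1 hD
    simpa [(hd i).ne'] using hZ i hi (d i) (hdE i)
  have hmod : ∀ D, k' D ≡ k D [MOD N] := by
    intro D
    by_cases h : D ∈ Z.image d
    · simp only [k', if_pos h, hk0 D h]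
      exact (Nat.modEq_zero_iff_dvd).2 dvd_rfl
    · simp only [k', if_neg h]
      exact hr _
  refine (Nat.sInf_le (⟨k', ?_, ?_, rfl⟩ : ∑ D ∈ E, k' D ∈ dilationSums N n E)).trans ?_
  · intro D _
    by_cases h : D ∈ Z.image d
    · exact (if_pos h).le
    · simpa only [k', if_neg h] using hrN _
  · intro i
    have h1 : N ∣ ∑ D ∈ E, k' D * D i := by
      have : ∑ D ∈ E, k' D * D i ≡ ∑ D ∈ E, k D * D i [MOD N] :=
        Nat.ModEq.sum fun D _ => (hmod D).mul_right _
      exact (this.dvd_iff dvd_rfl).2 (hdvd i)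
    have h2 : 0 < ∑ D ∈ E, k' D * D i := by
      suffices ∃ D ∈ E, 0 < k' D * D i by
        obtain ⟨D, hD, h⟩ := this
        exact h.trans_le (Finset.single_le_sum (f := fun D => k' D * D i) (by simp) hD)
      by_cases hi : i ∈ Z
      · refine ⟨d i, hdE i, Nat.mul_pos ?_ (hd i)⟩
        simp only [k', if_pos (Finset.mem_image_of_mem d hi)]
        exact hN
      · obtain ⟨D, hD, h⟩ := hpos i hi
        refine ⟨D, hD, Nat.mul_pos ?_ (Nat.pos_of_mul_pos_left h)⟩
        by_cases h' : D ∈ Z.image d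
        · simpa only [k', if_pos h'] using hN
        · simpa only [k', if_neg h'] using hr0 _ (Nat.pos_of_mul_pos_right h)
    obtain ⟨c, hc⟩ := h1
    refine ⟨c, Nat.pos_of_ne_zero ?_, by rw [hc, mul_comm]⟩
    rintro rfl
    simp [hc] at h2
  · calc ∑ D ∈ E, k' D ≤ ∑ D ∈ E, (k D + if D ∈ Z.image d then N else 0) := by
          refine Finset.sum_le_sum fun D _ => ?_
          by_cases h : D ∈ Z.image d
          · simp only [k', if_pos h]; omega
          · simpa only [k', if_neg h, add_zero] using hra _
      _ = ∑ D ∈ E, k D + (E.filter (· ∈ Z.image d)).card * N := by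
          rw [Finset.sum_add_distrib, ← Finset.sum_filter]; simp
      _ ≤ ∑ D ∈ E, k D + Z.card * N := by
          gcongr
          exact (Finset.card_le_card fun D hD => (Finset.mem_filter.1 hD).2).trans
            Finset.card_image_le

theorem one_add_mul_le_succ_pow (N z : ℕ) : 1 + z * N ≤ (N + 1) ^ z := by
  have := one_add_mul_le_pow (a := (N : ℤ)) (by omega) z
  rw [add_comm N]
  exact_mod_cast this

theorem sInf_dilationSums_lt {N n : ℕ} (hN : 0 < N) (E : Finset (Fin n →₀ ℕ))
    (hall : ∀ i : Fin n, ∃ D ∈ E, 0 < D i) :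
    sInf (dilationSums N n E) < (N + 1) ^ n := by
  have h := sInf_dilationSums_le hN E hall Finset.univ 0 (by simp) (by simp) (by simp)
  have := one_add_mul_le_succ_pow N n
  simp at h
  omega

theorem sInf_dilationSums_le_of_pow_dvd {N n : ℕ} (hN : 0 < N) (E : Finset (Fin n →₀ ℕ))
    (hall : ∀ i : Fin n, ∃ D ∈ E, 0 < D i) (Z : Finset (Fin n)) (k : (Fin n →₀ ℕ) → ℕ)
    (hdvd : ∀ i, N ∣ ∑ D ∈ E, k D * D i)
    (hpos : ∀ i ∉ Z, ∃ D ∈ E, 0 < k D * D i)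
    (hZ : ∀ i ∈ Z, ∀ D ∈ E, k D * D i = 0)
    (hpow : ∀ D ∈ E, (N + 1) ^ Z.card ∣ k D) (hk : 0 < ∑ D ∈ E, k D) :
    sInf (dilationSums N n E) ≤ ∑ D ∈ E, k D := by
  let k' : (Fin n →₀ ℕ) → ℕ := fun D => k D / (N + 1) ^ Z.card
  have hk' : ∀ D ∈ E, k D = (N + 1) ^ Z.card * k' D := fun D hD =>
    (Nat.mul_div_cancel' (hpow D hD)).symm
  have hsum : ∑ D ∈ E, k D = (N + 1) ^ Z.card * ∑ D ∈ E, k' D := by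
    rw [Finset.mul_sum]
    exact Finset.sum_congr rfl hk'
  have hcop : Nat.Coprime N ((N + 1) ^ Z.card) := Nat.Coprime.pow_right _ (by simp)
  have h := sInf_dilationSums_le hN E hall Z k' ?_ ?_ ?_
  · refine h.trans ?_
    have h1 := one_add_mul_le_succ_pow N Z.card
    have h2 : 0 < ∑ D ∈ E, k' D := Nat.pos_of_mul_pos_left (hsum ▸ hk)
    rw [hsum]
    calc ∑ D ∈ E, k' D + Z.card * N ≤ ∑ D ∈ E, k' D + Z.card * N * ∑ D ∈ E, k' D := by
          exact Nat.add_le_add_left (Nat.le_mul_of_pos_right _ h2) _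
      _ = (1 + Z.card * N) * ∑ D ∈ E, k' D := by ring
      _ ≤ (N + 1) ^ Z.card * ∑ D ∈ E, k' D := by gcongr
  · intro i
    refine hcop.dvd_of_dvd_mul_left ?_
    rw [Finset.mul_sum]
    convert! hdvd i using 1
    exact Finset.sum_congr rfl fun D hD => by rw [hk' D hD, mul_assoc]
  · intro i hi
    obtain ⟨D, hD, h⟩ := hpos i hi
    rw [hk' D hD, mul_assoc] at h
    exact ⟨D, hD, Nat.pos_of_mul_pos_left h⟩
  · intro i hi D hD
    have := hZ i hi D hD
    rw [hk' D hD, mul_assoc] at this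
    exact (Nat.mul_eq_zero.1 this).resolve_left (by positivity)

/-- A monomial of the generic product for the exponents `0` and `E` has degree `0` or at least the
integral dilation factor in the coefficients of the monomials of `E`. -/
theorem sInf_dilationSums_le_of_coeff_genericProd_ne_zero {F : Type*} [Field F] [Fintype F]
    {n : ℕ} (E : Finset (Fin n →₀ ℕ)) (hall : ∀ i : Fin n, ∃ D ∈ E, 0 < D i)
    (m : Option E →₀ ℕ)
    (hm : coeff m (genericProd F fun j : Option E => j.elim (0 : Fin n → ℕ) fun D => ⇑D.1) ≠ 0)
    (h0 : 0 < ∑ D : E, m (some D)) :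
    sInf (dilationSums (Fintype.card F - 1) n E) ≤ ∑ D : E, m (some D) := by
  classical
  have hq : 1 < Fintype.card F := Fintype.one_lt_card
  let k : (Fin n →₀ ℕ) → ℕ := fun D => if h : D ∈ E then m (some ⟨D, h⟩) else 0
  have hkm : ∀ D : E, k D = m (some D) := fun D => dif_pos D.2
  have hsum : ∑ D ∈ E, k D = ∑ D : E, m (some D) := by
    rw [← Finset.sum_coe_sort]
    exact Finset.sum_congr rfl fun D _ => hkm D
  let Z : Finset (Fin n) := Finset.univ.filter fun i => ∀ D ∈ E, k D * D i = 0
  rw [← hsum] at h0 ⊢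
  refine sInf_dilationSums_le_of_pow_dvd (by omega) E hall Z k ?_ ?_ ?_ ?_ h0
  · intro i
    have := card_sub_one_dvd_of_coeff_genericProd_ne_zero _ m hm i
    rw [Fintype.sum_option] at this
    rw [← Finset.sum_coe_sort]
    simpa [hkm] using this
  · intro i hi
    simpa [Z, Nat.pos_iff_ne_zero] using hi
  · intro i hi
    exact (Finset.mem_filter.1 hi).2
  · intro D hD
    rw [Nat.sub_add_cancel hq.le, hkm ⟨D, hD⟩]
    refine card_pow_dvd_of_coeff_genericProd_ne_zero _ m hm Z ?_ _
    rintro i hi (_ | D)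
    · simp
    · simpa [hkm] using (Finset.mem_filter.1 hi).2 D.1 D.2

/-- Let `L` be an injective linear map from `F ^ n` to an extension. The product of `T + L (f x)`
over all `x` has no monomials with exponent strictly between `q ^ n - ω` and `q ^ n`. -/
theorem coeff_prod_X_add_C_eq_zero {F K : Type*} [Field F] [Fintype F] [Field K] [Algebra F K]
    {n : ℕ} (f : Fin n → MvPolynomial (Fin n) F) (b : Fin n → K) (E : Finset (Fin n →₀ ℕ))
    (hE : E = Finset.univ.biUnion fun i => (f i).support)
    (hall : ∀ i : Fin n, ∃ D ∈ E, 0 < D i) (l : ℕ) (hl : l < Fintype.card F ^ n)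
    (hl' : Fintype.card F ^ n < l + sInf (dilationSums (Fintype.card F - 1) n E)) :
    (∏ x : Fin n → F, (Polynomial.X + Polynomial.C (∑ i, eval x (f i) • b i))).coeff l = 0 := by
  classical
  let α : E → K := fun D => ∑ i, coeff D.1 (f i) • b i
  let Q := genericProd F fun j : Option E => j.elim (0 : Fin n → ℕ) fun D => ⇑D.1
  let s : Option E → Polynomial K := fun j => j.elim Polynomial.X fun D => Polynomial.C (α D)
  have hQ : aeval s Q =
      ∏ x : Fin n → F, (Polynomial.X + Polynomial.C (∑ i, eval x (f i) • b i)) := by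
    simp only [Q, genericProd]
    rw [map_prod]
    refine Finset.prod_congr rfl fun x _ => ?_
    rw [map_sum, Fintype.sum_option]
    have h1 : ∑ i, eval x (f i) • b i = ∑ D : E, (∏ i, x i ^ D.1 i) • α D := by
      have : ∀ i, eval x (f i) = ∑ D ∈ E, coeff D (f i) * ∏ l, x l ^ D l := by
        intro i
        rw [eval_eq']
        refine Finset.sum_subset ?_ fun D _ hD => by simp [notMem_support_iff.1 hD]
        rw [hE]
        exact Finset.subset_biUnion_of_mem (fun i => (f i).support) (Finset.mem_univ i)
      simp only [α, Finset.smul_sum]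
      rw [Finset.sum_comm]
      refine Finset.sum_congr rfl fun i _ => ?_
      rw [this, Finset.sum_smul, ← Finset.sum_coe_sort]
      exact Finset.sum_congr rfl fun D _ => by rw [smul_smul, mul_comm]
    rw [h1, map_sum]
    congr 1
    · simp [s]
    · refine Finset.sum_congr rfl fun D _ => ?_
      rw [map_mul, aeval_X, aeval_C]
      simp only [Option.elim, s]
      rw [Algebra.smul_def, Polynomial.C_mul]
      rfl
  rw [← hQ, aeval_def, eval₂_eq', Polynomial.finsetSum_coeff]
  refine Finset.sum_eq_zero fun m hm => ?_
  have hm0 := mem_support_iff.1 hm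
  have hdeg : m none + ∑ D : E, m (some D) = Fintype.card F ^ n := by
    have h := genericProd_isHomogeneous _ hm0
    rwa [Pi.one_def, ← Finsupp.degree_eq_weight_one, Finsupp.degree_eq_sum,
      Fintype.sum_option] at h
  have hne : l ≠ m none := by
    rintro rfl
    have := sInf_dilationSums_le_of_coeff_genericProd_ne_zero E hall m hm0 (by omega)
    omega
  rw [Fintype.prod_option]
  simp only [s, Option.elim, ← Polynomial.C_pow, ← map_prod]
  rw [mul_comm (Polynomial.X ^ _), ← mul_assoc]
  have : algebraMap F (Polynomial K) (coeff m Q) = Polynomial.C (algebraMap F K (coeff m Q)) := rfl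
  rw [this, ← Polynomial.C_mul, Polynomial.coeff_C_mul_X_pow, if_neg hne]

/-- A finite field has extensions of every positive degree. -/
theorem exists_field_extension_of_degree (F : Type*) [Field F] [Fintype F] {n : ℕ} (hn : n ≠ 0) :
    ∃ (K : Type) (_ : Field K) (_ : Fintype K) (_ : Algebra F K),
      Fintype.card K = Fintype.card F ^ n ∧ Nonempty (Module.Basis (Fin n) F K) := by
  obtain ⟨p, hp⟩ := CharP.exists F
  have : Fact p.Prime := ⟨CharP.char_is_prime F p⟩
  have : NeZero n := ⟨hn⟩
  refine ⟨FiniteField.Extension F p n, inferInstance, Fintype.ofFinite _, inferInstance, ?_,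
    ⟨Module.finBasisOfFinrankEq F _ (FiniteField.finrank_extension F p n)⟩⟩
  let := Fintype.ofFinite (FiniteField.Extension F p n)
  rw [← Nat.card_eq_fintype_card, ← Nat.card_eq_fintype_card, FiniteField.natCard_extension]

/-- A monic polynomial of degree `N` whose coefficients of degrees strictly between `N - w` and
`N` vanish takes the value of `T ↦ T ^ N - T` on at most `N - w` points, unless it is
`T ^ N - T`. -/
theorem card_add_le_of_coeff_eq_zero {K : Type*} [Field K] {N w : ℕ} (hN : 1 < N) (hw : w < N)
    (P : Polynomial K) (hP : P.Monic) (hdeg : P.natDegree = N)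
    (hcoeff : ∀ l, l < N → N < l + w → P.coeff l = 0)
    (hne : P ≠ Polynomial.X ^ N - Polynomial.X) (S : Finset K)
    (hS : ∀ y ∈ S, P.eval y = y ^ N - y) : S.card + w ≤ N := by
  classical
  let R := P - (Polynomial.X ^ N - Polynomial.X)
  have hR : R ≠ 0 := sub_ne_zero.2 hne
  have hRdeg : R.natDegree ≤ N - w := by
    rw [Polynomial.natDegree_le_iff_coeff_eq_zero]
    intro l hl
    have hl1 : l ≠ 1 := by omega
    simp only [R, Polynomial.coeff_sub, Polynomial.coeff_X_pow, Polynomial.coeff_X, hl1.symm,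
      if_false, sub_zero]
    rcases lt_trichotomy l N with h | rfl | h
    · simp [hcoeff l h (by omega), h.ne]
    · have := hP.coeff_natDegree
      rw [hdeg] at this
      simp [this]
    · simp [h.ne', Polynomial.coeff_eq_zero_of_natDegree_lt (hdeg ▸ h)]
  have := Polynomial.card_le_degree_of_subset_roots (p := R) (Z := S) fun y hy => by
    rw [Polynomial.mem_roots hR]
    simp [R, hS y hy]
  omega

/-- Let `f = (f_1,…,f_n) : 𝔽_q^n → 𝔽_q^n` be a polynomial map that involves
all `n` variables.  If `|V_f| < q^n`, then `|V_f| ≤ q^n − ω_f`, where `ω_f` is the integral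
dilation factor of the degree matrix of `f`. -/
theorem value_set_le_card_sub_omega
    (F : Type*) [Field F] [Fintype F]
    (n : ℕ) (hn : 0 < n) (f : Fin n → MvPolynomial (Fin n) F)
    -- the set of exponent vectors of the monomials of `f_1, …, f_n`
    (E : Finset (Fin n →₀ ℕ))
    (hE : E = Finset.univ.biUnion fun i => (f i).support)
    -- `f` involves all `n` variables
    (hall : ∀ i : Fin n, ∃ D ∈ E, 0 < D i)
    -- the integral dilation factor `ω_f`
    (ω : ℕ)
    (hω : ω = sInf {s : ℕ | ∃ k : (Fin n →₀ ℕ) → ℕ,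
        (∀ D ∈ E, k D ≤ Fintype.card F - 1) ∧
        (∀ i : Fin n, ∃ c : ℕ, 0 < c ∧
          ∑ D ∈ E, k D * D i = c * (Fintype.card F - 1)) ∧
        s = ∑ D ∈ E, k D})
    (hV : (Set.range fun x : Fin n → F => fun i => eval x (f i)).ncard
            < Fintype.card F ^ n) :
    ((Set.range fun x : Fin n → F => fun i => eval x (f i)).ncard : ℝ)
      ≤ (Fintype.card F : ℝ) ^ n - ω := by
  have hq : 1 < Fintype.card F := Fintype.one_lt_card
  have hω' : ω = sInf (dilationSums (Fintype.card F - 1) n E) := hω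
  have hN : 1 < Fintype.card F ^ n := Nat.one_lt_pow hn.ne' hq
  have hlt : ω < Fintype.card F ^ n := by
    have := sInf_dilationSums_lt (N := Fintype.card F - 1) (by omega) E hall
    rwa [Nat.sub_add_cancel hq.le, ← hω'] at this
  classical
  obtain ⟨K, _, _, _, hK, ⟨b⟩⟩ := exists_field_extension_of_degree F hn.ne'
  let P : Polynomial K :=
    ∏ x : Fin n → F, (Polynomial.X + Polynomial.C (∑ i, eval x (f i) • b i))
  let V : Set (Fin n → F) := Set.range fun x i => eval x (f i)
  let L : (Fin n → F) → K := fun v => -∑ i, v i • b i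
  have hL : Function.Injective L := fun v w h =>
    b.equivFun.symm.injective
      (by simpa [Module.Basis.equivFun_symm_apply] using neg_injective h)
  let S : Finset K := V.toFinset.image L
  have hS : S.card = V.ncard := by
    rw [Finset.card_image_of_injective _ hL, Set.ncard_eq_toFinset_card']
  have hroot : ∀ y, P.eval y = 0 ↔ y ∈ S := by
    intro y
    simp only [P, S, V, L, Polynomial.eval_prod, Finset.prod_eq_zero_iff, Finset.mem_image,
      Set.mem_toFinset, Set.mem_range, Polynomial.eval_add, Polynomial.eval_X, Polynomial.eval_C]
    constructor
    · rintro ⟨x, -, hx⟩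
      exact ⟨_, ⟨x, rfl⟩, (eq_neg_of_add_eq_zero_left hx).symm⟩
    · rintro ⟨_, ⟨x, rfl⟩, rfl⟩
      exact ⟨x, Finset.mem_univ _, by simp⟩
  have hpow : ∀ y : K, y ^ Fintype.card F ^ n - y = 0 := fun y => by
    rw [← hK, FiniteField.pow_card, sub_self]
  have key := card_add_le_of_coeff_eq_zero hN hlt P
    (Polynomial.monic_prod_of_monic _ _ fun x _ => Polynomial.monic_X_add_C _)
    (by
      rw [Polynomial.natDegree_prod_of_monic _ _ fun x _ => Polynomial.monic_X_add_C _]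
      simp only [Polynomial.natDegree_X_add_C]
      simp)
    (fun l hl hl' => coeff_prod_X_add_C_eq_zero f b E hE hall l hl (hω' ▸ hl'))
    (by
      intro h
      have huniv : S = Finset.univ := Finset.eq_univ_iff_forall.2 fun y => by
        rw [← hroot, h]
        simpa using hpow y
      rw [huniv, Finset.card_univ, hK] at hS
      exact hV.ne hS.symm)
    S (fun y hy => by rw [hpow, (hroot y).2 hy])
  rw [hS] at key
  rw [le_sub_iff_add_le]
  exact_mod_cast key
end

section
/- Let f = (f_1,…,f_n) : 𝔽_q^n → 𝔽_q^n be a polynomial map that involves all n variables. If |V_f| < q^n, then |V_f| ≤ q^n − μ_f·(q−1) (an inequality of real numbers). -/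
open MvPolynomial Pointwise

/-- `L` is a logarithmic derivative `X P' / P` of `P`, and its coefficients satisfy the
divisibility which forces `P ≡ 1` modulo `p` in degrees below `N`. -/
structure IsSmallLogDeriv {R : Type*} [CommRing R] (p N : ℕ) (P L : PowerSeries R) : Prop where
  constantCoeff_eq : PowerSeries.constantCoeff P = 1
  X_mul_derivative : PowerSeries.X * PowerSeries.derivative R P = P * L
  dvd : ∀ i, 0 < i → i < N → (p : R) ^ (padicValNat p i + 1) ∣ PowerSeries.coeff i L

theorem IsSmallLogDeriv.mul {R : Type*} [CommRing R] {p N : ℕ} {P L P' L' : PowerSeries R}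
    (h : IsSmallLogDeriv p N P L) (h' : IsSmallLogDeriv p N P' L') :
    IsSmallLogDeriv p N (P * P') (L + L') where
  constantCoeff_eq := by simp [h.constantCoeff_eq, h'.constantCoeff_eq]
  X_mul_derivative := by
    rw [Derivation.leibniz, smul_eq_mul, smul_eq_mul]
    linear_combination P * h'.X_mul_derivative + P' * h.X_mul_derivative
  dvd i hi hN := by
    rw [map_add]
    exact dvd_add (h.dvd i hi hN) (h'.dvd i hi hN)

/-- The logarithmic derivative of `1 - c X ^ m`. -/
noncomputable def logDerivOneSub {R : Type*} [CommRing R] (c : R) (m : ℕ) : PowerSeries R :=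
  PowerSeries.mk fun i => if m ∣ i ∧ i ≠ 0 then -(m * c ^ (i / m)) else 0

theorem X_mul_derivative_one_sub {R : Type*} [CommRing R] (c : R) {m : ℕ} (hm : 0 < m) :
    PowerSeries.X * PowerSeries.derivative R (1 - PowerSeries.C c * PowerSeries.X ^ m) =
      (1 - PowerSeries.C c * PowerSeries.X ^ m) * logDerivOneSub c m := by
  have h : PowerSeries.X * PowerSeries.derivative R (1 - PowerSeries.C c * PowerSeries.X ^ m) =
      -PowerSeries.C (m * c) * PowerSeries.X ^ m := by
    rw [map_sub, PowerSeries.derivative_one, Derivation.leibniz, PowerSeries.derivative_C,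
      PowerSeries.derivative_pow, PowerSeries.derivative_X]
    obtain ⟨k, rfl⟩ : ∃ k, m = k + 1 := ⟨m - 1, by omega⟩
    simp only [smul_eq_mul, Nat.add_sub_cancel, map_mul, map_natCast]
    ring
  rw [h, sub_mul, one_mul, mul_assoc, neg_mul]
  ext i
  simp only [map_sub, map_neg, PowerSeries.coeff_C_mul, PowerSeries.coeff_X_pow_mul',
    PowerSeries.coeff_X_pow, logDerivOneSub, PowerSeries.coeff_mk]
  rcases lt_trichotomy i m with hi | rfl | hi
  · have : ¬ (m ∣ i ∧ i ≠ 0) := fun ⟨h1, h2⟩ =>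
      absurd (Nat.le_of_dvd (Nat.pos_of_ne_zero h2) h1) (by omega)
    simp [this, hi.ne, not_le.2 hi]
  · simp [hm, hm.ne']
  · obtain ⟨k, rfl⟩ := Nat.exists_eq_add_of_lt hi
    have h1 : (m + k + 1) / m = (m + k + 1 - m) / m + 1 := by
      rw [← Nat.add_div_right _ hm]; congr 1; omega
    have h2 : m ∣ m + k + 1 ↔ m ∣ m + k + 1 - m := by
      conv_lhs => rw [show m + k + 1 = (m + k + 1 - m) + m by omega, Nat.dvd_add_self_right]
    rw [h1]
    simp only [h2]
    have h3 : m + k + 1 - m ≠ 0 := by omega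
    have h4 : m + k + 1 ≠ 0 := by omega
    by_cases h5 : m ∣ m + k + 1 - m
    · simp only [h5, h3, h4, hi.ne', hi.le, ne_eq, not_false_eq_true, and_self, if_true, if_false]
      ring
    · simp [h5, hi.ne']

theorem padicValNat_lt_of_pos {p k : ℕ} (hk : 0 < k) : padicValNat p k < k := by
  rcases lt_or_ge p 2 with hp | hp
  · interval_cases p <;> simpa
  · exact (padicValNat_le_nat_log k).trans_lt (Nat.log_lt_self p hk.ne')

theorem isSmallLogDeriv_one_sub {R : Type*} [CommRing R] {p : ℕ} [Fact p.Prime] (N : ℕ) {c : R}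
    (hc : (p : R) ∣ c) {m : ℕ} (hm : 0 < m) :
    IsSmallLogDeriv p N (1 - PowerSeries.C c * PowerSeries.X ^ m) (logDerivOneSub c m) where
  constantCoeff_eq := by simp [hm.ne']
  X_mul_derivative := X_mul_derivative_one_sub c hm
  dvd i hi _ := by
    rw [logDerivOneSub, PowerSeries.coeff_mk]
    split_ifs with h
    · obtain ⟨⟨k, rfl⟩, h0⟩ := h
      have hk : 0 < k := Nat.pos_of_ne_zero fun hk => by simp [hk] at h0
      rw [Nat.mul_div_cancel_left _ hm, dvd_neg, padicValNat.mul hm.ne' hk.ne', add_assoc, pow_add]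
      refine mul_dvd_mul ?_ ((pow_dvd_pow _ (padicValNat_lt_of_pos hk)).trans (pow_dvd_pow_of_dvd hc k))
      exact_mod_cast Nat.cast_dvd_cast (α := R) (pow_padicValNat_dvd (p := p) (n := m))
    · exact dvd_zero _

theorem dvd_of_pow_dvd_natCast_mul {R : Type*} [CommRing R] [IsDomain R] {p : ℕ} [hp : Fact p.Prime]
    (hR : (p : R) ≠ 0) {m : ℕ} (hm : 0 < m) {a : R}
    (h : (p : R) ^ (padicValNat p m + 1) ∣ m * a) : (p : R) ∣ a := by
  obtain ⟨k, hk⟩ := pow_padicValNat_dvd (p := p) (n := m)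
  have hpk : ¬ p ∣ k := by
    intro hpk
    apply pow_succ_padicValNat_not_dvd (p := p) hm.ne'
    rw [pow_succ]
    exact (mul_dvd_mul_left _ hpk).trans hk.symm.dvd
  have h1 : (m : R) = (p : R) ^ padicValNat p m * k := by exact_mod_cast congrArg (Nat.cast (R := R)) hk
  rw [h1, pow_succ, mul_assoc] at h
  have h2 := (mul_dvd_mul_iff_left (pow_ne_zero _ hR)).1 h
  have h3 : IsCoprime (p : R) (k : R) := by
    have := (Nat.isCoprime_iff_coprime.2 ((Nat.Prime.coprime_iff_not_dvd hp.out).2 hpk)).map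
      (Int.castRingHom R)
    simpa using this
  exact h3.dvd_of_dvd_mul_left h2

theorem IsSmallLogDeriv.dvd_coeff_of_forall_eq_zero {R : Type*} [CommRing R] [IsDomain R] {p : ℕ}
    [Fact p.Prime] (hR : (p : R) ≠ 0) {N : ℕ} {P L : PowerSeries R} (h : IsSmallLogDeriv p N P L)
    {m : ℕ} (hm : 0 < m) (hN : m < N) (hP : ∀ i, 0 < i → i < m → PowerSeries.coeff i P = 0) :
    (p : R) ∣ PowerSeries.coeff m P := by
  have hL : PowerSeries.coeff 0 L = 0 := by
    have := congrArg PowerSeries.constantCoeff h.X_mul_derivative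
    simpa [h.constantCoeff_eq] using this.symm
  obtain ⟨k, rfl⟩ : ∃ k, m = k + 1 := ⟨m - 1, by omega⟩
  have key := congrArg (PowerSeries.coeff (k + 1)) h.X_mul_derivative
  rw [PowerSeries.coeff_succ_X_mul, PowerSeries.coeff_derivative, PowerSeries.coeff_mul,
    Finset.sum_eq_single (0, k + 1)] at key
  · simp only [PowerSeries.coeff_zero_eq_constantCoeff, h.constantCoeff_eq, one_mul] at key
    apply dvd_of_pow_dvd_natCast_mul hR hm
    rw [mul_comm]
    push_cast
    rw [key]
    exact h.dvd _ hm hN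
  · rintro ⟨i, j⟩ hij hne
    replace hij : i + j = k + 1 := by simpa using hij
    dsimp only
    rcases Nat.eq_zero_or_pos j with rfl | hj
    · rw [hL, mul_zero]
    · rw [hP i (Nat.pos_of_ne_zero fun hi => hne (by subst hi; simp_all)) (by omega), zero_mul]
  · simp

theorem IsSmallLogDeriv.exists_forall_eq_zero {R : Type*} [CommRing R] [IsDomain R] {p : ℕ}
    [Fact p.Prime] (hR : (p : R) ≠ 0) {N : ℕ} {P L : PowerSeries R} (h : IsSmallLogDeriv p N P L)
    {m : ℕ} (hN : m < N) :
    ∃ P' L', IsSmallLogDeriv p N P' L' ∧ (∀ i, 0 < i → i ≤ m → PowerSeries.coeff i P' = 0) ∧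
      PowerSeries.C (p : R) ∣ P - P' := by
  induction m with
  | zero => exact ⟨P, L, h, fun i h1 h2 => by omega, by simp⟩
  | succ m ih =>
    obtain ⟨P', L', h', hz, hd⟩ := ih (by omega)
    have ha := h'.dvd_coeff_of_forall_eq_zero hR m.succ_pos hN fun i h1 h2 => hz i h1 (by omega)
    set a := PowerSeries.coeff (m + 1) P' with ha'
    refine ⟨_, _, h'.mul (isSmallLogDeriv_one_sub N ha m.succ_pos), fun i hi him => ?_, ?_⟩
    · rw [mul_sub, mul_one, map_sub, mul_left_comm, PowerSeries.coeff_C_mul,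
        PowerSeries.coeff_mul_X_pow']
      rcases him.lt_or_eq with h1 | rfl
      · simp [hz i hi (by omega), not_le.2 h1]
      · simp [← ha', h'.constantCoeff_eq]
    · have h2 : P - P' * (1 - PowerSeries.C a * PowerSeries.X ^ (m + 1)) =
          (P - P') + PowerSeries.C a * (P' * PowerSeries.X ^ (m + 1)) := by ring
      rw [h2]
      exact dvd_add hd ((map_dvd _ ha).mul_right _)

theorem IsSmallLogDeriv.dvd_coeff {R : Type*} [CommRing R] [IsDomain R] {p : ℕ}
    [Fact p.Prime] (hR : (p : R) ≠ 0) {N : ℕ} {P L : PowerSeries R} (h : IsSmallLogDeriv p N P L)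
    {m : ℕ} (hm : 0 < m) (hN : m < N) : (p : R) ∣ PowerSeries.coeff m P := by
  obtain ⟨P', L', -, hz, Q, hQ⟩ := h.exists_forall_eq_zero hR hN
  refine ⟨PowerSeries.coeff m Q, ?_⟩
  rw [← PowerSeries.coeff_C_mul, ← hQ, map_sub, hz m hm le_rfl, sub_zero]

theorem dvd_coeff_prod_one_sub {R ι : Type*} [CommRing R] [IsDomain R] {p : ℕ} [Fact p.Prime]
    (hR : (p : R) ≠ 0) (s : Finset ι) (a : ι → R) {N : ℕ}
    (h : ∀ j, 0 < j → j < N → (p : R) ^ (padicValNat p j + 1) ∣ ∑ i ∈ s, a i ^ j)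
    {m : ℕ} (hm : 0 < m) (hN : m < N) :
    (p : R) ∣ PowerSeries.coeff m (∏ i ∈ s, (1 - PowerSeries.C (a i) * PowerSeries.X)) := by
  refine IsSmallLogDeriv.dvd_coeff (L := ∑ i ∈ s, logDerivOneSub (a i) 1) hR ⟨?_, ?_, ?_⟩ hm hN
  · simp [map_prod]
  · clear h
    classical
    induction s using Finset.induction_on with
    | empty => simp
    | insert i s hi ih =>
      have h1 := X_mul_derivative_one_sub (a i) one_pos
      rw [pow_one] at h1
      rw [Finset.prod_insert hi, Finset.sum_insert hi, Derivation.leibniz, smul_eq_mul, smul_eq_mul]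
      linear_combination (1 - PowerSeries.C (a i) * PowerSeries.X) * ih +
        (∏ i ∈ s, (1 - PowerSeries.C (a i) * PowerSeries.X)) * h1
  · intro i hi hiN
    have h2 := (h i hi hiN).neg_right
    simpa [logDerivOneSub, hi.ne'] using h2

theorem reflect_prod_X_sub_C {R ι : Type*} [CommRing R] (s : Finset ι) (a : ι → R) :
    (∏ i ∈ s, (Polynomial.X - Polynomial.C (a i))).reflect s.card =
      ∏ i ∈ s, (1 - Polynomial.C (a i) * Polynomial.X) := by
  classical
  induction s using Finset.induction_on with
  | empty => simp
  | insert i s hi ih =>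
    rw [Finset.prod_insert hi, Finset.prod_insert hi, Finset.card_insert_of_notMem hi, add_comm,
      Polynomial.reflect_mul _ _ (Polynomial.natDegree_X_sub_C_le _), ih]
    · congr 1
      rw [Polynomial.reflect_sub, Polynomial.reflect_C, pow_one, Polynomial.reflect_one_X]
    · refine (Polynomial.natDegree_prod_le _ _).trans ?_
      simpa using Finset.sum_le_sum fun i (_ : i ∈ s) => Polynomial.natDegree_X_sub_C_le (a i)

theorem dvd_coeff_prod_X_sub_C {R ι : Type*} [CommRing R] [IsDomain R] {p : ℕ} [Fact p.Prime]
    (hR : (p : R) ≠ 0) (s : Finset ι) (a : ι → R) {N : ℕ}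
    (h : ∀ j, 0 < j → j < N → (p : R) ^ (padicValNat p j + 1) ∣ ∑ i ∈ s, a i ^ j)
    {m : ℕ} (hm : m < s.card) (hN : s.card - m < N) :
    (p : R) ∣ (∏ i ∈ s, (Polynomial.X - Polynomial.C (a i))).coeff m := by
  have h1 := dvd_coeff_prod_one_sub hR s a h (m := s.card - m) (by omega) hN
  have h2 : ∏ i ∈ s, (1 - PowerSeries.C (a i) * PowerSeries.X) =
      ((∏ i ∈ s, (1 - Polynomial.C (a i) * Polynomial.X) : Polynomial R) : PowerSeries R) := by
    rw [← Polynomial.coeToPowerSeries.ringHom_apply, map_prod]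
    simp
  rwa [h2, Polynomial.coeff_coe, ← reflect_prod_X_sub_C, Polynomial.coeff_reflect,
    Polynomial.revAt_le (Nat.sub_le _ _), Nat.sub_sub_self hm.le] at h1

theorem exists_unit_pow_ne_one (F : Type*) [Field F] [Fintype F] {w : ℕ}
    (hw : ¬ (Fintype.card F - 1) ∣ w) : ∃ u : Fˣ, u ^ w ≠ 1 := by
  obtain ⟨u, hu⟩ := IsCyclic.exists_generator (α := Fˣ)
  refine ⟨u, fun h => hw ?_⟩
  rw [← orderOf_dvd_iff_pow_eq_one, orderOf_eq_card_of_forall_mem_zpowers hu] at h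
  classical
  rwa [Nat.card_eq_fintype_card, Fintype.card_units] at h

theorem sum_monoidHom_pow_eq_zero {F W : Type*} [Field F] [Fintype F] [CommRing W] [IsDomain W]
    {τ : F →* W} (hτ : Function.Injective τ) {w : ℕ} (hw : ¬ (Fintype.card F - 1) ∣ w) :
    ∑ t, τ t ^ w = 0 := by
  obtain ⟨u, hu⟩ := exists_unit_pow_ne_one F hw
  have h1 : τ u ^ w * ∑ t, τ t ^ w = ∑ t, τ t ^ w := by
    rw [Finset.mul_sum, ← Equiv.sum_comp (Equiv.mulLeft₀ (u : F) u.ne_zero) fun t => τ t ^ w]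
    simp [mul_pow]
  have h2 : τ u ^ w ≠ 1 := by
    rw [← map_pow, ← map_one τ, hτ.ne_iff]
    exact fun h => hu (Units.ext (by simpa using h))
  by_contra h
  exact h2 (mul_right_cancel₀ h (h1.trans (one_mul _).symm))

theorem card_pow_dvd_sum_prod {F W ι : Type*} [Field F] [Fintype F] [CommRing W] [Fintype ι]
    [DecidableEq ι] (τ : F →* W) (w : ι → ℕ) :
    (Fintype.card F : W) ^ (Finset.univ.filter fun i => w i = 0).card ∣
      ∑ x : ι → F, ∏ i, τ (x i) ^ w i := by
  rw [← Fintype.prod_sum (fun i t => τ t ^ w i),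
    ← Finset.prod_filter_mul_prod_filter_not Finset.univ fun i => w i = 0]
  refine Dvd.dvd.mul_right (dvd_of_eq ?_) _
  rw [Finset.prod_congr rfl (g := fun _ => (Fintype.card F : W)), Finset.prod_const]
  intro i hi
  simp [(Finset.mem_filter.1 hi).2]

theorem sum_dvd_mul_multinomial {α : Type*} [DecidableEq α] {s : Finset α} {a : α} (ha : a ∈ s)
    (r : α → ℕ) : ∑ i ∈ s, r i ∣ r a * Nat.multinomial s r := by
  rw [← Finset.insert_erase ha, Nat.multinomial_insert (Finset.notMem_erase a s),
    Finset.sum_insert (Finset.notMem_erase a s), ← mul_assoc]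
  refine Dvd.dvd.mul_right ?_ _
  rcases r a with _ | k
  · simp
  · rw [show k + 1 + ∑ i ∈ s.erase a, r i = k + ∑ i ∈ s.erase a, r i + 1 by omega, mul_comm (k + 1),
      ← Nat.add_one_mul_choose_eq]
    exact dvd_mul_right _ _

theorem mul_le_pow_sub_one {q : ℕ} (hq : 1 ≤ q) (z : ℕ) : z * ((q : ℝ) - 1) ≤ (q : ℝ) ^ z - 1 := by
  have hq' : (1 : ℝ) ≤ q := by exact_mod_cast hq
  have := one_add_mul_le_pow (a := (q : ℝ) - 1) (by linarith) z
  rw [add_sub_cancel] at this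
  linarith

/-- The number `μ` is at most the total of any rational weights on `E` whose weighted sum is a
lattice point, plus the number of zero coordinates of that point. -/
def DilationBound {n : ℕ} (E : Finset (Fin n →₀ ℕ)) (μ : ℝ) : Prop :=
  ∀ (r : (Fin n →₀ ℕ) → ℕ) (M : ℕ), 0 < M → (∀ i, M ∣ ∑ D ∈ E, r D * D i) →
    μ ≤ (∑ D ∈ E, r D : ℕ) / M + (Finset.univ.filter fun i => ∑ D ∈ E, r D * D i = 0).card

theorem DilationBound.exists_not_dvd {n : ℕ} {E : Finset (Fin n →₀ ℕ)} {μ : ℝ}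
    (h : DilationBound E μ) {q : ℕ} (hq : 2 ≤ q) {r : (Fin n →₀ ℕ) → ℕ}
    (hpos : 0 < ∑ D ∈ E, r D) (hlt : (∑ D ∈ E, r D : ℕ) < μ * (q - 1 : ℝ))
    (hdvd : ∀ i, q - 1 ∣ ∑ D ∈ E, r D * D i) :
    ∃ D ∈ E, ¬ q ^ (Finset.univ.filter fun i => ∑ D ∈ E, r D * D i = 0).card ∣ r D := by
  by_contra! hall
  set z := (Finset.univ.filter fun i => ∑ D ∈ E, r D * D i = 0).card with hz
  obtain ⟨J, hJ⟩ : q ^ z ∣ ∑ D ∈ E, r D := Finset.dvd_sum hall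
  have hq0 : 0 < q ^ z := by positivity
  have hJ0 : 0 < J := Nat.pos_of_ne_zero fun h0 => by simp [hJ, h0] at hpos
  have hcop : Nat.Coprime (q ^ z) (q - 1) := by
    refine Nat.Coprime.pow_left _ ?_
    obtain ⟨k, rfl⟩ : ∃ k, q = k + 1 := ⟨q - 1, by omega⟩
    simp
  have hM := h r (q ^ z * (q - 1)) (Nat.mul_pos hq0 (by omega)) fun i =>
    hcop.mul_dvd_of_dvd_of_dvd (Finset.dvd_sum fun D hD => (hall D hD).mul_right _) (hdvd i)
  rw [← hz, hJ] at hM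
  rw [hJ] at hlt
  have hq1 : (0 : ℝ) < (q : ℝ) - 1 := by
    have : (2 : ℝ) ≤ q := by exact_mod_cast hq
    linarith
  have hqz : (0 : ℝ) < (q : ℝ) ^ z := by exact_mod_cast hq0
  have hJ1 : (1 : ℝ) ≤ J := by exact_mod_cast hJ0
  push_cast [Nat.cast_sub (show 1 ≤ q by omega)] at hM hlt
  rw [mul_div_mul_left _ _ hqz.ne'] at hM
  have h1 := mul_le_mul_of_nonneg_right hM hq1.le
  rw [add_mul, div_mul_cancel₀ _ hq1.ne'] at h1
  have h2 := mul_le_pow_sub_one (show 1 ≤ q by omega) z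
  have h3 : (1 : ℝ) ≤ (q : ℝ) ^ z := one_le_pow₀ (by linarith)
  nlinarith

theorem pow_dvd_sum_pow {F W : Type*} [Field F] [Fintype F] [CommRing W] [IsDomain W]
    {τ : F →* W} (hτ : Function.Injective τ) {p a : ℕ} [hp : Fact p.Prime]
    (hq : Fintype.card F = p ^ a) {n : ℕ} {E : Finset (Fin n →₀ ℕ)} {μ : ℝ}
    (h : DilationBound E μ) (A : (Fin n →₀ ℕ) → W) {j : ℕ} (hj : 0 < j)
    (hlt : j < μ * (Fintype.card F - 1 : ℝ)) :
    (p : W) ^ (padicValNat p j + 1) ∣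
      ∑ x : Fin n → F, (∑ D ∈ E, A D * ∏ i, τ (x i) ^ D i) ^ j := by
  classical
  simp_rw [Finset.sum_pow_eq_sum_piAntidiag]
  rw [Finset.sum_comm]
  refine Finset.dvd_sum fun r hr => ?_
  have hsum := (Finset.mem_piAntidiag.1 hr).1
  have hx : ∀ x : Fin n → F, (Nat.multinomial E r : W) * ∏ D ∈ E, (A D * ∏ i, τ (x i) ^ D i) ^ r D =
      (Nat.multinomial E r * ∏ D ∈ E, A D ^ r D) * ∏ i, τ (x i) ^ ∑ D ∈ E, r D * D i := by
    intro x
    simp_rw [mul_pow, Finset.prod_mul_distrib, ← Finset.prod_pow, mul_assoc]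
    congr 2
    rw [Finset.prod_comm]
    refine Finset.prod_congr rfl fun i _ => ?_
    rw [← Finset.prod_pow_eq_pow_sum]
    exact Finset.prod_congr rfl fun D _ => by rw [← pow_mul, mul_comm]
  simp_rw [hx]
  rw [← Finset.mul_sum]
  by_cases hdvd : ∀ i, Fintype.card F - 1 ∣ ∑ D ∈ E, r D * D i
  · obtain ⟨D, hD, hDq⟩ := h.exists_not_dvd (q := Fintype.card F) Fintype.one_lt_card
      (r := r) (hsum ▸ hj) (by rwa [hsum]) hdvd
    have hz := card_pow_dvd_sum_prod τ fun i => ∑ D ∈ E, r D * D i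
    set z := (Finset.univ.filter fun i => ∑ D ∈ E, r D * D i = 0).card
    refine Dvd.dvd.trans ?_ (mul_dvd_mul (dvd_mul_right _ _) hz)
    have hr0 : r D ≠ 0 := fun h0 => hDq (by simp [h0])
    have hm0 : Nat.multinomial E r ≠ 0 := (Nat.multinomial_pos _ _).ne'
    have hv : padicValNat p j ≤ padicValNat p (r D) + padicValNat p (Nat.multinomial E r) := by
      rw [← padicValNat.mul hr0 hm0]
      have := sum_dvd_mul_multinomial hD r
      rw [hsum] at this
      exact (padicValNat_dvd_iff_le (mul_ne_zero hr0 hm0)).1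
        (pow_padicValNat_dvd.trans this)
    have hvz : padicValNat p (r D) < a * z := by
      by_contra! hle
      apply hDq
      rw [hq, ← pow_mul]
      exact (pow_dvd_pow p hle).trans pow_padicValNat_dvd
    have hnat : p ^ (padicValNat p j + 1) ∣ Nat.multinomial E r * Fintype.card F ^ z := by
      rw [hq, ← pow_mul]
      refine (pow_dvd_pow p (show padicValNat p j + 1 ≤
        padicValNat p (Nat.multinomial E r) + a * z by omega)).trans ?_
      rw [pow_add]
      exact mul_dvd_mul_right pow_padicValNat_dvd _
    exact_mod_cast Nat.cast_dvd_cast (α := W) hnat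
  · push Not at hdvd
    obtain ⟨i, hi⟩ := hdvd
    rw [← Fintype.prod_sum (fun i t => τ t ^ ∑ D ∈ E, r D * D i),
      Finset.prod_eq_zero (Finset.mem_univ i) (sum_monoidHom_pow_eq_zero hτ hi), mul_zero]
    exact dvd_zero _

/-- The Newton polytope spanned by `0` and the exponent vectors in `E`. -/
def newtonPolytope {n : ℕ} (E : Finset (Fin n →₀ ℕ)) : Set (Fin n → ℝ) :=
  convexHull ℝ ({0} ∪ {x : Fin n → ℝ | ∃ D ∈ E, x = fun i => (D i : ℝ)})

/-- The infimum of the dilation factors that put a strictly positive lattice point into the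
Newton polytope. -/
noncomputable def minDilation {n : ℕ} (E : Finset (Fin n →₀ ℕ)) : ℝ :=
  sInf {k : ℝ | 0 < k ∧ ∃ v ∈ k • newtonPolytope E, ∀ i : Fin n, ∃ m : ℕ, 0 < m ∧ v i = m}

theorem minDilation_le_sum {n : ℕ} (hn : 0 < n) {E : Finset (Fin n →₀ ℕ)} (c : (Fin n →₀ ℕ) → ℝ)
    (hc : ∀ D, 0 ≤ c D)
    (h : ∀ i, ∃ m : ℕ, 0 < m ∧ ∑ D ∈ insert 0 E, c D * D i = m) :
    minDilation E ≤ ∑ D ∈ insert 0 E, c D := by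
  have hpos : 0 < ∑ D ∈ insert 0 E, c D := by
    refine (Finset.sum_nonneg fun D _ => hc D).lt_of_ne fun h0 => ?_
    have hz := (Finset.sum_eq_zero_iff_of_nonneg fun D _ => hc D).1 h0.symm
    obtain ⟨m, hm, hs⟩ := h ⟨0, hn⟩
    rw [Finset.sum_eq_zero fun D hD => by rw [hz D hD, zero_mul]] at hs
    exact hm.ne (by exact_mod_cast hs)
  refine csInf_le ⟨0, fun k hk => hk.1.le⟩ ⟨hpos, fun i => ∑ D ∈ insert 0 E, c D * D i, ?_, h⟩
  rw [Set.mem_smul_set_iff_inv_smul_mem₀ hpos.ne']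
  have hmem : _ ∈ newtonPolytope E := Finset.centerMass_mem_convexHull (R := ℝ) (insert 0 E)
    (w := c) (z := fun D i => (D i : ℝ)) (fun D _ => hc D) hpos fun D hD => by
      rcases Finset.mem_insert.1 hD with rfl | hD
      · exact Or.inl (by ext; simp)
      · exact Or.inr ⟨D, hD, rfl⟩
  convert hmem using 1
  ext i
  simp [Finset.centerMass]

theorem dilationBound_minDilation {n : ℕ} (hn : 0 < n) {E : Finset (Fin n →₀ ℕ)}
    (hall : ∀ i : Fin n, ∃ D ∈ E, 0 < D i) : DilationBound (insert 0 E) (minDilation E) := by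
  classical
  intro r M hM hdvd
  choose d hdE hd using hall
  set Z := Finset.univ.filter fun i => ∑ D ∈ insert 0 E, r D * D i = 0
  have hM' : (M : ℝ) ≠ 0 := by exact_mod_cast hM.ne'
  refine (minDilation_le_sum hn (fun D => (r D : ℝ) / M + ∑ i ∈ Z, if d i = D then 1 else 0)
    (fun D => by positivity) fun i => ?_).trans_eq ?_
  · obtain ⟨k, hk⟩ := hdvd i
    refine ⟨k + ∑ l ∈ Z, d l i, ?_, ?_⟩
    · by_cases hi : i ∈ Z
      · have h1 : d i i ≤ ∑ l ∈ Z, d l i :=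
          Finset.single_le_sum (f := fun l => d l i) (fun l _ => Nat.zero_le _) hi
        have := hd i
        omega
      · have hk0 : k ≠ 0 := by
          rintro rfl
          exact hi (Finset.mem_filter.2 ⟨Finset.mem_univ _, by simpa using hk⟩)
        omega
    · have hk' : ∑ D ∈ insert 0 E, (r D : ℝ) * D i = M * k := by exact_mod_cast hk
      simp_rw [add_mul, Finset.sum_add_distrib, div_mul_eq_mul_div, ← Finset.sum_div, hk',
        Finset.sum_mul]
      rw [mul_div_cancel_left₀ _ hM', Finset.sum_comm]
      simp [hdE]
  · rw [Finset.sum_add_distrib, ← Finset.sum_div, Finset.sum_comm]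
    simp [hdE]

theorem ncard_range_le_of_coeff_eq_zero {K ι : Type*} [Field K] [Fintype K] [Fintype ι]
    (hι : Fintype.card ι = Fintype.card K) {φ : ι → K} (hφ : ∀ x, φ x ≠ 0) {B : ℝ}
    (hB : B ≤ (Fintype.card K : ℝ) - 1)
    (h : ∀ m < Fintype.card K, (Fintype.card K : ℝ) - m < B →
      (∏ x, (Polynomial.X - Polynomial.C (φ x))).coeff m = 0) :
    ((Set.range φ).ncard : ℝ) ≤ Fintype.card K - B := by
  classical
  by_contra! hlt
  set N := Fintype.card K with hN
  set P := ∏ x, (Polynomial.X - Polynomial.C (φ x)) with hP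
  have hmonic : P.Monic := Polynomial.monic_prod_X_sub_C _ _
  have hdeg : P.natDegree = N := by
    rw [hP, Polynomial.natDegree_finsetProd_X_sub_C_eq_card, Finset.card_univ, hι]
  set V := Finset.univ.image φ with hV
  have hVcard : (Set.range φ).ncard = V.card := by
    rw [← Set.ncard_coe_finset, hV, Finset.coe_image, Finset.coe_univ, Set.image_univ]
  rw [hVcard] at hlt
  have hP0 : P.eval 0 ≠ 0 := by
    rw [hP, Polynomial.eval_prod]
    exact Finset.prod_ne_zero_iff.2 fun x _ => by simpa using hφ x
  have hN1 : 1 < N := Fintype.one_lt_card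
  have hV0 : 0 < V.card := by
    have : Nonempty ι := Fintype.card_pos_iff.1 (by omega)
    exact Finset.card_pos.2 (Finset.univ_nonempty.image φ)
  set H := P - (Polynomial.X ^ N - Polynomial.X) with hH
  have hHdeg : H.natDegree < V.card := by
    suffices H.natDegree ≤ V.card - 1 by omega
    refine Polynomial.natDegree_le_iff_coeff_eq_zero.2 fun m hm => ?_
    have hVm : (V.card : ℝ) ≤ m := by exact_mod_cast (show V.card ≤ m by omega)
    rw [hH, Polynomial.coeff_sub, Polynomial.coeff_sub, Polynomial.coeff_X_pow, Polynomial.coeff_X]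
    rcases lt_trichotomy m N with hmN | hmN | hmN
    · have hm1 : 1 < m := by exact_mod_cast (show (1 : ℝ) < m by linarith)
      rw [h m hmN (by linarith), if_neg hmN.ne, if_neg hm1.ne]
      simp
    · have hcoeff : P.coeff N = 1 := hdeg ▸ hmonic.coeff_natDegree
      rw [hmN, hcoeff, if_pos rfl, if_neg hN1.ne]
      simp
    · rw [Polynomial.coeff_eq_zero_of_natDegree_lt (hdeg ▸ hmN), if_neg hmN.ne',
        if_neg (by omega)]
      simp
  have hHroot : ∀ y ∈ V, H.eval y = 0 := by
    intro y hy
    obtain ⟨x, -, rfl⟩ := Finset.mem_image.1 hy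
    have : P.eval (φ x) = 0 := by
      rw [hP, Polynomial.eval_prod]
      exact Finset.prod_eq_zero (Finset.mem_univ x) (by simp)
    simp [hH, this, hN, FiniteField.pow_card]
  have hH0 := Polynomial.eq_zero_of_natDegree_lt_card_of_eval_eq_zero' H V hHroot hHdeg
  apply hP0
  have := congrArg (Polynomial.eval 0) hH0
  simpa [hH, show N ≠ 0 by omega] using this

theorem eval_eq_sum_of_support_subset {F σ : Type*} [CommRing F] [Fintype σ]
    {g : MvPolynomial σ F} {E : Finset (σ →₀ ℕ)} (h : g.support ⊆ E) (x : σ → F) :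
    eval x g = ∑ D ∈ E, coeff D g * ∏ i, x i ^ D i := by
  rw [eval_eq']
  exact Finset.sum_subset h fun D _ hD => by rw [notMem_support_iff.1 hD, zero_mul]

theorem support_sub_C_subset {F σ : Type*} [CommRing F] [DecidableEq σ]
    (g : MvPolynomial σ F) (c : F) : (g - C c).support ⊆ insert 0 g.support := by
  intro D hD
  by_cases h : D = 0
  · simp [h]
  · rw [mem_support_iff, coeff_sub, coeff_C, if_neg (Ne.symm h), sub_zero] at hD
    exact Finset.mem_insert_of_mem (mem_support_iff.2 hD)

theorem ncard_range_eval_le {F : Type*} [Field F] [Fintype F] {n : ℕ} (hn : 0 < n)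
    (f : Fin n → MvPolynomial (Fin n) F) {E : Finset (Fin n →₀ ℕ)}
    (hf : ∀ i, (f i).support ⊆ E) {μ : ℝ} (hμ : DilationBound (insert 0 E) μ)
    (hμn : μ ≤ n) {c : Fin n → F} (hc : c ∉ Set.range fun x : Fin n → F => fun i => eval x (f i)) :
    ((Set.range fun x : Fin n → F => fun i => eval x (f i)).ncard : ℝ)
      ≤ (Fintype.card F : ℝ) ^ n - μ * (Fintype.card F - 1) := by
  classical
  obtain ⟨p, hpF⟩ := CharP.exists F
  obtain ⟨a, hp, hq⟩ := FiniteField.card F p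
  have : Fact p.Prime := ⟨hp⟩
  have : NeZero n := ⟨hn.ne'⟩
  let K := FiniteField.Extension F p n
  let _ : Fintype K := Fintype.ofFinite K
  have : CharP K p := charP_of_injective_algebraMap (algebraMap F K).injective p
  let b : Module.Basis (Fin n) F K :=
    Module.finBasisOfFinrankEq F K (FiniteField.finrank_extension F p n)
  have hK : Fintype.card K = Fintype.card F ^ n := by
    rw [← Nat.card_eq_fintype_card, ← Nat.card_eq_fintype_card]
    exact FiniteField.natCard_extension F p n
  let φ : (Fin n → F) → K := fun x => ∑ i, (eval x (f i) - c i) • b i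
  have hφ : φ = (fun y => b.equivFun.symm (y - c)) ∘ fun x i => eval x (f i) := by
    ext x
    simp [φ, Module.Basis.equivFun_symm_apply]
  have hcard : (Set.range φ).ncard = (Set.range fun x : Fin n → F => fun i => eval x (f i)).ncard := by
    rw [hφ, Set.range_comp]
    exact Set.ncard_image_of_injective _
      (b.equivFun.symm.injective.comp (sub_left_injective (b := c)))
  have hφ0 : ∀ x, φ x ≠ 0 := fun x hx => hc ⟨x, by
    rw [hφ] at hx
    exact sub_eq_zero.1 ((LinearEquiv.map_eq_zero_iff _).1 hx)⟩
  let τ : F →* WittVector p K := (WittVector.teichmuller p).comp (algebraMap F K : F →* K)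
  have hτc : ∀ t, WittVector.constantCoeff (τ t) = algebraMap F K t :=
    fun t => WittVector.teichmuller_coeff_zero p _
  have hτ : Function.Injective τ := fun s t hst =>
    (algebraMap F K).injective (by rw [← hτc, ← hτc, hst])
  let A : (Fin n →₀ ℕ) → WittVector p K := fun D =>
    WittVector.teichmuller p (∑ i, coeff D (f i - C (c i)) • b i)
  let g : (Fin n → F) → WittVector p K := fun x => ∑ D ∈ insert 0 E, A D * ∏ i, τ (x i) ^ D i
  have hg : ∀ x, WittVector.constantCoeff (g x) = φ x := by
    intro x
    have hA : ∀ D, WittVector.constantCoeff (A D) = ∑ i, coeff D (f i - C (c i)) • b i :=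
      fun D => WittVector.teichmuller_coeff_zero p _
    have he : ∀ i, eval x (f i) - c i =
        ∑ D ∈ insert 0 E, coeff D (f i - C (c i)) * ∏ l, x l ^ D l := fun i => by
      rw [← eval_eq_sum_of_support_subset
        ((support_sub_C_subset _ _).trans (Finset.insert_subset_insert _ (hf i))), map_sub, eval_C]
    simp only [g, φ, map_sum, map_mul, map_prod, map_pow, hA, hτc, he, Finset.sum_smul]
    rw [Finset.sum_comm]
    refine Finset.sum_congr rfl fun D _ => ?_
    rw [Finset.sum_mul]
    refine Finset.sum_congr rfl fun i _ => ?_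
    simp only [Algebra.smul_def, map_mul, map_prod, map_pow]
    ring
  have hp0 : (p : WittVector p K) ≠ 0 := WittVector.p_nonzero p K
  have hn1 := mul_le_pow_sub_one (q := Fintype.card F) Fintype.card_pos n
  have hF1 : (1 : ℝ) ≤ Fintype.card F := by exact_mod_cast Fintype.card_pos (α := F)
  have hmain := ncard_range_le_of_coeff_eq_zero (φ := φ) (B := μ * (Fintype.card F - 1))
    (by simp [hK]) hφ0 (by
      rw [hK, Nat.cast_pow]
      exact (mul_le_mul_of_nonneg_right hμn (by linarith)).trans hn1) fun m hm hlt => by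
    have hcu : (Finset.univ : Finset (Fin n → F)).card = Fintype.card K := by simp [hK]
    have hd := dvd_coeff_prod_X_sub_C hp0 Finset.univ g (N := Fintype.card K - m + 1)
      (fun j hj hjN => pow_dvd_sum_pow hτ hq hμ A hj (lt_of_le_of_lt (by
        rw [← Nat.cast_sub hm.le]
        exact_mod_cast Nat.le_of_lt_succ hjN) hlt)) (m := m) (by rwa [hcu]) (by rw [hcu]; omega)
    have hd' := map_dvd WittVector.constantCoeff hd
    rw [map_natCast, CharP.cast_eq_zero, zero_dvd_iff, ← Polynomial.coeff_map,
      Polynomial.map_prod] at hd'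
    simpa [hg] using hd'
  rwa [hcard, hK, Nat.cast_pow] at hmain

/-- Let `f = (f_1,…,f_n) : 𝔽_q^n → 𝔽_q^n` be a polynomial map that involves
all `n` variables.  If `|V_f| < q^n`, then `|V_f| ≤ q^n − μ_f·(q−1)`, where `μ_f` is the
minimal dilation factor of the Newton polytope of `f`. -/
theorem value_set_le_card_sub_mu
    (F : Type*) [Field F] [Fintype F]
    (n : ℕ) (hn : 0 < n) (f : Fin n → MvPolynomial (Fin n) F)
    -- the set of exponent vectors of the monomials of `f_1, …, f_n`
    (E : Finset (Fin n →₀ ℕ))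
    (hE : E = Finset.univ.biUnion fun i => (f i).support)
    -- `f` involves all `n` variables
    (hall : ∀ i : Fin n, ∃ D ∈ E, 0 < D i)
    -- the Newton polytope `Δ(f)`
    (Δ : Set (Fin n → ℝ))
    (hΔ : Δ = convexHull ℝ ({0} ∪ {x : Fin n → ℝ | ∃ D ∈ E, x = fun i => (D i : ℝ)}))
    -- the minimal dilation factor `μ_f`
    (μ : ℝ)
    (hμ : μ = sInf {k : ℝ | 0 < k ∧
        ∃ v ∈ k • Δ, ∀ i : Fin n, ∃ m : ℕ, 0 < m ∧ v i = m})
    (hV : (Set.range fun x : Fin n → F => fun i => eval x (f i)).ncard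
            < Fintype.card F ^ n) :
    ((Set.range fun x : Fin n → F => fun i => eval x (f i)).ncard : ℝ)
      ≤ (Fintype.card F : ℝ) ^ n - μ * (Fintype.card F - 1) := by
  subst hE hΔ hμ
  have hbound := dilationBound_minDilation hn hall
  have hle := hbound (fun _ => 0) 1 one_pos (by simp)
  simp only [Finset.sum_const_zero, Nat.cast_zero, zero_div, zero_add, zero_mul, Finset.filter_true,
    Finset.card_univ, Fintype.card_fin] at hle
  obtain ⟨c, hc⟩ : ∃ c, c ∉ Set.range fun x : Fin n → F => fun i => eval x (f i) := by
    by_contra! h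
    rw [Set.eq_univ_of_forall h, Set.ncard_univ] at hV
    simp at hV
  exact ncard_range_eval_le hn f
    (fun i => Finset.subset_biUnion_of_mem (fun i => (f i).support) (Finset.mem_univ i)) hbound hle hc
end

section
/- Let f = (f_1,…,f_n) : 𝔽_q^n → 𝔽_q^n be a polynomial map with d = deg f ≥ 1. If |V_f| < q^n, then |V_f| ≤ q^n − n(q−1)/d (an inequality of real numbers). -/
open MvPolynomial

/-- Substituting polynomials of degree at most one does not increase the total degree. -/
lemma totalDegree_aeval_le_of_totalDegree_le_one {R σ τ : Type*} [CommSemiring R]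
    (g : σ → MvPolynomial τ R) (hg : ∀ i, (g i).totalDegree ≤ 1) (p : MvPolynomial σ R) :
    (aeval g p).totalDegree ≤ p.totalDegree := by
  rw [aeval_def, eval₂_eq]
  refine totalDegree_finsetSum_le fun s hs => ?_
  refine (totalDegree_mul _ _).trans ?_
  rw [algebraMap_eq, totalDegree_C, zero_add]
  refine (totalDegree_finsetProd _ _).trans ?_
  refine le_trans (Finset.sum_le_sum fun i _ => ?_) (le_totalDegree hs)
  calc (g i ^ s i).totalDegree ≤ s i * (g i).totalDegree := totalDegree_pow _ _
    _ ≤ s i * 1 := by gcongr; exact hg i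
    _ = s i := mul_one _

/-- A polynomial of degree less than `(q - 1) * n` with coefficients in an `F`-algebra sums to
zero over `F ^ n`, where `F` is a finite field of cardinality `q`. -/
lemma sum_eval_algebraMap_eq_zero {F L σ : Type*} [Field F] [Fintype F] [CommRing L]
    [Algebra F L] [Fintype σ] [DecidableEq σ] (p : MvPolynomial σ L)
    (h : p.totalDegree < (Fintype.card F - 1) * Fintype.card σ) :
    ∑ x : σ → F, eval (fun i => algebraMap F L (x i)) p = 0 := by
  simp_rw [eval_eq']
  rw [Finset.sum_comm]
  refine Finset.sum_eq_zero fun s hs => ?_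
  rw [← Finset.mul_sum]
  have hm : (monomial s (1 : F)).totalDegree < (Fintype.card F - 1) * Fintype.card σ :=
    ((totalDegree_monomial_le s 1).trans (le_totalDegree hs)).trans_lt h
  have key := congrArg (algebraMap F L) (MvPolynomial.sum_eval_eq_zero _ hm)
  simp only [map_sum, eval_monomial, one_mul, map_zero, Finsupp.prod_pow, map_prod, map_pow]
    at key
  rw [key, mul_zero]

/-- In a finite field `L`, the elementary symmetric functions of a constant family indexed by `L`
vanish in degrees other than `0` and `card L`. -/
lemma esymm_const_eq_zero {L : Type*} [Field L] [Fintype L] (c : L) {k : ℕ} (hk : k ≠ 0)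
    (hk' : k ≠ Fintype.card L) :
    ((Finset.univ : Finset L).val.map fun _ => c).esymm k = 0 := by
  obtain ⟨p, hp, m, hpp, hm⟩ := FiniteField.card' L
  rw [Finset.esymm_map_val, Finset.sum_congr rfl (g := fun _ => c ^ k)]
  · rw [Finset.sum_const, Finset.card_powersetCard, Finset.card_univ, nsmul_eq_mul, hm,
      (CharP.cast_eq_zero_iff L p _).2 (hpp.dvd_choose_pow hk (hm ▸ hk')), zero_mul]
  · intro t ht
    rw [Finset.prod_const, (Finset.mem_powersetCard.1 ht).2]

/-- The elementary symmetric functions of low degree of the values of a polynomial `G` on `F ^ n`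
vanish; here `F ^ n` is identified with the extension field `L` of degree `n`. -/
lemma esymm_values_eq_zero {F L ι : Type*} [Field F] [Fintype F] [Field L] [Fintype L]
    [Algebra F L] [Fintype ι] [DecidableEq ι] (b : Module.Basis ι F L) (G : MvPolynomial ι L)
    {k : ℕ} (hk : k ≠ 0) (hk' : k ≠ Fintype.card L)
    (h : k * G.totalDegree < (Fintype.card F - 1) * Fintype.card ι) :
    ((Finset.univ : Finset L).val.map
      fun z => eval (fun i => algebraMap F L (b.repr z i)) G).esymm k = 0 := by
  classical
  set g : L → L := fun z => eval (fun i => algebraMap F L (b.repr z i)) G with hg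
  let ℓ : L → ι → MvPolynomial ι L := fun z j =>
    ∑ i, C (algebraMap F L (b.repr (b i * z) j)) * X i
  let H : MvPolynomial ι L :=
    ∑ t ∈ (Finset.univ : Finset L).powersetCard k, ∏ z ∈ t, aeval (ℓ z) G
  have hℓ (z : L) (j : ι) : (ℓ z j).totalDegree ≤ 1 := by
    refine totalDegree_finsetSum_le fun i _ => (totalDegree_mul _ _).trans ?_
    rw [totalDegree_C, totalDegree_X]
  have hH : H.totalDegree ≤ k * G.totalDegree := by
    refine totalDegree_finsetSum_le fun t ht => (totalDegree_finsetProd _ _).trans ?_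
    rw [← (Finset.mem_powersetCard.1 ht).2, ← smul_eq_mul]
    exact Finset.sum_le_card_nsmul _ _ _ fun z _ =>
      totalDegree_aeval_le_of_totalDegree_le_one _ (hℓ z) G
  have hval (w z : L) :
      eval (fun i => algebraMap F L (b.repr w i)) (aeval (ℓ z) G) = g (w * z) := by
    have hlin (j : ι) :
        eval (fun i => algebraMap F L (b.repr w i)) (ℓ z j) =
          algebraMap F L (b.repr (w * z) j) := by
      have hw : w * z = ∑ i, b.repr w i • (b i * z) := by
        conv_lhs => rw [← b.sum_repr w, Finset.sum_mul]
        simp_rw [smul_mul_assoc]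
      rw [hw]
      simp [ℓ, mul_comm]
    have hC : (eval fun i => algebraMap F L (b.repr w i)).comp
        (algebraMap L (MvPolynomial ι L)) = RingHom.id L := by
      ext
      simp
    rw [map_aeval, hC]
    simp_rw [hlin]
    rfl
  have hHval (w : L) : eval (fun i => algebraMap F L (b.repr w i)) H =
      ((Finset.univ : Finset L).val.map fun z => g (w * z)).esymm k := by
    simp only [H, map_sum, map_prod, hval, Finset.esymm_map_val]
  have hzero : ((Finset.univ : Finset L).val.map fun z => g (0 * z)).esymm k = 0 := by
    simp only [zero_mul]
    exact esymm_const_eq_zero _ hk hk'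
  have hunit (w : L) (hw : w ≠ 0) :
      ((Finset.univ : Finset L).val.map fun z => g (w * z)).esymm k =
        ((Finset.univ : Finset L).val.map g).esymm k := by
    congr 1
    have : (Finset.univ : Finset L).map (Equiv.mulLeft₀ w hw).toEmbedding = Finset.univ :=
      Finset.map_univ_equiv _
    conv_rhs => rw [← this, Finset.map_val, Multiset.map_map]
    rfl
  have hsum : ∑ w : L, eval (fun i => algebraMap F L (b.repr w i)) H = 0 := by
    rw [← sum_eval_algebraMap_eq_zero (F := F) H (hH.trans_lt h)]
    exact Fintype.sum_equiv b.equivFun.toEquiv _ _ fun w => rfl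
  rw [← Finset.add_sum_erase _ _ (Finset.mem_univ (0 : L)), hHval, hzero, zero_add,
    Finset.sum_congr rfl fun w hw => (hHval w).trans (hunit w (Finset.ne_of_mem_erase hw)),
    Finset.sum_const, Finset.card_erase_of_mem (Finset.mem_univ _), Finset.card_univ,
    nsmul_eq_mul, Nat.cast_sub Fintype.card_pos, FiniteField.cast_card_eq_zero] at hsum
  simpa using hsum

/-- If the elementary symmetric functions of the values of a non-surjective self-map `g` of a
finite field `L` vanish in degrees `k` with `0 < k` and `k * d < m`, then `g` omits at least
`m / d` values. -/
lemma le_mul_card_sub_card_image {L : Type*} [Field L] [Fintype L] [DecidableEq L] (g : L → L)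
    {d m : ℕ} (hd : 1 ≤ d) (hm : m < Fintype.card L)
    (h : ∀ k, k ≠ 0 → k * d < m → ((Finset.univ : Finset L).val.map g).esymm k = 0)
    (hg : ¬ Function.Surjective g) :
    m ≤ (Fintype.card L - (Finset.univ.image g).card) * d := by
  open Polynomial in
  set Q := Fintype.card L with hQ
  have hQ1 : 1 < Q := Fintype.one_lt_card
  let s : Multiset L := (Finset.univ : Finset L).val.map g
  have hs : Multiset.card s = Q := by simp [s, hQ]
  let P : L[X] := (s.map fun t => Polynomial.X - Polynomial.C t).prod
  let R : L[X] := P - (Polynomial.X ^ Q - Polynomial.X)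
  have hroot (v : L) : R.eval v = P.eval v := by
    simp [R, hQ, FiniteField.pow_card]
  have hPeval (v : L) : P.eval v = 0 ↔ v ∈ Set.range g := by
    simp [P, s, Polynomial.eval_prod, Finset.prod_eq_zero_iff, sub_eq_zero, eq_comm (a := v)]
  have hR : R ≠ 0 := by
    intro h0
    refine hg fun v => (hPeval v).1 ?_
    rw [← hroot, h0, Polynomial.eval_zero]
  have hcard : (Finset.univ.image g).card ≤ R.natDegree := by
    refine Polynomial.card_le_degree_of_subset_roots fun v hv => ?_
    rw [Polynomial.mem_roots hR, Polynomial.IsRoot, hroot, hPeval]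
    simpa using hv
  have hPdeg : P.natDegree = Q := by
    rw [← hs]
    exact Polynomial.natDegree_multiset_prod_X_sub_C_eq_card s
  have hRdeg : R.natDegree ≤ Q := by
    refine (Polynomial.natDegree_sub_le _ _).trans ?_
    rw [hPdeg, FiniteField.X_pow_card_sub_X_natDegree_eq L hQ1, max_self]
  by_contra! hlt
  have hlt' : (Q - R.natDegree) * d < m := lt_of_le_of_lt (by gcongr) hlt
  refine hR (Polynomial.leadingCoeff_eq_zero.1 ?_)
  have hcoeff := Multiset.prod_X_sub_C_coeff s (k := R.natDegree) (hs ▸ hRdeg)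
  rw [hs] at hcoeff
  have hne1 : R.natDegree ≠ 1 := by
    intro h1
    rw [h1] at hlt'
    have := Nat.le_mul_of_pos_right (Q - 1) hd
    omega
  change (P - (Polynomial.X ^ Q - Polynomial.X)).coeff R.natDegree = 0
  rw [Polynomial.coeff_sub, Polynomial.coeff_sub, Polynomial.coeff_X_pow,
    Polynomial.coeff_X_of_ne_one hne1, hcoeff]
  rcases eq_or_ne R.natDegree Q with heq | hne
  · simp [heq, Multiset.esymm]
  · rw [h _ (by omega) hlt', if_neg hne]
    simp

/-- The bound for value sets of polynomial maps, given an extension field `L` of `F` with an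
`F`-basis of the same size as the number of variables. -/
lemma mul_card_sub_one_le_of_basis {F L : Type*} [Field F] [Fintype F] [Field L] [Fintype L]
    [Algebra F L] {n d : ℕ} (b : Module.Basis (Fin n) F L) (f : Fin n → MvPolynomial (Fin n) F)
    (hd : ∀ i, (f i).totalDegree ≤ d) (hd1 : 1 ≤ d)
    (hV : (Set.range fun x : Fin n → F => fun i => eval x (f i)).ncard < Fintype.card F ^ n) :
    n * (Fintype.card F - 1) ≤ (Fintype.card F ^ n -
      (Set.range fun x : Fin n → F => fun i => eval x (f i)).ncard) * d := by
  classical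
  have hL : Fintype.card L = Fintype.card F ^ n := by
    simpa using Module.card_fintype b
  let G : MvPolynomial (Fin n) L := ∑ j, C (b j) * map (algebraMap F L) (f j)
  let g : L → L := fun z => eval (fun i => algebraMap F L (b.repr z i)) G
  have hG : G.totalDegree ≤ d := by
    refine totalDegree_finsetSum_le fun j _ => (totalDegree_mul _ _).trans ?_
    rw [totalDegree_C, zero_add]
    exact (Finset.sup_mono (support_map_subset _ _)).trans (hd j)
  have hg (z : L) : g z = b.equivFun.symm fun j => eval (b.equivFun z) (f j) := by
    have hj (j : Fin n) : eval (fun i => algebraMap F L (b.repr z i)) (map (algebraMap F L) (f j))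
        = algebraMap F L (eval (b.equivFun z) (f j)) := by
      rw [eval_map]
      exact (eval₂_comp (algebraMap F L) (b.equivFun z) (f j)).symm
    simp only [g, G, map_sum, map_mul, eval_C, hj, Module.Basis.equivFun_symm_apply,
      Algebra.smul_def, mul_comm]
  have himage : Set.range g =
      b.equivFun.symm '' Set.range fun x : Fin n → F => fun i => eval x (f i) := by
    rw [← Set.range_comp, ← b.equivFun.surjective.range_comp]
    exact congrArg Set.range (funext hg)
  have hncard : (Set.range fun x : Fin n → F => fun i => eval x (f i)).ncard =
      (Finset.univ.image g).card := by
    rw [← Set.ncard_image_of_injective _ b.equivFun.symm.injective, ← himage,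
      ← Set.ncard_coe_finset]
    simp
  rw [hncard] at hV ⊢
  have hbern : n * (Fintype.card F - 1) < Fintype.card L := by
    have hq : Fintype.card F = 1 + (Fintype.card F - 1) := by
      have := Fintype.card_pos (α := F)
      omega
    have := one_add_mul_le_pow_of_sq_nonneg (a := Fintype.card F - 1) zero_le zero_le zero_le n
    rw [← hq, ← hL] at this
    simp only [Nat.cast_id] at this
    omega
  have hsurj : ¬ Function.Surjective g := by
    intro hs
    rw [Finset.image_univ_of_surjective hs, Finset.card_univ, hL] at hV
    exact hV.false
  rw [← hL]
  exact le_mul_card_sub_card_image g hd1 hbern (fun k hk hkd => by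
    refine esymm_values_eq_zero b G hk ?_ ?_
    · rintro rfl
      have := Nat.le_mul_of_pos_right (Fintype.card L) hd1
      omega
    · rw [Fintype.card_fin, mul_comm _ n]
      exact lt_of_le_of_lt (by gcongr) hkd) hsurj

/-- Let `f = (f_1,…,f_n) : 𝔽_q^n → 𝔽_q^n` be a polynomial map with
`d = deg f ≥ 1`.  If `|V_f| < q^n`, then `|V_f| ≤ q^n − n(q−1)/d`. -/
theorem value_set_le_card_sub_degree_bound
    (F : Type*) [Field F] [Fintype F]
    (n : ℕ) (hn : 0 < n) (f : Fin n → MvPolynomial (Fin n) F)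
    (d : ℕ) (hd : d = Finset.univ.sup fun i => (f i).totalDegree) (hd1 : 1 ≤ d)
    (hV : (Set.range fun x : Fin n → F => fun i => eval x (f i)).ncard
            < Fintype.card F ^ n) :
    ((Set.range fun x : Fin n → F => fun i => eval x (f i)).ncard : ℝ)
      ≤ (Fintype.card F : ℝ) ^ n - n * (Fintype.card F - 1) / d := by
  obtain ⟨p, hp⟩ := CharP.exists F
  have : Fact p.Prime := ⟨CharP.char_is_prime F p⟩
  have : NeZero n := ⟨hn.ne'⟩
  let L := FiniteField.Extension F p n
  let : Fintype L := Fintype.ofFinite L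
  let b : Module.Basis (Fin n) F L :=
    Module.finBasisOfFinrankEq F L (FiniteField.finrank_extension F p n)
  have key := mul_card_sub_one_le_of_basis b f (fun i => hd ▸
    Finset.le_sup (f := fun i => (f i).totalDegree) (Finset.mem_univ i)) hd1 hV
  have hd0 : (0 : ℝ) < d := by exact_mod_cast hd1
  rw [le_sub_comm, div_le_iff₀ hd0]
  rw [← Nat.cast_le (α := ℝ), Nat.cast_mul, Nat.cast_mul, Nat.cast_sub Fintype.card_pos,
    Nat.cast_sub hV.le] at key
  push_cast at key
  exact key
end

section
/- Let f = (f_1,…,f_n) : 𝔽_q^n → 𝔽_q^n be a polynomial map that involves all n variables. If |V_f| < q^n, then |V_f| ≤ q^n − min{q, μ_f·(q−1)} (an inequality of real numbers). -/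
section RootCounting

open Polynomial

theorem ncard_range_le_of_esymm_eq_zero {σ K : Type*} [Fintype σ] [Field K] [Fintype K]
    (hσ : Fintype.card σ = Fintype.card K) (g : σ → K) (hg : ¬ Function.Surjective g) {B : ℝ}
    (hB : B ≤ Fintype.card K - 1)
    (h : ∀ k : ℕ, 0 < k → (k : ℝ) < B → (Finset.univ.val.map g).esymm k = 0) :
    ((Set.range g).ncard : ℝ) ≤ Fintype.card K - B := by
  classical
  have hN : 1 < Fintype.card K := Fintype.one_lt_card
  set H : Polynomial K := ((Finset.univ.val.map g).map fun t => X - C t).prod with hH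
  have hcard : Multiset.card (Finset.univ.val.map g) = Fintype.card K := by
    rw [Multiset.card_map, ← hσ]; rfl
  have hdeg : H.natDegree = Fintype.card K := by
    rw [hH, natDegree_multiset_prod_X_sub_C_eq_card, hcard]
  have hmonic : H.Monic := monic_multiset_prod_of_monic _ _ fun t _ => monic_X_sub_C t
  have hroot (s : σ) : H.eval (g s) = 0 := by
    rw [hH, eval_multiset_prod]
    apply Multiset.prod_eq_zero
    simp only [Multiset.map_map, Multiset.mem_map]
    exact ⟨s, Finset.mem_univ_val s, by simp⟩
  set P : Polynomial K := H - (X ^ Fintype.card K - X) with hP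
  have hP0 : P ≠ 0 := by
    intro h0
    apply hg
    intro y
    have hy : H.eval y = 0 := by
      rw [sub_eq_zero.1 h0]
      simp [FiniteField.pow_card]
    rw [hH, eval_multiset_prod, Multiset.prod_eq_zero_iff] at hy
    simp only [Multiset.map_map, Multiset.mem_map] at hy
    obtain ⟨s, -, hs⟩ := hy
    refine ⟨s, ?_⟩
    simp only [Function.comp_apply, eval_sub, eval_X, eval_C] at hs
    exact (sub_eq_zero.1 hs).symm
  have hPdeg : (P.natDegree : ℝ) ≤ Fintype.card K - B := by
    by_contra! hlt
    apply hP0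
    rw [← leadingCoeff_eq_zero, leadingCoeff]
    generalize P.natDegree = d at hlt
    have hd1 : d ≠ 1 := by
      rintro rfl
      push_cast at hlt
      linarith
    rw [hP, coeff_sub, coeff_sub, coeff_X_pow, coeff_X, if_neg (Ne.symm hd1), sub_zero]
    rcases lt_trichotomy d (Fintype.card K) with hd | hd | hd
    · rw [if_neg hd.ne, sub_zero, hH, Multiset.prod_X_sub_C_coeff _ (hcard ▸ hd.le), hcard,
        h _ (Nat.sub_pos_of_lt hd) (by rw [Nat.cast_sub hd.le]; linarith), mul_zero]
    · rw [if_pos hd, hd, ← hdeg, hmonic.coeff_natDegree, sub_self]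
    · rw [if_neg hd.ne', coeff_eq_zero_of_natDegree_lt (hdeg ▸ hd), sub_zero]
  refine le_trans (Nat.cast_le.2 ?_) hPdeg
  have hsub : (Finset.univ.image g) ⊆ P.roots.toFinset := by
    intro y hy
    obtain ⟨s, -, rfl⟩ := Finset.mem_image.1 hy
    rw [Multiset.mem_toFinset, mem_roots hP0, IsRoot.def, hP, eval_sub, hroot]
    simp [FiniteField.pow_card]
  calc (Set.range g).ncard = (Finset.univ.image g).card := by
        rw [← Set.ncard_coe_finset]; simp
    _ ≤ P.roots.toFinset.card := Finset.card_le_card hsub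
    _ ≤ Multiset.card P.roots := Multiset.toFinset_card_le _
    _ ≤ P.natDegree := card_roots' P

end RootCounting

open MvPolynomial Pointwise

section PowerSums

variable {F R : Type*} [Field F] [Fintype F] [CommRing R] [IsDomain R]

theorem sum_monoidHom_pow_eq_zero_s3 {τ : F →* R} (hτ : Function.Injective τ) {a : ℕ}
    (ha : ¬ Fintype.card F - 1 ∣ a) : ∑ t, τ t ^ a = 0 := by
  obtain ⟨g, hg⟩ : ∃ g : Fˣ, g ^ a ≠ 1 := by
    by_contra! h
    exact ha ((FiniteField.forall_pow_eq_one_iff F a).1 h)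
  have hne : τ g ^ a ≠ 1 := by
    rw [← map_pow, ← map_one τ]
    intro h
    exact hg (Units.ext (by simpa using hτ h))
  have hsum : ∑ t, τ t ^ a = τ g ^ a * ∑ t, τ t ^ a := by
    rw [Finset.mul_sum, ← Equiv.sum_comp (Units.mulLeft g)]
    simp [mul_pow]
  have h0 : (τ g ^ a - 1) * ∑ t, τ t ^ a = 0 := by
    rw [sub_mul, ← hsum, one_mul, sub_self]
  exact (mul_eq_zero.1 h0).resolve_left (sub_ne_zero.2 hne)

theorem card_dvd_sum_eval {n : ℕ} {τ : F →* R} (hτ : Function.Injective τ)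
    (P : MvPolynomial (Fin n) R)
    (hP : ∀ u ∈ P.support, ∃ i, u i = 0 ∨ ¬ Fintype.card F - 1 ∣ u i) :
    (Fintype.card F : R) ∣ ∑ x : Fin n → F, eval (fun i => τ (x i)) P := by
  classical
  simp_rw [eval_eq']
  rw [Finset.sum_comm]
  refine Finset.dvd_sum fun u hu => ?_
  rw [← Finset.mul_sum]
  refine Dvd.dvd.mul_left ?_ _
  have hprod : ∑ x : Fin n → F, ∏ i, τ (x i) ^ u i = ∏ i, ∑ t, τ t ^ u i := by
    rw [Finset.prod_univ_sum, Fintype.piFinset_univ]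
  rw [hprod]
  obtain ⟨i, hi⟩ := hP u hu
  refine Dvd.dvd.trans ?_ (Finset.dvd_prod_of_mem _ (Finset.mem_univ i))
  rcases hi with hi | hi
  · simp [hi]
  · simp [sum_monoidHom_pow_eq_zero_s3 hτ hi]

end PowerSums

theorem mem_smul_of_mem_support_pow {n : ℕ} {R : Type*} [CommRing R]
    {P : MvPolynomial (Fin n) R} {Δ : Set (Fin n → ℝ)} (hconv : Convex ℝ Δ) (hne : Δ.Nonempty)
    (hP : ∀ u ∈ P.support, (fun i => (u i : ℝ)) ∈ Δ) (k : ℕ) :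
    ∀ u ∈ (P ^ k).support, (fun i => (u i : ℝ)) ∈ (k : ℝ) • Δ := by
  classical
  induction k with
  | zero =>
    intro u hu
    have hu0 : u = 0 := by
      by_contra h
      rw [mem_support_iff, pow_zero, coeff_one, if_neg (Ne.symm h)] at hu
      exact hu rfl
    subst hu0
    rw [Nat.cast_zero, Set.zero_smul_set hne]
    ext i
    simp
  | succ k ih =>
    intro u hu
    rw [pow_succ] at hu
    obtain ⟨v, hv, w, hw, rfl⟩ := Finset.mem_add.1 (support_mul _ _ hu)
    rw [Nat.cast_succ, hconv.add_smul k.cast_nonneg zero_le_one, one_smul]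
    refine ⟨_, ih v hv, _, hP w hw, ?_⟩
    ext i
    simp

theorem dvd_mul_esymm_of_dvd_sum_pow {σ R : Type*} [Fintype σ] [CommRing R] (a : σ → R)
    (c : R) (k : ℕ) (h : ∀ j, 0 < j → j ≤ k → c ∣ ∑ s, a s ^ j) :
    c ∣ (k : R) * (Finset.univ.val.map a).esymm k := by
  classical
  have hN := congrArg (aeval a) (mul_esymm_eq_sum σ R k)
  simp only [map_mul, map_natCast, aeval_esymm_eq_multiset_esymm, map_sum, psum, map_pow,
    aeval_X] at hN
  rw [hN]
  refine Dvd.dvd.mul_left (Finset.dvd_sum fun x hx => Dvd.dvd.mul_left (h _ ?_ ?_) _) _ <;>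
  · obtain ⟨hx, hlt⟩ := Finset.mem_filter.1 hx
    rw [Finset.HasAntidiagonal.mem_antidiagonal] at hx
    lia

theorem map_eq_zero_of_prime_pow_dvd_mul {R K : Type*} [CommRing R] [IsDomain R]
    [Field K] {p : ℕ} [Fact p.Prime] [CharP K p] (hp0 : (p : R) ≠ 0)
    (φ : R →+* K) {r k : ℕ} (hk : 0 < k) (hkr : k < p ^ r) {w : R}
    (h : ((p ^ r : ℕ) : R) ∣ k * w) : φ w = 0 := by
  have hp : p.Prime := Fact.out
  obtain ⟨a, m, hm, rfl⟩ := Nat.exists_eq_pow_mul_and_not_dvd hk.ne' p hp.ne_one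
  have har : a < r := by
    refine (Nat.pow_lt_pow_iff_right hp.one_lt).1 (lt_of_le_of_lt ?_ hkr)
    exact Nat.le_mul_of_pos_right _ (Nat.pos_of_ne_zero (by rintro rfl; simp at hm))
  obtain ⟨b, rfl⟩ := Nat.exists_eq_add_of_lt har
  obtain ⟨s, hs⟩ := h
  have hs' : (m : R) * w = p ^ (b + 1) * s := by
    have hpa : ((p : R) ^ a) ≠ 0 := pow_ne_zero _ hp0
    apply mul_left_cancel₀ hpa
    push_cast at hs
    rw [← mul_assoc, hs]
    ring
  have hφ := congrArg φ hs'
  simp only [map_mul, map_natCast, map_pow, CharP.cast_eq_zero, ne_eq, Nat.succ_ne_zero,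
    not_false_eq_true, zero_pow, zero_mul] at hφ
  exact (mul_eq_zero.1 hφ).resolve_left fun h0 => hm ((CharP.cast_eq_zero_iff K p m).1 h0)

/-- Let `f = (f_1,…,f_n) : 𝔽_q^n → 𝔽_q^n` be a polynomial map that involves
all `n` variables.  If `|V_f| < q^n`, then `|V_f| ≤ q^n − min{q, μ_f·(q−1)}`. -/
theorem value_set_le_card_sub_min_q_mu
    (F : Type*) [Field F] [Fintype F]
    (n : ℕ) (hn : 0 < n) (f : Fin n → MvPolynomial (Fin n) F)
    -- the set of exponent vectors of the monomials of `f_1, …, f_n`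
    (E : Finset (Fin n →₀ ℕ))
    (hE : E = Finset.univ.biUnion fun i => (f i).support)
    -- `f` involves all `n` variables
    (hall : ∀ i : Fin n, ∃ D ∈ E, 0 < D i)
    -- the Newton polytope `Δ(f)`
    (Δ : Set (Fin n → ℝ))
    (hΔ : Δ = convexHull ℝ ({0} ∪ {x : Fin n → ℝ | ∃ D ∈ E, x = fun i => (D i : ℝ)}))
    -- the minimal dilation factor `μ_f`
    (μ : ℝ)
    (hμ : μ = sInf {k : ℝ | 0 < k ∧
        ∃ v ∈ k • Δ, ∀ i : Fin n, ∃ m : ℕ, 0 < m ∧ v i = m})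
    (hV : (Set.range fun x : Fin n → F => fun i => eval x (f i)).ncard
            < Fintype.card F ^ n) :
    ((Set.range fun x : Fin n → F => fun i => eval x (f i)).ncard : ℝ)
      ≤ (Fintype.card F : ℝ) ^ n
          - min (Fintype.card F : ℝ) (μ * (Fintype.card F - 1)) := by
  classical
  obtain ⟨p, hpF⟩ := CharP.exists F
  have hp : Fact p.Prime := ⟨CharP.char_is_prime F p⟩
  obtain ⟨r, -, hq⟩ := FiniteField.card F p
  have : NeZero n := ⟨hn.ne'⟩
  let K := FiniteField.Extension F p n
  have : Fintype K := Fintype.ofFinite K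
  have : CharP K p := charP_of_injective_algebraMap (algebraMap F K).injective p
  have hcardK : Fintype.card K = Fintype.card F ^ n := by
    simpa only [Nat.card_eq_fintype_card] using FiniteField.natCard_extension F p n
  let b : Module.Basis (Fin n) F K :=
    Module.finBasisOfFinrankEq F K (FiniteField.finrank_extension F p n)
  let τ : F →* WittVector p K :=
    (WittVector.teichmuller p).comp (algebraMap F K : F →* K)
  have hτφ (t : F) : WittVector.constantCoeff (τ t) = algebraMap F K t :=
    WittVector.teichmuller_coeff_zero p _
  have hτ : Function.Injective τ := fun s t hst =>
    (algebraMap F K).injective (by rw [← hτφ, ← hτφ, hst])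
  have hq1 : 1 < Fintype.card F := Fintype.one_lt_card
  have hq1' : (1 : ℝ) < Fintype.card F := by exact_mod_cast hq1
  -- a lift of `∑ i, b i * f i` to the Witt vectors
  let c (D : Fin n →₀ ℕ) : K := ∑ i, (f i).coeff D • b i
  let G : MvPolynomial (Fin n) (WittVector p K) :=
    ∑ D ∈ E, monomial D (WittVector.teichmuller p (c D))
  have hfE (i : Fin n) : (f i).support ⊆ E := by
    rw [hE]
    exact Finset.subset_biUnion_of_mem (fun i => (f i).support) (Finset.mem_univ i)
  have hGE : ∀ u ∈ G.support, u ∈ E := by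
    intro u hu
    obtain ⟨D, hD, hu⟩ := Finset.mem_biUnion.1 (support_sum hu)
    rwa [Finset.mem_singleton.1 (support_monomial_subset hu)]
  let e : (Fin n → F) ≃ₗ[F] K := b.equivFun.symm
  have hG (x : Fin n → F) : WittVector.constantCoeff (eval (fun i => τ (x i)) G)
      = e (fun i => eval x (f i)) := by
    have hf (i : Fin n) : eval x (f i) = ∑ D ∈ E, (f i).coeff D * ∏ j, x j ^ D j := by
      rw [eval_eq']
      refine Finset.sum_subset (hfE i) fun D _ hD => ?_
      rw [notMem_support_iff.1 hD, zero_mul]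
    have hc (D : Fin n →₀ ℕ) : WittVector.constantCoeff (WittVector.teichmuller p (c D)) = c D :=
      WittVector.teichmuller_coeff_zero p _
    simp only [G, e, map_sum, eval_monomial, map_mul, Finsupp.prod_fintype, pow_zero,
      implies_true, map_prod, map_pow, hτφ, hc, Module.Basis.equivFun_symm_apply, hf,
      Finset.sum_smul]
    rw [Finset.sum_comm]
    refine Finset.sum_congr rfl fun D _ => ?_
    refine (Finset.sum_mul _ _ _).trans ?_
    refine Finset.sum_congr rfl fun i _ => ?_
    simp only [Algebra.smul_def, map_mul, map_prod, map_pow]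
    ring
  have hconv : Convex ℝ Δ := hΔ ▸ convex_convexHull ℝ _
  have hED : ∀ D ∈ E, (fun i => (D i : ℝ)) ∈ Δ := fun D hD =>
    hΔ ▸ subset_convexHull ℝ _ (Or.inr ⟨D, hD, rfl⟩)
  have hne : Δ.Nonempty := ⟨0, hΔ ▸ subset_convexHull ℝ _ (Or.inl rfl)⟩
  have hbdd : BddBelow {k : ℝ | 0 < k ∧
      ∃ v ∈ k • Δ, ∀ i : Fin n, ∃ m : ℕ, 0 < m ∧ v i = m} := ⟨0, fun k hk => hk.1.le⟩
  have hdvd (k : ℕ) (hk : 0 < k) (hkμ : (k : ℝ) < μ * (Fintype.card F - 1)) :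
      (Fintype.card F : WittVector p K) ∣
        ∑ x : Fin n → F, eval (fun i => τ (x i)) G ^ k := by
    simp_rw [← map_pow]
    refine card_dvd_sum_eval hτ _ fun u hu => ?_
    by_contra! hcon
    have hkΔ := mem_smul_of_mem_support_pow hconv hne (fun u hu => hED u (hGE u hu)) k u hu
    refine hkμ.not_ge ?_
    rw [← le_div_iff₀ (by linarith), hμ]
    refine csInf_le hbdd ⟨by have := sub_pos.2 hq1'; positivity,
      fun i => (u i : ℝ) / (Fintype.card F - 1), ?_, fun i => ?_⟩
    · obtain ⟨v, hv, hvu⟩ := hkΔ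
      refine ⟨v, hv, ?_⟩
      ext i
      have := congrFun hvu i
      simp only [Pi.smul_apply, smul_eq_mul] at this ⊢
      rw [← this]
      ring
    · obtain ⟨hi0, m, hm⟩ := hcon i
      refine ⟨m, Nat.pos_of_ne_zero (by rintro rfl; simp_all), ?_⟩
      beta_reduce
      rw [hm, Nat.cast_mul, Nat.cast_sub hq1.le, Nat.cast_one, mul_div_cancel_left₀]
      linarith
  let g (x : Fin n → F) : K := e (fun i => eval x (f i))
  have hrange : (Set.range fun x : Fin n → F => fun i => eval x (f i)).ncard
      = (Set.range g).ncard := by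
    rw [← Set.ncard_image_of_injective _ e.injective, ← Set.range_comp]
    rfl
  have hsurj : ¬ Function.Surjective g := by
    intro hs
    rw [hrange, hs.range_eq, Set.ncard_univ, Nat.card_eq_fintype_card, hcardK] at hV
    exact lt_irrefl _ hV
  have hB : min (Fintype.card F : ℝ) (μ * (Fintype.card F - 1)) ≤ Fintype.card K - 1 := by
    rw [hcardK]
    rcases Nat.lt_or_ge 1 n with hn1 | hn1
    · refine (min_le_left _ _).trans ?_
      have : Fintype.card F + 1 ≤ Fintype.card F ^ n :=
        Nat.succ_le_of_lt (lt_self_pow₀ hq1 hn1)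
      have : (Fintype.card F : ℝ) + 1 ≤ (Fintype.card F ^ n : ℕ) := by exact_mod_cast this
      linarith
    · obtain rfl : n = 1 := le_antisymm hn1 hn
      refine (min_le_right _ _).trans ?_
      have hμ1 : μ ≤ 1 := by
        obtain ⟨D, hD, hD0⟩ := hall 0
        rw [hμ]
        refine csInf_le hbdd ⟨one_pos, fun i => (D i : ℝ), ?_, fun i => ⟨D i, ?_, rfl⟩⟩
        · rw [one_smul]
          exact hED D hD
        · rwa [Subsingleton.elim i 0]
      rw [pow_one]
      nlinarith
  have hmain := ncard_range_le_of_esymm_eq_zero (by simp [hcardK]) g hsurj hB fun k hk hkB => ?_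
  · rw [hrange]
    simpa [hcardK] using hmain
  · obtain ⟨hkq, hkμ⟩ := lt_min_iff.1 hkB
    have hmap : (Finset.univ.val.map g).esymm k = WittVector.constantCoeff
        ((Finset.univ.val.map fun x : Fin n → F => eval (fun i => τ (x i)) G).esymm k) := by
      simp only [← aeval_esymm_eq_multiset_esymm (Fin n → F) ℤ, esymm, map_sum, map_prod, aeval_X,
        hG, g]
    rw [hmap]
    refine map_eq_zero_of_prime_pow_dvd_mul (p := p) (r := r) (WittVector.p_nonzero p K) _ hk ?_ ?_
    · rw [← hq]
      exact_mod_cast hkq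
    · rw [← hq]
      refine dvd_mul_esymm_of_dvd_sum_pow _ _ k fun j hj hjk => hdvd j hj ?_
      exact lt_of_le_of_lt (Nat.cast_le.2 hjk) hkμ
end

section
/- Let f = (f_1,…,f_n) : 𝔽_q^n → 𝔽_q^n be a polynomial map with d = deg f ≥ 1. If |V_f| < q^n, then |V_f| ≤ q^n − min{q, n(q−1)/d} (an inequality of real numbers). -/
open MvPolynomial

section ScaleVars

variable {σ R : Type*} [CommRing R]

/-- The substitution `X j ↦ c j * X j`. -/
noncomputable def scaleVars (c : σ → R) : MvPolynomial σ R →ₐ[R] MvPolynomial σ R :=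
  aeval fun j => C (c j) * X j

theorem coeff_scaleVars [Fintype σ] (c : σ → R) (m : σ →₀ ℕ) (p : MvPolynomial σ R) :
    coeff m (scaleVars c p) = (∏ j, c j ^ m j) * coeff m p := by
  classical
  induction p using MvPolynomial.induction_on' with
  | monomial u a =>
    have h : scaleVars c (monomial u a) = monomial u ((∏ j, c j ^ u j) * a) := by
      rw [scaleVars, aeval_monomial, Finsupp.prod_fintype _ _ (by simp), mul_comm _ a,
        ← C_mul_monomial, monomial_eq (s := u), Finsupp.prod_fintype _ _ (by simp)]
      simp only [mul_pow, Finset.prod_mul_distrib, map_prod, map_pow, algebraMap_eq]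
    rw [h, coeff_monomial, coeff_monomial]
    split_ifs with h
    · rw [h]
    · simp
  | add p q hp hq => simp only [map_add, coeff_add, hp, hq, mul_add]

theorem scaleVars_scaleVars (c e : σ → R) (p : MvPolynomial σ R) :
    scaleVars c (scaleVars e p) = scaleVars (c * e) p := by
  rw [← AlgHom.comp_apply]
  congr 1
  ext j
  simp only [scaleVars, AlgHom.comp_apply, aeval_X, map_mul, aeval_C, algebraMap_eq,
    Pi.mul_apply]
  ring_nf

theorem totalDegree_scaleVars_le [Fintype σ] (c : σ → R) (p : MvPolynomial σ R) :
    (scaleVars c p).totalDegree ≤ p.totalDegree := by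
  refine totalDegree_le_of_support_subset fun m hm => ?_
  rw [mem_support_iff, coeff_scaleVars] at hm
  exact mem_support_iff.mpr (right_ne_zero_of_mul hm)

theorem eval_one_scaleVars (c : σ → R) (p : MvPolynomial σ R) :
    eval 1 (scaleVars c p) = eval c p := by
  induction p using MvPolynomial.induction_on with
  | C a => simp [scaleVars]
  | add p q hp hq => simp [hp, hq]
  | mul_X p j hp => simp [hp]; simp [scaleVars]

theorem totalDegree_coeff_prod_X_sub_C_le {ι : Type*} (s : Finset ι) (G : ι → MvPolynomial σ R)
    (d : ℕ) (hG : ∀ i, (G i).totalDegree ≤ d) (k : ℕ) :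
    ((∏ i ∈ s, (Polynomial.X - Polynomial.C (G i))).coeff k).totalDegree ≤ (s.card - k) * d := by
  classical
  induction s using Finset.induction_on generalizing k with
  | empty =>
    rw [Finset.prod_empty, Polynomial.coeff_one]
    split_ifs <;> simp
  | insert a s ha ih =>
    rw [Finset.prod_insert ha, Finset.card_insert_of_notMem ha, sub_mul, Polynomial.coeff_sub,
      Polynomial.coeff_C_mul]
    by_cases hk : s.card < k
    · have h0 : (∏ i ∈ s, (Polynomial.X - Polynomial.C (G i))).coeff k = 0 := by
        refine Polynomial.coeff_eq_zero_of_natDegree_lt (lt_of_le_of_lt ?_ hk)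
        refine (Polynomial.natDegree_prod_le _ _).trans ?_
        calc _ ≤ ∑ _i ∈ s, 1 := Finset.sum_le_sum fun i _ => Polynomial.natDegree_X_sub_C_le _
          _ = s.card := by simp
      rw [h0, mul_zero, sub_zero]
      cases k with
      | zero => simp
      | succ k =>
        rw [Polynomial.coeff_X_mul]
        exact (ih k).trans (Nat.mul_le_mul_right _ (by omega))
    · refine (totalDegree_sub _ _).trans (max_le ?_ ?_)
      · cases k with
        | zero => simp
        | succ k =>
          rw [Polynomial.coeff_X_mul]
          exact (ih k).trans (Nat.mul_le_mul_right _ (by omega))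
      · refine (totalDegree_mul _ _).trans ((add_le_add (hG a) (ih k)).trans ?_)
        rw [show s.card + 1 - k = (s.card - k) + 1 by omega]
        linarith

end ScaleVars

section FiniteField

theorem coeff_pow_card_eq_zero (F : Type*) [Field F] [Fintype F] {A : Type*} [CommRing A]
    [Algebra F A] (p : Polynomial A) {k : ℕ} (hk : ¬ Fintype.card F ∣ k) :
    (p ^ Fintype.card F).coeff k = 0 := by
  obtain ⟨r, hr⟩ := CharP.exists F
  obtain ⟨m, hprime, hm⟩ := FiniteField.card F r
  have : Fact r.Prime := ⟨hprime⟩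
  rcases subsingleton_or_nontrivial A with hA | hA
  · exact Subsingleton.elim _ _
  have : CharP A r := charP_of_injective_algebraMap (algebraMap F A).injective r
  have : ExpChar A r := ExpChar.prime hprime
  rw [hm] at hk ⊢
  rw [← Polynomial.map_iterateFrobenius_expand, Polynomial.coeff_map,
    Polynomial.coeff_expand (pow_pos hprime.pos _), if_neg hk, map_zero]

variable {F : Type*} [Field F] [Fintype F] {L : Type*} [Field L] [Algebra F L]

/-- The polynomial `∏ x, (T - g (x₁ s₁, …, xₙ sₙ))` in `T`, where `x` runs over `F ^ n` and the
`sᵢ` are indeterminates. -/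
noncomputable def scaledValuePoly (F : Type*) [Field F] [Fintype F] {L : Type*} [Field L]
    [Algebra F L] {n : ℕ} (g : MvPolynomial (Fin n) L) : Polynomial (MvPolynomial (Fin n) L) :=
  ∏ x : Fin n → F, (Polynomial.X - Polynomial.C (scaleVars (fun j => algebraMap F L (x j)) g))

theorem map_scaleVars_scaledValuePoly {n : ℕ} (g : MvPolynomial (Fin n) L) (c : Fin n → F) :
    (scaledValuePoly F g).map (scaleVars fun j => algebraMap F L (c j)).toRingHom =
      ∏ x : Fin n → F,
        (Polynomial.X - Polynomial.C (scaleVars (fun j => algebraMap F L ((c * x) j)) g)) := by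
  rw [scaledValuePoly, Polynomial.map_prod]
  refine Finset.prod_congr rfl fun x _ => ?_
  rw [Polynomial.map_sub, Polynomial.map_X, Polynomial.map_C]
  have h := scaleVars_scaleVars (fun j => algebraMap F L (c j)) (fun j => algebraMap F L (x j)) g
  simp only [AlgHom.toRingHom_eq_coe, RingHom.coe_coe, h]
  congr 4
  ext j
  simp

theorem map_units_scaledValuePoly {n : ℕ} (g : MvPolynomial (Fin n) L) (c : Fin n → Fˣ) :
    (scaledValuePoly F g).map (scaleVars fun j => algebraMap F L (c j)).toRingHom =
      scaledValuePoly F g := by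
  rw [map_scaleVars_scaledValuePoly g fun j => (c j : F)]
  exact Fintype.prod_equiv (Equiv.piCongrRight fun j => Units.mulLeft (c j)) _ _ fun x => rfl

theorem exists_map_kill_scaledValuePoly {n : ℕ} (g : MvPolynomial (Fin n) L) (j : Fin n) :
    ∃ H, (scaledValuePoly F g).map
        (scaleVars fun i => algebraMap F L (Function.update (1 : Fin n → F) j 0 i)).toRingHom =
      H ^ Fintype.card F := by
  classical
  refine ⟨∏ y : {i // i ≠ j} → F, (Polynomial.X - Polynomial.C (scaleVars
    (fun i => algebraMap F L ((Equiv.funSplitAt j F).symm (0, y) i)) g)), ?_⟩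
  rw [map_scaleVars_scaledValuePoly, Fintype.prod_equiv (Equiv.funSplitAt j F) _
    (fun z => Polynomial.X - Polynomial.C (scaleVars
      (fun i => algebraMap F L ((Equiv.funSplitAt j F).symm (0, z.2) i)) g)),
    Fintype.prod_prod_type]
  · dsimp only
    rw [Finset.prod_const, Finset.card_univ]
  intro x
  congr 4
  ext i
  congr 1
  by_cases h : i = j <;> simp [h, Equiv.funSplitAt, Equiv.piSplitAt]

theorem coeff_scaledValuePoly_eq_zero {n : ℕ} (g : MvPolynomial (Fin n) L) (d k : ℕ)
    (hg : g.totalDegree ≤ d) (hk : ¬ Fintype.card F ∣ k)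
    (hd : (Fintype.card F ^ n - k) * d < n * (Fintype.card F - 1)) :
    (scaledValuePoly F g).coeff k = 0 := by
  classical
  ext m
  rw [coeff_zero]
  by_contra hm
  have hdvd : ∀ j, Fintype.card F - 1 ∣ m j := by
    intro j
    rw [← FiniteField.forall_pow_eq_one_iff F]
    intro u
    have h := congrArg (fun P => coeff m (Polynomial.coeff P k))
      (map_units_scaledValuePoly g (Function.update (1 : Fin n → Fˣ) j u))
    simp only [Polynomial.coeff_map, AlgHom.toRingHom_eq_coe, RingHom.coe_coe,
      coeff_scaleVars] at h
    have h1 := mul_right_cancel₀ hm (h.trans (one_mul _).symm)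
    rw [Finset.prod_eq_single j (fun i _ hi => by simp [hi]) (by simp)] at h1
    rw [Function.update_self, ← map_pow] at h1
    refine Units.ext ((algebraMap F L).injective ?_)
    simpa using h1
  have hpos : ∀ j, m j ≠ 0 := by
    intro j hj
    obtain ⟨H, hH⟩ := exists_map_kill_scaledValuePoly (F := F) g j
    have h := congrArg (fun P => coeff m (Polynomial.coeff P k)) hH
    simp only [Polynomial.coeff_map, AlgHom.toRingHom_eq_coe, RingHom.coe_coe,
      coeff_scaleVars, coeff_pow_card_eq_zero F H hk, coeff_zero] at h
    rw [Finset.prod_eq_one, one_mul] at h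
    · exact hm h
    · intro i _
      by_cases hi : i = j
      · simp [hi, hj]
      · simp [hi]
  have h1 : n * (Fintype.card F - 1) ≤ m.degree := by
    rw [Finsupp.degree_eq_sum]
    calc n * (Fintype.card F - 1) = ∑ _j : Fin n, (Fintype.card F - 1) := by simp
      _ ≤ ∑ j, m j := Finset.sum_le_sum fun j _ =>
        Nat.le_of_dvd (Nat.pos_of_ne_zero (hpos j)) (hdvd j)
  have h2 : m.degree ≤ ((scaledValuePoly F g).coeff k).totalDegree :=
    le_totalDegree (mem_support_iff.mpr hm)
  have h3 := totalDegree_coeff_prod_X_sub_C_le Finset.univ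
    (fun x : Fin n → F => scaleVars (fun j => algebraMap F L (x j)) g) d
    (fun x => (totalDegree_scaleVars_le _ g).trans hg) k
  rw [Finset.card_univ, Fintype.card_fun, Fintype.card_fin] at h3
  exact absurd (h1.trans (h2.trans h3)) (not_le.mpr hd)

theorem coeff_prod_X_sub_C_eval_eq_zero {n : ℕ} (g : MvPolynomial (Fin n) L) (d k : ℕ)
    (hg : g.totalDegree ≤ d) (hk : ¬ Fintype.card F ∣ k)
    (hd : (Fintype.card F ^ n - k) * d < n * (Fintype.card F - 1)) :
    (∏ x : Fin n → F, (Polynomial.X -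
      Polynomial.C (eval (fun j => algebraMap F L (x j)) g))).coeff k = 0 := by
  have h : (scaledValuePoly F g).map (eval 1) = ∏ x : Fin n → F, (Polynomial.X -
      Polynomial.C (eval (fun j => algebraMap F L (x j)) g)) := by
    simp [scaledValuePoly, Polynomial.map_prod, eval_one_scaleVars]
  rw [← h, Polynomial.coeff_map, coeff_scaledValuePoly_eq_zero g d k hg hk hd, map_zero]

/-- A non-surjective map `F ^ n → L`, `#L = #F ^ n`, given by a polynomial of degree at most `d`
over `L`, misses either at least `#F` values, or at least `n (#F - 1) / d` values. -/
theorem card_range_eval_le [Fintype L] {n : ℕ} (hn : 0 < n)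
    (hL : Fintype.card L = Fintype.card F ^ n)
    (g : MvPolynomial (Fin n) L) (d : ℕ) (hg : g.totalDegree ≤ d) (hd : 1 ≤ d)
    (hns : ¬ Function.Surjective fun x : Fin n → F => eval (fun j => algebraMap F L (x j)) g) :
    ∃ e ≤ Fintype.card F ^ n,
      (Set.range fun x : Fin n → F => eval (fun j => algebraMap F L (x j)) g).ncard ≤ e ∧
      (Fintype.card F ≤ Fintype.card F ^ n - e ∨
        n * (Fintype.card F - 1) ≤ (Fintype.card F ^ n - e) * d) := by
  classical
  set q := Fintype.card F with hq
  have hq1 : 1 < q := Fintype.one_lt_card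
  have hM1 : 1 < q ^ n := Nat.one_lt_pow hn.ne' hq1
  set v : (Fin n → F) → L := fun x => eval (fun j => algebraMap F L (x j)) g with hv
  set P : Polynomial L := ∏ x, (Polynomial.X - Polynomial.C (v x)) with hP
  set Q : Polynomial L := Polynomial.X ^ q ^ n - Polynomial.X with hQ
  have hQeval : ∀ y : L, Q.eval y = 0 := fun y => by
    simp [hQ, ← hL, FiniteField.pow_card]
  have hPeval : ∀ y : L, P.eval y = 0 ↔ y ∈ Set.range v := fun y => by
    simp [hP, Polynomial.eval_prod, Finset.prod_eq_zero_iff, sub_eq_zero, eq_comm (a := y)]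
  have hPmonic : P.Monic := Polynomial.monic_prod_of_monic _ _ fun x _ =>
    Polynomial.monic_X_sub_C _
  have hPdeg : P.natDegree = q ^ n := by
    rw [hP, Polynomial.natDegree_prod_of_monic _ _ fun x _ => Polynomial.monic_X_sub_C _]
    simp [hq]
  have hne : P - Q ≠ 0 := fun h => hns fun y => (hPeval y).mp (by
    rw [sub_eq_zero.mp h, hQeval])
  have hcoeff : (P - Q).coeff (P - Q).natDegree ≠ 0 := by
    simpa using hne
  have hQdeg : Q.natDegree ≤ q ^ n := by
    refine (Polynomial.natDegree_sub_le _ _).trans ?_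
    simp [hM1.le]
  set e := (P - Q).natDegree with he
  have hele : e ≤ q ^ n := (Polynomial.natDegree_sub_le _ _).trans (by
    rw [hPdeg]; exact max_le le_rfl hQdeg)
  refine ⟨e, hele, ?_, ?_⟩
  · have hsub : Set.range v ⊆ ((P - Q).roots.toFinset : Set L) := by
      intro y hy
      have : P.eval y = 0 := (hPeval y).mpr hy
      simp [hne, this, hQeval]
    calc (Set.range v).ncard ≤ ((P - Q).roots.toFinset : Set L).ncard :=
          Set.ncard_le_ncard hsub (Finset.finite_toSet _)
      _ = (P - Q).roots.toFinset.card := Set.ncard_coe_finset _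
      _ ≤ _ := (Multiset.toFinset_card_le _).trans (Polynomial.card_roots' _)
  · by_contra! hcon
    obtain ⟨h1, h2⟩ := hcon
    apply hcoeff
    have hbern : n * (q - 1) + 1 ≤ q ^ n := by
      have := one_add_mul_le_pow (R := ℤ) (a := q - 1) (by omega) n
      rw [add_sub_cancel, add_comm] at this
      zify [hq1.le]
      exact this
    have he1 : e ≠ 1 := fun h => by
      rw [h] at h2
      have : q ^ n - 1 ≤ (q ^ n - 1) * d := Nat.le_mul_of_pos_right _ hd
      omega
    have hX : (Polynomial.X : Polynomial L).coeff e = 0 := by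
      rw [Polynomial.coeff_X, if_neg (Ne.symm he1)]
    rw [Polynomial.coeff_sub, hQ, Polynomial.coeff_sub, Polynomial.coeff_X_pow, hX]
    rcases hele.eq_or_lt with heq | hlt
    · have := hPmonic.coeff_natDegree
      rw [hPdeg, ← heq] at this
      rw [this, if_pos heq]
      simp
    · rw [if_neg hlt.ne]
      have hdvd : ¬ q ∣ e := fun h => by
        have h3 : q ∣ q ^ n - e := Nat.dvd_sub (dvd_pow_self q hn.ne') h
        exact absurd (Nat.le_of_dvd (by omega) h3) (by omega)
      rw [hP, hv, coeff_prod_X_sub_C_eval_eq_zero g d e hg hdvd h2]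
      simp

/-- A system of `n` polynomials in `n` variables over `F` is a single polynomial over an extension
`L` of `F` of degree `n`. -/
theorem card_range_eval_pi_le [Fintype L] {n : ℕ} (hn : 0 < n) (b : Module.Basis (Fin n) F L)
    (f : Fin n → MvPolynomial (Fin n) F) (d : ℕ) (hf : ∀ i, (f i).totalDegree ≤ d) (hd : 1 ≤ d)
    (hV : (Set.range fun x : Fin n → F => fun i => eval x (f i)).ncard < Fintype.card F ^ n) :
    ∃ e ≤ Fintype.card F ^ n,
      (Set.range fun x : Fin n → F => fun i => eval x (f i)).ncard ≤ e ∧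
      (Fintype.card F ≤ Fintype.card F ^ n - e ∨
        n * (Fintype.card F - 1) ≤ (Fintype.card F ^ n - e) * d) := by
  have hL : Fintype.card L = Fintype.card F ^ n := by
    rw [Module.card_fintype b, Fintype.card_fin]
  let g : MvPolynomial (Fin n) L := ∑ i, C (b i) * map (algebraMap F L) (f i)
  have hg : g.totalDegree ≤ d := by
    refine totalDegree_finsetSum_le fun i _ => (totalDegree_mul _ _).trans ?_
    rw [totalDegree_C, zero_add]
    exact (Finset.sup_mono (support_map_subset _ _)).trans (hf i)
  have hgv : (fun x : Fin n → F => eval (fun j => algebraMap F L (x j)) g) =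
      b.equivFun.symm ∘ fun x : Fin n → F => fun i => eval x (f i) := by
    funext x
    have hx (i) : eval (fun j => algebraMap F L (x j)) (map (algebraMap F L) (f i)) =
        algebraMap F L (eval x (f i)) := by
      rw [eval_map]
      exact (eval₂_comp (algebraMap F L) x (f i)).symm
    simp [g, hx, Module.Basis.equivFun_symm_apply, Algebra.smul_def, mul_comm]
  have hcard : (Set.range fun x : Fin n → F => eval (fun j => algebraMap F L (x j)) g).ncard =
      (Set.range fun x : Fin n → F => fun i => eval x (f i)).ncard := by
    rw [hgv, Set.range_comp, Set.ncard_image_of_injective _ b.equivFun.symm.injective]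
  have hns : ¬ Function.Surjective
      fun x : Fin n → F => eval (fun j => algebraMap F L (x j)) g := fun h => by
    rw [h.range_eq, Set.ncard_univ, Nat.card_eq_fintype_card, hL] at hcard
    omega
  rw [← hcard]
  exact card_range_eval_le hn hL g d hg hd hns

end FiniteField

/-- Let `f = (f_1,…,f_n) : 𝔽_q^n → 𝔽_q^n` be a polynomial map with
`d = deg f ≥ 1`.  If `|V_f| < q^n`, then `|V_f| ≤ q^n − min{q, n(q−1)/d}`. -/
theorem value_set_le_card_sub_min_q_degree_bound
    (F : Type*) [Field F] [Fintype F]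
    (n : ℕ) (hn : 0 < n) (f : Fin n → MvPolynomial (Fin n) F)
    (d : ℕ) (hd : d = Finset.univ.sup fun i => (f i).totalDegree) (hd1 : 1 ≤ d)
    (hV : (Set.range fun x : Fin n → F => fun i => eval x (f i)).ncard
            < Fintype.card F ^ n) :
    ((Set.range fun x : Fin n → F => fun i => eval x (f i)).ncard : ℝ)
      ≤ (Fintype.card F : ℝ) ^ n
          - min (Fintype.card F : ℝ) (n * (Fintype.card F - 1) / d) := by
  classical
  obtain ⟨p, hp⟩ := CharP.exists F
  have : Fact p.Prime := ⟨CharP.char_is_prime F p⟩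
  have : NeZero n := ⟨hn.ne'⟩
  let L := FiniteField.Extension F p n
  have : Fintype L := Fintype.ofFinite L
  let b : Module.Basis (Fin n) F L :=
    Module.finBasisOfFinrankEq F L (FiniteField.finrank_extension F p n)
  obtain ⟨e, he, hle, h⟩ := card_range_eval_pi_le hn b f d
    (fun i => hd ▸ Finset.le_sup (f := fun i => (f i).totalDegree) (Finset.mem_univ i)) hd1 hV
  have hle' : ((Set.range fun x : Fin n → F => fun i => eval x (f i)).ncard : ℝ) ≤ e := by
    exact_mod_cast hle
  have hq1 : 1 ≤ Fintype.card F := Fintype.card_pos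
  have hcast : ((Fintype.card F ^ n - e : ℕ) : ℝ) = (Fintype.card F : ℝ) ^ n - e := by
    rw [Nat.cast_sub he, Nat.cast_pow]
  suffices min (Fintype.card F : ℝ) (n * (Fintype.card F - 1) / d) ≤
      (Fintype.card F : ℝ) ^ n - e by linarith
  rw [← hcast]
  rcases h with h | h
  · exact (min_le_left _ _).trans (by exact_mod_cast h)
  · refine (min_le_right _ _).trans ?_
    rw [div_le_iff₀ (by exact_mod_cast hd1), ← Nat.cast_one, ← Nat.cast_sub hq1]
    exact_mod_cast h
end

section
/- Let f ∈ 𝔽_q[x] be a polynomial of degree d > 0. If |V_f| < q, then |V_f| ≤ q − (q−1)/d (an inequality of real numbers). -/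
open Polynomial

/-- Scaling of roots commutes with finite products of monic polynomials. -/
lemma Polynomial.prod_scaleRoots_of_monic {R ι : Type*} [CommRing R] (s : Finset ι)
    (p : ι → R[X]) (hp : ∀ i ∈ s, (p i).Monic) (r : R) :
    (∏ i ∈ s, p i).scaleRoots r = ∏ i ∈ s, (p i).scaleRoots r := by
  classical
  nontriviality R
  induction s using Finset.induction with
  | empty => simp
  | insert i s hi ih =>
    have hs : (∏ j ∈ s, p j).Monic :=
      monic_prod_of_monic _ _ fun j hj => hp j (Finset.mem_insert_of_mem hj)
    rw [Finset.prod_insert hi, Finset.prod_insert hi, mul_scaleRoots',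
      ih fun j hj => hp j (Finset.mem_insert_of_mem hj)]
    simp [(hp i (Finset.mem_insert_self i s)).leadingCoeff, hs.leadingCoeff]

lemma FiniteField.prod_X_sub_C (F : Type*) [Field F] [Fintype F] :
    ∏ a : F, (X - C a) = X ^ Fintype.card F - X := by
  have h1 : (X ^ Fintype.card F - X : F[X]).natDegree = Fintype.card F :=
    FiniteField.X_pow_card_sub_X_natDegree_eq F Fintype.one_lt_card
  have h2 : (X ^ Fintype.card F - X : F[X]).Monic :=
    monic_X_pow_sub (by simpa using Fintype.one_lt_card)
  have h := prod_multiset_X_sub_C_of_monic_of_roots_card_eq h2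
    (by rw [FiniteField.roots_X_pow_card_sub_X, h1]; rfl)
  rwa [FiniteField.roots_X_pow_card_sub_X] at h

section

variable {F : Type*} [Field F] [Fintype F]

lemma FiniteField.prod_X_sub_C_mul_of_pow_eq_zero {S : Type*} [CommRing S] [Algebra F S]
    {t : S} (ht : t ^ (Fintype.card F - 1) = 0) :
    ∏ a : F, (X - C (t * algebraMap F S a)) = X ^ Fintype.card F := by
  nontriviality S
  have hq : 1 < Fintype.card F := Fintype.one_lt_card
  have hS : ∏ a : F, (X - C (algebraMap F S a)) = X ^ Fintype.card F - X := by
    simpa [Polynomial.map_prod] using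
      congrArg (Polynomial.map (algebraMap F S)) (FiniteField.prod_X_sub_C F)
  have hdeg : (X ^ Fintype.card F - X : S[X]).natDegree = Fintype.card F := by
    rw [← hS, natDegree_finsetProd_X_sub_C_eq_card, Finset.card_univ]
  have h := prod_scaleRoots_of_monic Finset.univ (fun a : F => X - C (algebraMap F S a))
    (fun a _ => monic_X_sub_C _) t
  simp only [X_sub_C_scaleRoots, mul_comm _ t] at h
  rw [← h, hS]
  ext i
  rw [coeff_scaleRoots, hdeg, coeff_sub, coeff_X_pow, coeff_X]
  by_cases h1 : 1 = i
  · subst h1; simp [ht, hq.ne]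
  · by_cases h2 : i = Fintype.card F <;> simp [h1, h2, hq.ne]

/-- If `t ^ (q - 1) = 0`, the elements `t a`, for `a ∈ 𝔽_q`, have the same elementary symmetric
functions as `q` zeros, so polynomials have the same product of values over both families. -/
lemma FiniteField.prod_eval_mul_of_pow_eq_zero {S : Type*} [CommRing S] [Algebra F S]
    {t : S} (ht : t ^ (Fintype.card F - 1) = 0) (h : S[X]) :
    ∏ a : F, h.eval (t * algebraMap F S a) = h.coeff 0 ^ Fintype.card F := by
  nontriviality S
  have := resultant_prod_left Finset.univ (fun a : F => X - C (t * algebraMap F S a)) h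
    h.natDegree (by simp only [leadingCoeff_X_sub_C]; simp) le_rfl
  rw [FiniteField.prod_X_sub_C_mul_of_pow_eq_zero ht, natDegree_X_pow,
    resultant_X_pow_left _ _ _ le_rfl] at this
  simpa only [natDegree_X_sub_C, resultant_X_sub_C_left _ _ _ le_rfl] using this.symm

lemma FiniteField.X_pow_dvd_prod_one_sub_sub_one (f : F[X]) (hf : 0 < f.natDegree) :
    (X ^ (Fintype.card F - 1) : F[X]) ∣
      ∏ a : F, (1 - C (f.eval a) * X ^ f.natDegree) - 1 := by
  set q := Fintype.card F
  set d := f.natDegree with hd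
  let I : Ideal F[X] := Ideal.span {X ^ (q - 1)}
  rw [← Ideal.mem_span_singleton, ← Ideal.Quotient.eq_zero_iff_mem]
  let φ : F[X] →+* F[X] ⧸ I := Ideal.Quotient.mk I
  let t : F[X] ⧸ I := φ X
  have ht : t ^ (q - 1) = 0 := by
    rw [← map_pow]
    exact Ideal.Quotient.eq_zero_iff_mem.2 (Ideal.mem_span_singleton_self _)
  have hφ (a : F) : φ (C a) = algebraMap F (F[X] ⧸ I) a := rfl
  let h : (F[X] ⧸ I)[X] :=
    1 - ∑ i ∈ Finset.range (d + 1), C (φ (C (f.coeff i)) * t ^ (d - i)) * X ^ i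
  have heval (a : F) :
      h.eval (t * algebraMap F _ a) = φ (1 - C (f.eval a) * X ^ d) := by
    rw [eval_eq_sum_range (p := f), ← hd]
    simp only [h, eval_sub, eval_one, eval_finsetSum, eval_mul, eval_C, eval_pow, eval_X,
      map_sub, map_one, map_mul, map_sum, map_pow, Finset.sum_mul]
    congr 1
    refine Finset.sum_congr rfl fun i hi => ?_
    have hi' : d = (d - i) + i := by have := Finset.mem_range.1 hi; omega
    conv_rhs => rw [hi', pow_add]
    rw [← hφ, mul_pow]
    simp only [t]
    ring
  have h0 : h.coeff 0 = φ (1 - C (f.coeff 0) * X ^ d) := by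
    rw [coeff_zero_eq_eval_zero]
    simp [h, eval_finsetSum, Finset.sum_range_succ', t]
  have key := FiniteField.prod_eval_mul_of_pow_eq_zero (F := F) ht h
  simp only [heval, h0] at key
  rw [← map_prod, ← map_pow] at key
  have hfrob : (1 - C (f.coeff 0) * X ^ d : F[X]) ^ q = 1 - C (f.coeff 0) * X ^ (d * q) := by
    have := map_sub (FiniteField.frobeniusAlgHom F F[X]) 1 (C (f.coeff 0) * X ^ d)
    simp only [FiniteField.coe_frobeniusAlgHom] at this
    rw [this, one_pow, mul_pow, ← C_pow, FiniteField.pow_card, pow_mul]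
  have hzero : φ (X ^ (d * q)) = 0 := by
    refine Ideal.Quotient.eq_zero_iff_mem.2 (Ideal.mem_span_singleton.2 (pow_dvd_pow _ ?_))
    nlinarith [Nat.sub_le q 1]
  change φ _ = 0
  rw [map_sub, key, hfrob, map_sub, map_mul, hzero]
  simp

lemma Polynomial.reverse_prod_X_sub_C {R ι : Type*} [CommRing R] [IsDomain R] (s : Finset ι)
    (v : ι → R) : (∏ i ∈ s, (X - C (v i))).reverse = ∏ i ∈ s, (1 - C (v i) * X) := by
  classical
  induction s using Finset.induction with
  | empty => simpa using reverse_C (1 : R)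
  | insert i s hi ih =>
    rw [Finset.prod_insert hi, Finset.prod_insert hi, reverse_mul_of_domain, ih]
    congr 1
    rw [reverse, natDegree_X_sub_C, reflect_sub, reflect_one_X, reflect_C, pow_one]

lemma FiniteField.coeff_prod_X_sub_C_eval_eq_zero (f : F[X]) (hf : 0 < f.natDegree) {m : ℕ}
    (hm : m < Fintype.card F) (h : (Fintype.card F - m) * f.natDegree < Fintype.card F - 1) :
    (∏ a : F, (X - C (f.eval a))).coeff m = 0 := by
  have hdeg : (∏ a : F, (X - C (f.eval a))).natDegree = Fintype.card F := by
    rw [natDegree_finsetProd_X_sub_C_eq_card, Finset.card_univ]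
  have hexp : expand F f.natDegree (∏ a : F, (X - C (f.eval a))).reverse =
      ∏ a : F, (1 - C (f.eval a) * X ^ f.natDegree) := by
    rw [reverse_prod_X_sub_C]
    simp
  have hc := X_pow_dvd_iff.1 (FiniteField.X_pow_dvd_prod_one_sub_sub_one f hf) _ h
  rw [← hexp, coeff_sub, coeff_expand_mul hf, coeff_reverse, hdeg, revAt_le (Nat.sub_le _ _),
    Nat.sub_sub_self hm.le, coeff_one, if_neg, sub_zero] at hc
  · exact hc
  · exact Nat.mul_ne_zero (by omega) (by omega)

/-- Wan's bound, in its integral form. -/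
lemma FiniteField.card_sub_one_le_mul_card_sub_ncard_range_eval (f : F[X])
    (hf : 0 < f.natDegree)
    (hV : (Set.range fun x : F => f.eval x).ncard < Fintype.card F) :
    Fintype.card F - 1 ≤
      (Fintype.card F - (Set.range fun x : F => f.eval x).ncard) * f.natDegree := by
  classical
  set q := Fintype.card F with hq
  have hq1 : 1 < q := Fintype.one_lt_card
  set P : F[X] := ∏ a : F, (X - C (f.eval a)) with hP
  have hPmonic : P.Monic := monic_prod_X_sub_C _ _
  have hPdeg : P.natDegree = q := by
    rw [hP, natDegree_finsetProd_X_sub_C_eq_card, Finset.card_univ]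
  set R : F[X] := P - (X ^ q - X) with hR
  have hPeval (a : F) : P.eval (f.eval a) = 0 := by
    rw [hP, eval_prod]
    exact Finset.prod_eq_zero (Finset.mem_univ a) (by simp)
  have hR0 : R ≠ 0 := by
    intro h0
    have hsurj : Function.Surjective fun x : F => f.eval x := by
      intro y
      have hy : P.eval y = 0 := by
        rw [sub_eq_zero.1 h0]
        simp [hq, FiniteField.pow_card]
      rw [hP, eval_prod, Finset.prod_eq_zero_iff] at hy
      obtain ⟨a, -, ha⟩ := hy
      exact ⟨a, (sub_eq_zero.1 (by simpa using ha)).symm⟩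
    rw [hsurj.range_eq, Set.ncard_univ, Nat.card_eq_fintype_card] at hV
    exact lt_irrefl _ hV
  have hcard : (Set.range fun x : F => f.eval x).ncard ≤ R.natDegree := by
    rw [Set.ncard_eq_toFinset_card']
    refine card_le_degree_of_subset_roots fun y hy => ?_
    obtain ⟨a, rfl⟩ := Set.mem_toFinset.1 hy
    rw [mem_roots hR0, IsRoot, hR, eval_sub, hPeval]
    simp [hq, FiniteField.pow_card]
  have hlead : R.coeff R.natDegree ≠ 0 := leadingCoeff_ne_zero.2 hR0
  have hlt : R.natDegree < q := by
    refine lt_of_le_of_ne ?_ fun h => hlead ?_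
    · refine (natDegree_sub_le _ _).trans (max_le hPdeg.le ?_)
      rw [FiniteField.X_pow_card_sub_X_natDegree_eq F hq1]
    · have h1 : P.coeff q = 1 := hPdeg ▸ hPmonic.coeff_natDegree
      rw [h, hR, coeff_sub, h1, coeff_sub, coeff_X_pow, coeff_X]
      simp [hq1.ne]
  have hbound : q - 1 ≤ (q - R.natDegree) * f.natDegree := by
    by_contra! hlt'
    have hm1 : 1 ≠ R.natDegree := by
      intro h
      rw [← h] at hlt'
      exact absurd hlt' (not_lt.2 (Nat.le_mul_of_pos_right _ hf))
    refine hlead ?_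
    have hP0 : P.coeff R.natDegree = 0 :=
      FiniteField.coeff_prod_X_sub_C_eval_eq_zero f hf hlt hlt'
    conv_lhs => rw [hR]
    rw [coeff_sub, ← hR, hP0, coeff_sub, coeff_X_pow, coeff_X, if_neg hlt.ne, if_neg hm1]
    simp
  exact hbound.trans (Nat.mul_le_mul_right _ (Nat.sub_le_sub_left hcard q))

end

/-- Let `f ∈ 𝔽_q[x]` be a polynomial of degree `d > 0`.
If `|V_f| < q`, then `|V_f| ≤ q − (q−1)/d`. -/
theorem univariate_value_set_le_card_sub_degree_bound
    (F : Type*) [Field F] [Fintype F]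
    (f : Polynomial F) (d : ℕ) (hd : d = f.natDegree) (hd1 : 0 < d)
    (hV : (Set.range fun x : F => Polynomial.eval x f).ncard < Fintype.card F) :
    ((Set.range fun x : F => Polynomial.eval x f).ncard : ℝ)
      ≤ (Fintype.card F : ℝ) - (Fintype.card F - 1) / d := by
  subst hd
  have h := FiniteField.card_sub_one_le_mul_card_sub_ncard_range_eval f hd1 hV
  have h1 : 1 ≤ Fintype.card F := Fintype.card_pos
  have h2 : ((Fintype.card F : ℝ) - 1) ≤
      ((Fintype.card F : ℝ) - (Set.range fun x : F => Polynomial.eval x f).ncard) *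
        f.natDegree := by
    rw [← Nat.cast_one, ← Nat.cast_sub h1, ← Nat.cast_sub hV.le]
    exact_mod_cast h
  rw [← div_le_iff₀ (by exact_mod_cast hd1)] at h2
  linarith
end

section
/- Let f ∈ 𝔽_q[x] be a nonzero polynomial of degree d ≥ 1. Then: (i) for every positive integer k with k < (q−1)/d, the element S_k(f) is divisible by pk in ℤ_q (hence (q−1)/d ≤ U(f) whenever U(f) exists); and (ii) if f is a permutation polynomial of 𝔽_q, then U(f) exists and U(f) = q−1. -/
open Polynomial in
/-- The lift of a polynomial to the ring of Witt vectors by Teichmüller lifts of its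
coefficients. -/
noncomputable def Polynomial.teichmullerLift (p : ℕ) [Fact p.Prime] {R : Type*} [CommRing R]
    (f : R[X]) : (WittVector p R)[X] :=
  ∑ i ∈ f.support, C (WittVector.teichmuller p (f.coeff i)) * X ^ i

namespace Polynomial

variable (p : ℕ) [Fact p.Prime] {R : Type*} [CommRing R]

theorem eval_teichmullerLift (f : R[X]) (w : WittVector p R) :
    (f.teichmullerLift p).eval w =
      ∑ i ∈ f.support, WittVector.teichmuller p (f.coeff i) * w ^ i := by
  simp [teichmullerLift, eval_finsetSum]

theorem natDegree_teichmullerLift_le (f : R[X]) :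
    (f.teichmullerLift p).natDegree ≤ f.natDegree :=
  natDegree_sum_le_of_forall_le _ _ fun i hi =>
    (natDegree_C_mul_X_pow_le _ i).trans (le_natDegree_of_mem_supp i hi)

theorem constantCoeff_eval_teichmullerLift (f : R[X]) (x : R) :
    WittVector.constantCoeff ((f.teichmullerLift p).eval (WittVector.teichmuller p x)) =
      f.eval x := by
  rw [eval_teichmullerLift, map_sum, eval_eq_sum, Polynomial.sum]
  refine Finset.sum_congr rfl fun i _ => ?_
  rw [map_mul, map_pow]
  simp [WittVector.constantCoeff_apply, WittVector.teichmuller_coeff_zero]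

end Polynomial

theorem natCast_mul_dvd_pow_sub_pow {R : Type*} [CommRing R] {p : ℕ} (hp : p ≠ 1)
    (hunit : ∀ m : ℕ, ¬ p ∣ m → IsUnit (m : R)) {a b : R} (h : (p : R) ∣ a - b)
    {k : ℕ} (hk : k ≠ 0) : ((p * k : ℕ) : R) ∣ a ^ k - b ^ k := by
  obtain ⟨e, m, hm, rfl⟩ := Nat.exists_eq_pow_mul_and_not_dvd hk p hp
  rw [← mul_assoc, ← pow_succ', Nat.cast_mul, (hunit m hm).mul_right_dvd, Nat.cast_pow,
    pow_mul, pow_mul]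
  exact (dvd_sub_pow_of_dvd_sub h e).trans (sub_dvd_pow_sub_pow _ _ m)

namespace WittVector

variable (p : ℕ) [Fact p.Prime] {F : Type*} [Field F] [CharP F p]

theorem isUnit_natCast {m : ℕ} (hm : ¬ p ∣ m) : IsUnit (m : WittVector p F) := by
  refine isUnit_of_coeff_zero_ne_zero _ ?_
  rw [← constantCoeff_apply, map_natCast]
  rwa [Ne, CharP.cast_eq_zero_iff F p]

variable [Fintype F]

theorem natCast_p_dvd_iff (w : WittVector p F) :
    (p : WittVector p F) ∣ w ↔ constantCoeff w = 0 := by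
  rw [← Ideal.mem_span_singleton, mem_span_p_iff_coeff_zero_eq_zero, constantCoeff_apply]

theorem sum_teichmuller_pow_eq_zero {j : ℕ} (hj : ¬ Fintype.card F - 1 ∣ j) :
    ∑ x : F, teichmuller p x ^ j = 0 := by
  obtain ⟨u, hu⟩ : ∃ u : Fˣ, u ^ j ≠ 1 := by
    by_contra! h
    exact hj ((FiniteField.forall_pow_eq_one_iff F j).1 h)
  have hne : teichmuller p (u : F) ^ j ≠ 1 := by
    intro h
    have h0 := congrArg constantCoeff h
    rw [map_pow, constantCoeff_apply, teichmuller_coeff_zero, map_one] at h0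
    exact hu (Units.ext (by simpa using h0))
  have hmul : teichmuller p (u : F) ^ j * ∑ x : F, teichmuller p x ^ j =
      ∑ x : F, teichmuller p x ^ j := by
    rw [Finset.mul_sum, ← Equiv.sum_comp u.mulLeft (fun x : F => teichmuller p x ^ j)]
    simp [mul_pow]
  by_contra h0
  exact hne (mul_eq_right₀ h0 |>.1 hmul)

theorem sum_eval_teichmuller (P : Polynomial (WittVector p F))
    (hP : P.natDegree < Fintype.card F - 1) :
    ∑ x : F, P.eval (teichmuller p x) = Fintype.card F * P.coeff 0 := by
  simp_rw [Polynomial.eval_eq_sum_range]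
  rw [Finset.sum_comm]
  simp_rw [← Finset.mul_sum]
  rw [Finset.sum_eq_single_of_mem 0 (by simp)]
  · simp [mul_comm]
  · intro j hj hj0
    rw [sum_teichmuller_pow_eq_zero, mul_zero]
    refine Nat.not_dvd_of_pos_of_lt (by omega) ?_
    have := Finset.mem_range.1 hj
    omega

theorem natCast_mul_dvd_card {k : ℕ} (hk : k ≠ 0) (hlt : k < Fintype.card F) :
    ((p * k : ℕ) : WittVector p F) ∣ (Fintype.card F : WittVector p F) := by
  obtain ⟨n, hp, hn⟩ := FiniteField.card F p
  obtain ⟨e, m, hm, rfl⟩ := Nat.exists_eq_pow_mul_and_not_dvd hk p hp.ne_one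
  rw [← mul_assoc, ← pow_succ', Nat.cast_mul, (isUnit_natCast p hm).mul_right_dvd, hn]
  refine Nat.cast_dvd_cast (pow_dvd_pow p ?_)
  have hm0 : 0 < m := Nat.pos_of_ne_zero fun h => hm (h ▸ dvd_zero p)
  rw [hn] at hlt
  exact (Nat.pow_lt_pow_iff_right hp.one_lt).1 ((Nat.le_mul_of_pos_right _ hm0).trans_lt hlt)

theorem natCast_mul_dvd_sum_eval_teichmullerLift_pow (f : Polynomial F) {k : ℕ} (hk : k ≠ 0)
    (hlt : k < Fintype.card F) (hdeg : k * f.natDegree < Fintype.card F - 1) :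
    ((p * k : ℕ) : WittVector p F) ∣
      ∑ x : F, ((f.teichmullerLift p).eval (teichmuller p x)) ^ k := by
  simp_rw [← Polynomial.eval_pow]
  rw [sum_eval_teichmuller]
  · exact (natCast_mul_dvd_card p hk hlt).mul_right _
  · exact (Polynomial.natDegree_pow_le.trans
      (Nat.mul_le_mul_left k (f.natDegree_teichmullerLift_le p))).trans_lt hdeg

theorem natCast_mul_dvd_sum_eval_teichmullerLift_pow_of_bijective {f : Polynomial F}
    (hf : Function.Bijective fun x : F => f.eval x) {k : ℕ} (hk : k ≠ 0)
    (hlt : k < Fintype.card F - 1) :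
    ((p * k : ℕ) : WittVector p F) ∣
      ∑ x : F, ((f.teichmullerLift p).eval (teichmuller p x)) ^ k := by
  have h0 : ∑ x : F, teichmuller p (f.eval x) ^ k = 0 := by
    rw [hf.sum_comp (fun y : F => teichmuller p y ^ k)]
    exact sum_teichmuller_pow_eq_zero p
      (Nat.not_dvd_of_pos_of_lt (Nat.pos_of_ne_zero hk) hlt)
  rw [← sub_zero (∑ x : F, _), ← h0, ← Finset.sum_sub_distrib]
  refine Finset.dvd_sum fun x _ => natCast_mul_dvd_pow_sub_pow (Fact.out : p.Prime).ne_one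
    (fun m hm => isUnit_natCast p hm) ?_ hk
  rw [natCast_p_dvd_iff, map_sub, Polynomial.constantCoeff_eval_teichmullerLift,
    constantCoeff_apply, teichmuller_coeff_zero, sub_self]

theorem not_natCast_p_dvd_sum_eval_teichmullerLift_pow {f : Polynomial F}
    (hf : Function.Bijective fun x : F => f.eval x) :
    ¬ (p : WittVector p F) ∣
      ∑ x : F, ((f.teichmullerLift p).eval (teichmuller p x)) ^ (Fintype.card F - 1) := by
  classical
  rw [natCast_p_dvd_iff, map_sum]
  simp_rw [map_pow, Polynomial.constantCoeff_eval_teichmullerLift]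
  rw [hf.sum_comp (fun y : F => y ^ (Fintype.card F - 1))]
  have h (y : F) : y ^ (Fintype.card F - 1) = 1 - if y = 0 then 1 else 0 := by
    have := Fintype.one_lt_card (α := F)
    split_ifs with hy
    · rw [hy, zero_pow (by omega), sub_self]
    · rw [FiniteField.pow_card_sub_one_eq_one y hy, sub_zero]
  simp [h]

end WittVector


/-- Let `f ∈ 𝔽_q[x]` be nonzero of degree `d ≥ 1`.  Then:
(i) for every positive integer `k` with `k < (q−1)/d`, the element `S_k(f)` is divisible by
`pk` in `ℤ_q` (hence `(q−1)/d ≤ U(f)` whenever `U(f)` exists); and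
(ii) if `f` is a permutation polynomial of `𝔽_q`, then `U(f)` exists and `U(f) = q−1`. -/
theorem U_bounds
    (p : ℕ) [Fact p.Prime] (F : Type*) [Field F] [Fintype F] [CharP F p]
    (f : Polynomial F) (hf : f ≠ 0)
    (d : ℕ) (hd : d = f.natDegree) (hd1 : 1 ≤ d)
    -- the power sums `S_k(f)` of the Teichmüller lift of `f`
    (S : ℕ → WittVector p F)
    (hS : ∀ k : ℕ, S k = ∑ x : F,
        (∑ i ∈ f.support, WittVector.teichmuller p (f.coeff i)
            * (WittVector.teichmuller p x) ^ i) ^ k) :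
    -- (i)
    ((∀ k : ℕ, 0 < k → (k : ℝ) < ((Fintype.card F : ℝ) - 1) / d →
        ((p * k : ℕ) : WittVector p F) ∣ S k) ∧
      ({k : ℕ | 0 < k ∧ ¬ ((p * k : ℕ) : WittVector p F) ∣ S k}.Nonempty →
        ((Fintype.card F : ℝ) - 1) / d
          ≤ sInf {k : ℕ | 0 < k ∧ ¬ ((p * k : ℕ) : WittVector p F) ∣ S k})) ∧
    -- (ii)
    (Function.Bijective (fun x : F => Polynomial.eval x f) →
      {k : ℕ | 0 < k ∧ ¬ ((p * k : ℕ) : WittVector p F) ∣ S k}.Nonempty ∧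
      sInf {k : ℕ | 0 < k ∧ ¬ ((p * k : ℕ) : WittVector p F) ∣ S k}
        = Fintype.card F - 1) := by
  subst hd
  have hS' (k : ℕ) : S k =
      ∑ x : F, ((f.teichmullerLift p).eval (WittVector.teichmuller p x)) ^ k := by
    simp_rw [hS, Polynomial.eval_teichmullerLift]
  have hcard := Fintype.one_lt_card (α := F)
  have hsmall (k : ℕ) (hk : 0 < k)
      (hlt : (k : ℝ) < ((Fintype.card F : ℝ) - 1) / f.natDegree) :
      ((p * k : ℕ) : WittVector p F) ∣ S k := by
    rw [lt_div_iff₀ (by exact_mod_cast hd1)] at hlt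
    have hdeg : k * f.natDegree < Fintype.card F - 1 := by
      have : k * f.natDegree + 1 < Fintype.card F := by
        exact_mod_cast (by linarith : (k : ℝ) * f.natDegree + 1 < Fintype.card F)
      omega
    rw [hS']
    have := Nat.le_mul_of_pos_right k hd1
    exact WittVector.natCast_mul_dvd_sum_eval_teichmullerLift_pow p f hk.ne' (by omega) hdeg
  refine ⟨⟨hsmall, fun hne => ?_⟩, fun hbij => ?_⟩
  · by_contra! hlt
    exact (Nat.sInf_mem hne).2 (hsmall _ (Nat.sInf_mem hne).1 hlt)
  · have hmem : Fintype.card F - 1 ∈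
        {k : ℕ | 0 < k ∧ ¬ ((p * k : ℕ) : WittVector p F) ∣ S k} := by
      refine ⟨by omega, fun h => ?_⟩
      rw [hS', Nat.cast_mul] at h
      exact WittVector.not_natCast_p_dvd_sum_eval_teichmullerLift_pow p hbij
        (dvd_of_mul_right_dvd h)
    refine ⟨⟨_, hmem⟩, le_antisymm (Nat.sInf_le hmem) (le_csInf ⟨_, hmem⟩ fun k hk => ?_)⟩
    by_contra! hlt
    refine hk.2 ?_
    rw [hS']
    exact WittVector.natCast_mul_dvd_sum_eval_teichmullerLift_pow_of_bijective p hbij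
      hk.1.ne' hlt
end

section
/- Let p be a prime, e ∈ ℕ, and n ≥ 1. There exist polynomials h_1,…,h_e ∈ ℤ[x_1,…,x_n], each h_t being homogeneous of degree p^t (or zero), such that for every commutative ring R and all x_1,…,x_n ∈ R: (x_1 + ⋯ + x_n)^{p^e} = x_1^{p^e} + ⋯ + x_n^{p^e} + p·h_1(x_1^{p^{e−1}},…,x_n^{p^{e−1}}) + p²·h_2(x_1^{p^{e−2}},…,x_n^{p^{e−2}}) + ⋯ + p^e·h_e(x_1,…,x_n). -/
open MvPolynomial in
theorem MvPolynomial.IsHomogeneous.of_C_mul {σ R : Type*} [CommRing R] [IsDomain R] {r : R}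
    (hr : r ≠ 0) {φ : MvPolynomial σ R} {m : ℕ} (hφ : (C r * φ).IsHomogeneous m) :
    φ.IsHomogeneous m := fun d hd ↦
  hφ (by rw [coeff_C_mul]; exact mul_ne_zero hr hd)

open MvPolynomial in
theorem MvPolynomial.natCast_dvd_sum_X_pow_sub_sum_X_pow {σ : Type*} [Fintype σ] {p : ℕ}
    (hp : p.Prime) :
    (p : MvPolynomial σ ℤ) ∣ (∑ i, X i) ^ p - ∑ i, X i ^ p := by
  have := Fact.mk hp
  have h := (C_dvd_iff_zmod p ((∑ i : σ, X i) ^ p - ∑ i : σ, X i ^ p : MvPolynomial σ ℤ)).2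
    (by simp [sum_pow_char])
  simpa using h

open MvPolynomial in
/-- The difference between `(∑ i, X i) ^ p ^ (k + 1)` and its Frobenius twist
`(∑ i, X i ^ p) ^ p ^ k` is `p ^ (k + 1)` times a homogeneous polynomial. -/
theorem MvPolynomial.exists_isHomogeneous_sum_X_pow_eq {σ : Type*} [Fintype σ] {p : ℕ}
    (hp : p.Prime) (k : ℕ) :
    ∃ h : MvPolynomial σ ℤ, h.IsHomogeneous (p ^ (k + 1)) ∧
      (∑ i, X i) ^ p ^ (k + 1) = (∑ i, X i ^ p) ^ p ^ k + (p : MvPolynomial σ ℤ) ^ (k + 1) * h := by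
  obtain ⟨h, hh⟩ := dvd_sub_pow_of_dvd_sub
    (natCast_dvd_sum_X_pow_sub_sum_X_pow (σ := σ) hp) k
  rw [← pow_mul, ← pow_succ'] at hh
  refine ⟨h, ?_, sub_eq_iff_eq_add'.1 hh⟩
  refine IsHomogeneous.of_C_mul (r := (p : ℤ) ^ (k + 1))
    (pow_ne_zero _ (Nat.cast_ne_zero.2 hp.ne_zero)) ?_
  have hC : C ((p : ℤ) ^ (k + 1)) * h = (p : MvPolynomial σ ℤ) ^ (k + 1) * h := by simp
  rw [hC, ← hh]
  refine IsHomogeneous.sub ?_ ?_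
  · simpa using (IsHomogeneous.sum Finset.univ (fun i : σ ↦ (X i : MvPolynomial σ ℤ)) 1
      fun i _ ↦ isHomogeneous_X ℤ i).pow (p ^ (k + 1))
  · simpa only [pow_succ'] using
      (IsHomogeneous.sum Finset.univ (fun i : σ ↦ (X i ^ p : MvPolynomial σ ℤ)) p
        fun i _ ↦ isHomogeneous_X_pow i p).pow (p ^ k)

/-- Let `p` be a prime, `e ∈ ℕ`, `n ≥ 1`.  There exist polynomials
`h_1, …, h_e ∈ ℤ[x_1,…,x_n]`, each `h_t` homogeneous of degree `p^t` (or zero), such that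
for every commutative ring `R` and all `x_1, …, x_n ∈ R`:
`(x_1 + ⋯ + x_n)^{p^e} = x_1^{p^e} + ⋯ + x_n^{p^e} + Σ_{t=1}^e p^t · h_t(x_1^{p^{e−t}},…,x_n^{p^{e−t}})`.
Here `h t` (for `t : Fin e`) plays the role of `h_{t+1}`. -/
theorem pow_p_pow_expansion (p : ℕ) (hp : p.Prime) (e n : ℕ) (hn : 1 ≤ n) :
    ∃ h : Fin e → MvPolynomial (Fin n) ℤ,
      (∀ t : Fin e, (h t).IsHomogeneous (p ^ ((t : ℕ) + 1)) ∨ h t = 0) ∧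
      ∀ (R : Type*) [CommRing R] (x : Fin n → R),
        (∑ i, x i) ^ (p ^ e) =
          ∑ i, (x i) ^ (p ^ e) +
            ∑ t : Fin e, (p : R) ^ ((t : ℕ) + 1) *
              MvPolynomial.aeval (fun i => x i ^ (p ^ (e - ((t : ℕ) + 1)))) (h t) := by
  choose h hhom heq using
    MvPolynomial.exists_isHomogeneous_sum_X_pow_eq (σ := Fin n) hp
  refine ⟨fun t ↦ h t, fun t ↦ Or.inl (hhom t), fun R _ x ↦ ?_⟩
  have step : ∀ t ∈ Finset.range e,
      (p : R) ^ (t + 1) * MvPolynomial.aeval (fun i ↦ x i ^ p ^ (e - (t + 1))) (h t) =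
        (∑ i, x i ^ p ^ (e - (t + 1))) ^ p ^ (t + 1) - (∑ i, x i ^ p ^ (e - t)) ^ p ^ t := by
    intro t ht
    have hsub : e - t = e - (t + 1) + 1 := by
      have := Finset.mem_range.1 ht
      omega
    have key := congrArg (MvPolynomial.aeval fun i ↦ x i ^ p ^ (e - (t + 1))) (heq t)
    simp only [map_add, map_mul, map_pow, map_sum, map_natCast, MvPolynomial.aeval_X,
      ← pow_mul (x _), ← pow_succ, ← hsub] at key
    rw [key, add_sub_cancel_left]
  rw [Fin.sum_univ_eq_sum_range (fun t ↦ (p : R) ^ (t + 1) *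
      MvPolynomial.aeval (fun i ↦ x i ^ p ^ (e - (t + 1))) (h t)), Finset.sum_congr rfl step,
    Finset.sum_range_sub (fun t ↦ (∑ i, x i ^ p ^ (e - t)) ^ p ^ t)]
  simp
end

section
/- Let f = (f_1,…,f_n) : 𝔽_q^n → 𝔽_q^n be a polynomial map with d = deg f ≥ 1 that involves all n variables. Then ω_f ≥ μ_f·(q−1) ≥ n(q−1)/d (inequalities of real numbers). -/
open MvPolynomial Pointwise

/-- If every coordinate is positive in some exponent vector, then assigning the weight `Q` to all
exponent vectors gives an admissible tuple for the integral dilation factor. -/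
theorem integralDilations_nonempty {n : ℕ} (E : Finset (Fin n →₀ ℕ)) (Q : ℕ)
    (hall : ∀ i : Fin n, ∃ D ∈ E, 0 < D i) :
    {s : ℕ | ∃ k : (Fin n →₀ ℕ) → ℕ, (∀ D ∈ E, k D ≤ Q) ∧
      (∀ i : Fin n, ∃ c : ℕ, 0 < c ∧ ∑ D ∈ E, k D * D i = c * Q) ∧
      s = ∑ D ∈ E, k D}.Nonempty := by
  refine ⟨_, fun _ => Q, fun _ _ => le_rfl, fun i => ⟨∑ D ∈ E, D i, ?_, ?_⟩, rfl⟩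
  · obtain ⟨D, hD, hDi⟩ := hall i
    exact Finset.sum_pos' (fun _ _ => Nat.zero_le _) ⟨D, hD, hDi⟩
  · rw [← Finset.mul_sum, mul_comm]

/-- An admissible tuple `k` for the integral dilation factor yields the dilation factor
`(∑ k) / Q` of the Newton polytope. -/
theorem sum_div_mem_dilations {n : ℕ} (hn : 0 < n) (E : Finset (Fin n →₀ ℕ))
    (k : (Fin n →₀ ℕ) → ℕ) (Q : ℕ) (hQ : 0 < Q)
    (hk : ∀ i : Fin n, ∃ c : ℕ, 0 < c ∧ ∑ D ∈ E, k D * D i = c * Q) :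
    ((∑ D ∈ E, k D : ℕ) : ℝ) / (Q : ℝ) ∈ {r : ℝ | 0 < r ∧
      ∃ v ∈ r • convexHull ℝ ({0} ∪ {x : Fin n → ℝ | ∃ D ∈ E, x = fun i => (D i : ℝ)}),
        ∀ i : Fin n, ∃ m : ℕ, 0 < m ∧ v i = m} := by
  have hQ0 : (0 : ℝ) < Q := by exact_mod_cast hQ
  have hs : 0 < ∑ D ∈ E, k D := by
    obtain ⟨c, hc, h⟩ := hk ⟨0, hn⟩
    by_contra h0
    have hz : ∀ D ∈ E, k D = 0 := Finset.sum_eq_zero_iff.1 (by omega)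
    rw [Finset.sum_eq_zero fun D hD => by rw [hz D hD, zero_mul]] at h
    exact (Nat.mul_pos hc hQ).ne h
  have hs0 : (0 : ℝ) < (∑ D ∈ E, k D : ℕ) := by exact_mod_cast hs
  set s : ℝ := ((∑ D ∈ E, k D : ℕ) : ℝ) with hsdef
  refine ⟨div_pos hs0 hQ0, _, Set.smul_mem_smul_set
    ((convex_convexHull ℝ _).sum_mem (t := E) (w := fun D => (k D : ℝ) / s)
      (z := fun D i => (D i : ℝ)) (fun D _ => by positivity) ?_
      fun D hD => subset_convexHull ℝ _ (Or.inr ⟨D, hD, rfl⟩)), fun i => ?_⟩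
  · rw [← Finset.sum_div, ← Nat.cast_sum, div_self hs0.ne']
  · obtain ⟨c, hc, h⟩ := hk i
    refine ⟨c, hc, ?_⟩
    have h' : ∑ D ∈ E, (k D : ℝ) * (D i : ℝ) = c * Q := by exact_mod_cast h
    simp only [Pi.smul_apply, Finset.sum_apply, smul_eq_mul, div_mul_eq_mul_div]
    rw [← Finset.sum_div, h']
    field_simp

/-- On the Newton polytope of exponent vectors of degree at most `d`, the coordinate sum is at
most `d`. -/
theorem sum_coord_le_of_mem_newtonPolytope {n : ℕ} (E : Finset (Fin n →₀ ℕ)) (d : ℕ)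
    (hdeg : ∀ D ∈ E, ∑ i, D i ≤ d) {w : Fin n → ℝ}
    (hw : w ∈ convexHull ℝ ({0} ∪ {x : Fin n → ℝ | ∃ D ∈ E, x = fun i => (D i : ℝ)})) :
    ∑ i, w i ≤ d := by
  have hlin : IsLinearMap ℝ fun x : Fin n → ℝ => ∑ i, x i :=
    ⟨fun x y => by simp [Finset.sum_add_distrib], fun c x => by simp [Finset.mul_sum]⟩
  refine convexHull_min ?_ (convex_halfSpace_le hlin (d : ℝ)) hw
  rintro x (rfl | ⟨D, hD, rfl⟩)
  · simp
  · simpa using (by exact_mod_cast hdeg D hD : ∑ i, (D i : ℝ) ≤ d)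

/-- Let `f = (f_1,…,f_n) : 𝔽_q^n → 𝔽_q^n` be a polynomial map with
`d = deg f ≥ 1` that involves all `n` variables.  Then
`ω_f ≥ μ_f·(q−1) ≥ n(q−1)/d` as real numbers. -/
theorem omega_ge_mu_ge_degree_bound
    (F : Type*) [Field F] [Fintype F]
    (n : ℕ) (hn : 0 < n) (f : Fin n → MvPolynomial (Fin n) F)
    (d : ℕ) (hd : d = Finset.univ.sup fun i => (f i).totalDegree) (hd1 : 1 ≤ d)
    -- the set of exponent vectors of the monomials of `f_1, …, f_n`
    (E : Finset (Fin n →₀ ℕ))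
    (hE : E = Finset.univ.biUnion fun i => (f i).support)
    -- `f` involves all `n` variables
    (hall : ∀ i : Fin n, ∃ D ∈ E, 0 < D i)
    -- the Newton polytope `Δ(f)`
    (Δ : Set (Fin n → ℝ))
    (hΔ : Δ = convexHull ℝ ({0} ∪ {x : Fin n → ℝ | ∃ D ∈ E, x = fun i => (D i : ℝ)}))
    -- the minimal dilation factor `μ_f`
    (μ : ℝ)
    (hμ : μ = sInf {k : ℝ | 0 < k ∧
        ∃ v ∈ k • Δ, ∀ i : Fin n, ∃ m : ℕ, 0 < m ∧ v i = m})
    -- the integral dilation factor `ω_f`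
    (ω : ℕ)
    (hω : ω = sInf {s : ℕ | ∃ k : (Fin n →₀ ℕ) → ℕ,
        (∀ D ∈ E, k D ≤ Fintype.card F - 1) ∧
        (∀ i : Fin n, ∃ c : ℕ, 0 < c ∧
          ∑ D ∈ E, k D * D i = c * (Fintype.card F - 1)) ∧
        s = ∑ D ∈ E, k D}) :
    μ * (Fintype.card F - 1) ≤ (ω : ℝ) ∧
    (n : ℝ) * (Fintype.card F - 1) / d ≤ μ * (Fintype.card F - 1) := by
  set q : ℝ := (Fintype.card F : ℝ) - 1 with hq
  have hcard : 1 < Fintype.card F := Fintype.one_lt_card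
  have hqcast : ((Fintype.card F - 1 : ℕ) : ℝ) = q := by
    rw [hq, Nat.cast_sub hcard.le, Nat.cast_one]
  have hq0 : 0 < q := by
    rw [← hqcast]
    exact_mod_cast Nat.sub_pos_of_lt hcard
  have hd0 : (0 : ℝ) < d := by exact_mod_cast hd1
  have hdeg : ∀ D ∈ E, ∑ i, D i ≤ d := by
    intro D hD
    rw [hE] at hD
    obtain ⟨j, -, hj⟩ := Finset.mem_biUnion.1 hD
    have h1 := le_totalDegree hj
    rw [Finsupp.sum_fintype _ _ (fun _ => rfl)] at h1
    rw [hd]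
    exact h1.trans (Finset.le_sup (f := fun i => (f i).totalDegree) (Finset.mem_univ j))
  have hωmem := Nat.sInf_mem (integralDilations_nonempty E (Fintype.card F - 1) hall)
  rw [← hω] at hωmem
  obtain ⟨k, -, hk, hs⟩ := hωmem
  have hmem : (ω : ℝ) / q ∈ {k : ℝ | 0 < k ∧
      ∃ v ∈ k • Δ, ∀ i : Fin n, ∃ m : ℕ, 0 < m ∧ v i = m} := by
    rw [← hqcast, hs, hΔ]
    exact sum_div_mem_dilations hn E k _ (Nat.sub_pos_of_lt hcard) hk
  constructor
  · rw [← le_div_iff₀ hq0, hμ]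
    exact csInf_le ⟨0, fun x hx => hx.1.le⟩ hmem
  · rw [mul_div_right_comm]
    refine mul_le_mul_of_nonneg_right ?_ hq0.le
    rw [hμ]
    refine le_csInf ⟨_, hmem⟩ ?_
    rintro r ⟨hr, v, ⟨w, hw, rfl⟩, hv⟩
    rw [hΔ] at hw
    have hwd := sum_coord_le_of_mem_newtonPolytope E d hdeg hw
    rw [div_le_iff₀ hd0]
    calc (n : ℝ) = ∑ _i : Fin n, (1 : ℝ) := by simp
      _ ≤ ∑ i, r * w i := by
        refine Finset.sum_le_sum fun i _ => ?_
        obtain ⟨m, hm, hvm⟩ := hv i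
        have : r * w i = m := hvm
        rw [this]
        exact_mod_cast hm
      _ = r * ∑ i, w i := (Finset.mul_sum _ _ _).symm
      _ ≤ r * d := mul_le_mul_of_nonneg_left hwd hr.le
end

section
/- Let f = (f_1,…,f_n) : 𝔽_q^n → 𝔽_q^n be a polynomial map that involves all n variables. Then μ_f equals the minimum of α_1 + ⋯ + α_m over all tuples (α_1,…,α_m) of nonnegative rational numbers such that every coordinate of α_1 D_1 + ⋯ + α_m D_m is a strictly positive integer; in particular this minimum is attained. -/
open MvPolynomial Pointwise

/-- Reduction to a basic solution: a nonnegative combination of the vectors `D j` can be replaced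
by one with the same value, no larger coefficient sum, and linearly independent support. -/
theorem exists_basic_combination {ι κ : Type*} [Fintype ι] (D : ι → κ → ℝ)
    (a : ι → ℝ) (ha : ∀ j, 0 ≤ a j) :
    ∃ b : ι → ℝ, (∀ j, 0 ≤ b j) ∧ ∑ j, b j ≤ ∑ j, a j ∧
      (∀ i, ∑ j, b j * D j i = ∑ j, a j * D j i) ∧
      ∀ c : ι → ℝ, (∀ j, b j = 0 → c j = 0) → (∀ i, ∑ j, c j * D j i = 0) → ∀ j, c j = 0 := by
  classical
  induction hN : (Finset.univ.filter fun j => a j ≠ 0).card using Nat.strong_induction_on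
    generalizing a with
  | _ N ih =>
  by_cases hind : ∀ c : ι → ℝ, (∀ j, a j = 0 → c j = 0) → (∀ i, ∑ j, c j * D j i = 0) →
      ∀ j, c j = 0
  · exact ⟨a, ha, le_rfl, fun _ => rfl, hind⟩
  obtain ⟨c, hca, hcD, hsum, p, hp⟩ : ∃ c : ι → ℝ, (∀ j, a j = 0 → c j = 0) ∧
      (∀ i, ∑ j, c j * D j i = 0) ∧ 0 ≤ ∑ j, c j ∧ ∃ j, 0 < c j := by
    push Not at hind
    obtain ⟨c, hca, hcD, p, hp⟩ := hind
    have key : ∀ d : ι → ℝ, d p ≠ 0 → 0 ≤ ∑ j, d j → ∃ j, 0 < d j := by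
      intro d hd hs
      by_contra! hneg
      have : ∑ j, d j < 0 := Finset.sum_neg' (fun j _ => hneg j)
        ⟨p, Finset.mem_univ p, lt_of_le_of_ne (hneg p) hd⟩
      linarith
    rcases le_total 0 (∑ j, c j) with h | h
    · exact ⟨c, hca, hcD, h, key c hp h⟩
    · have h' : 0 ≤ ∑ j, (-c) j := by simpa using h
      exact ⟨-c, fun j hj => by simp [hca j hj], fun i => by simp [hcD i], h',
        key (-c) (by simpa using hp) h'⟩
  obtain ⟨q, hq, hmin⟩ := Finset.exists_min_image (Finset.univ.filter fun j => 0 < c j)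
    (fun j => a j / c j) ⟨p, by simpa using hp⟩
  simp only [Finset.mem_filter, Finset.mem_univ, true_and] at hq hmin
  set t := a q / c q with ht
  have ht0 : 0 ≤ t := div_nonneg (ha q) hq.le
  have hnonneg : ∀ j, 0 ≤ a j - t * c j := by
    intro j
    rcases lt_or_ge 0 (c j) with hj | hj
    · have := (le_div_iff₀ hj).1 (hmin j hj)
      linarith
    · nlinarith [ha j]
  have hcard : (Finset.univ.filter fun j => a j - t * c j ≠ 0).card < N := by
    rw [← hN]
    apply Finset.card_lt_card
    rw [Finset.ssubset_iff_of_subset]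
    · refine ⟨q, ?_, ?_⟩
      · simpa using fun h => hq.ne' (hca q h)
      · simp [ht, hq.ne']
    · intro j
      simp only [Finset.mem_filter, Finset.mem_univ, true_and]
      intro hj h
      exact hj (by simp [h, hca j h])
  obtain ⟨b, hb, hbs, hbD, hbi⟩ := ih _ hcard (fun j => a j - t * c j) hnonneg rfl
  refine ⟨b, hb, hbs.trans ?_, fun i => ?_, hbi⟩
  · rw [Finset.sum_sub_distrib, ← Finset.mul_sum]
    nlinarith
  · rw [hbD i]
    simp only [sub_mul, mul_assoc, Finset.sum_sub_distrib, ← Finset.mul_sum, hcD i]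
    simp

theorem exists_ratLinearMap_real_apply_ratCast : ∃ φ : ℝ →ₗ[ℚ] ℚ, ∀ r : ℚ, φ r = r := by
  obtain ⟨φ, hφ⟩ := LinearMap.exists_leftInverse_of_injective (Algebra.linearMap ℚ ℝ)
    (LinearMap.ker_eq_bot.2 (algebraMap ℚ ℝ).injective)
  exact ⟨φ, fun r => by simpa using LinearMap.congr_fun hφ r⟩

/-- The coefficients of an integral vector with respect to linearly independent integral vectors
are rational. -/
theorem exists_rat_eq_of_basic {ι κ : Type*} [Fintype ι] (D : ι → κ → ℕ) (b : ι → ℝ)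
    (hb : ∀ c : ι → ℝ, (∀ j, b j = 0 → c j = 0) → (∀ i, ∑ j, c j * (D j i : ℝ) = 0) →
      ∀ j, c j = 0)
    (hint : ∀ i, ∃ m : ℕ, ∑ j, b j * (D j i : ℝ) = m) :
    ∃ r : ι → ℚ, ∀ j, (r j : ℝ) = b j := by
  obtain ⟨φ, hφ⟩ := exists_ratLinearMap_real_apply_ratCast
  refine ⟨fun j => φ (b j), fun j => ?_⟩
  refine sub_eq_zero.1 (hb (fun j => (φ (b j) : ℝ) - b j) (fun j hj => by simp [hj])
    (fun i => ?_) j)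
  obtain ⟨m, hm⟩ := hint i
  have h : ∑ j, φ (b j) * (D j i : ℚ) = m := by
    have h1 := congrArg φ hm
    have h2 : φ (m : ℝ) = m := by simpa using hφ m
    rw [h2, map_sum] at h1
    rw [← h1]
    refine Finset.sum_congr rfl fun j _ => ?_
    rw [mul_comm, mul_comm (b j), ← nsmul_eq_mul, ← nsmul_eq_mul, map_nsmul]
  have h' : ∑ j, (φ (b j) : ℝ) * (D j i : ℝ) = m := by exact_mod_cast h
  simp [sub_mul, Finset.sum_sub_distrib, h', hm]

/-- The set of nonnegative real coefficient vectors whose combination of the `D j` has strictly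
positive integer coordinates. -/
def positiveIntegralCombinations {ι κ : Type*} [Fintype ι] (D : ι → κ → ℕ) : Set (ι → ℝ) :=
  {a | (∀ j, 0 ≤ a j) ∧ ∀ i, ∃ m : ℕ, 0 < m ∧ ∑ j, a j * (D j i : ℝ) = m}

theorem isClosed_positiveIntegralCombinations {ι κ : Type*} [Fintype ι] (D : ι → κ → ℕ) :
    IsClosed (positiveIntegralCombinations D) := by
  have hN : IsClosed ((Nat.cast : ℕ → ℝ) '' {m | 0 < m}) :=
    Nat.isClosedEmbedding_coe_real.isClosedMap _ (isClosed_discrete _)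
  have h : positiveIntegralCombinations D = (⋂ j, {a | 0 ≤ a j}) ∩
      ⋂ i, (fun a : ι → ℝ => ∑ j, a j * (D j i : ℝ)) ⁻¹' ((Nat.cast : ℕ → ℝ) '' {m | 0 < m}) := by
    ext a
    simp [positiveIntegralCombinations, eq_comm]
  rw [h]
  exact (isClosed_iInter fun j => isClosed_le continuous_const (continuous_apply j)).inter
    (isClosed_iInter fun i => hN.preimage (by fun_prop))

theorem exists_min_positiveIntegralCombinations {ι κ : Type*} [Fintype ι] (D : ι → κ → ℕ)
    (hne : (positiveIntegralCombinations D).Nonempty) :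
    ∃ a ∈ positiveIntegralCombinations D, ∀ b ∈ positiveIntegralCombinations D,
      ∑ j, a j ≤ ∑ j, b j := by
  obtain ⟨a₀, h₀⟩ := hne
  set K := ∑ j, a₀ j
  have hc : IsCompact (Set.Icc (0 : ι → ℝ) (fun _ => K) ∩ positiveIntegralCombinations D) :=
    isCompact_Icc.inter_right (isClosed_positiveIntegralCombinations D)
  have hmem : ∀ b ∈ positiveIntegralCombinations D, ∑ j, b j ≤ K →
      b ∈ Set.Icc (0 : ι → ℝ) (fun _ => K) ∩ positiveIntegralCombinations D := fun b hb hbK =>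
    ⟨⟨fun j => hb.1 j, fun j =>
      (Finset.single_le_sum (fun j _ => hb.1 j) (Finset.mem_univ j)).trans hbK⟩, hb⟩
  obtain ⟨a, ha, hmin⟩ := hc.exists_isMinOn ⟨a₀, hmem a₀ h₀ le_rfl⟩
    (f := fun a : ι → ℝ => ∑ j, a j) (by fun_prop)
  refine ⟨a, ha.2, fun b hb => ?_⟩
  rcases le_total (∑ j, b j) K with h | h
  · exact hmin (hmem b hb h)
  · exact (hmin (hmem a₀ h₀ le_rfl)).trans h

theorem exists_rat_min_positiveIntegralCombinations {ι κ : Type*} [Fintype ι] (D : ι → κ → ℕ)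
    (hne : (positiveIntegralCombinations D).Nonempty) :
    ∃ r : ι → ℚ, (fun j => (r j : ℝ)) ∈ positiveIntegralCombinations D ∧
      ∀ b ∈ positiveIntegralCombinations D, ∑ j, (r j : ℝ) ≤ ∑ j, b j := by
  obtain ⟨a, ha, hmin⟩ := exists_min_positiveIntegralCombinations D hne
  obtain ⟨b, hb, hba, hbD, hbi⟩ := exists_basic_combination (fun j i => (D j i : ℝ)) a ha.1
  obtain ⟨r, hr⟩ := exists_rat_eq_of_basic D b hbi fun i => by
    obtain ⟨m, -, hm⟩ := ha.2 i
    exact ⟨m, (hbD i).trans hm⟩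
  refine ⟨r, ?_, fun c hc => ?_⟩
  · simp only [hr]
    exact ⟨hb, fun i => by simpa only [hbD i] using ha.2 i⟩
  · simp only [hr]
    exact hba.trans (hmin c hc)

/-- Points of the convex hull of `0` and the `D j` are combinations with coefficient sum at most
one. -/
theorem exists_combination_of_mem_convexHull {ι V : Type*} [Fintype ι] [AddCommGroup V]
    [Module ℝ V] (D : ι → V) {x : V} (hx : x ∈ convexHull ℝ ({0} ∪ Set.range D)) :
    ∃ a : ι → ℝ, (∀ j, 0 ≤ a j) ∧ ∑ j, a j ≤ 1 ∧ ∑ j, a j • D j = x := by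
  classical
  refine convexHull_min (t := {x | ∃ a : ι → ℝ, (∀ j, 0 ≤ a j) ∧ ∑ j, a j ≤ 1 ∧
    ∑ j, a j • D j = x}) ?_ ?_ hx
  · rintro _ (rfl | ⟨j, rfl⟩)
    · exact ⟨0, by simp⟩
    · exact ⟨Pi.single j 1, fun k => (Pi.single_nonneg.2 zero_le_one : (0 : ι → ℝ) ≤ _) k,
        by simp, by simp [Pi.single_apply]⟩
  · rintro _ ⟨a, ha, has, rfl⟩ _ ⟨b, hb, hbs, rfl⟩ s t hs ht hst
    refine ⟨fun j => s * a j + t * b j,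
      fun j => add_nonneg (mul_nonneg hs (ha j)) (mul_nonneg ht (hb j)), ?_, ?_⟩
    · rw [Finset.sum_add_distrib, ← Finset.mul_sum, ← Finset.mul_sum]
      nlinarith
    · simp [add_smul, mul_smul, Finset.sum_add_distrib, Finset.smul_sum]

theorem combination_mem_smul_convexHull {ι V : Type*} [Fintype ι] [AddCommGroup V]
    [Module ℝ V] (D : ι → V) {a : ι → ℝ} (ha : ∀ j, 0 ≤ a j) (hpos : 0 < ∑ j, a j) :
    ∑ j, a j • D j ∈ (∑ j, a j) • convexHull ℝ ({0} ∪ Set.range D) := by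
  refine ⟨Finset.univ.centerMass a D, ?_, ?_⟩
  · exact Finset.centerMass_mem_convexHull _ (fun j _ => ha j) hpos
      fun j _ => Or.inr (Set.mem_range_self j)
  · simp only [Finset.centerMass]
    exact smul_inv_smul₀ hpos.ne' _

/-- The infimal dilation factor equals the minimal coefficient sum. -/
theorem sInf_dilation_eq {ι κ : Type*} [Fintype ι] [Nonempty κ] (D : ι → κ → ℕ) {a : ι → ℝ}
    (ha : a ∈ positiveIntegralCombinations D)
    (hmin : ∀ b ∈ positiveIntegralCombinations D, ∑ j, a j ≤ ∑ j, b j) :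
    sInf {k : ℝ | 0 < k ∧ ∃ v ∈ k • convexHull ℝ ({0} ∪ Set.range fun j i => (D j i : ℝ)),
      ∀ i, ∃ m : ℕ, 0 < m ∧ v i = m} = ∑ j, a j := by
  refine IsLeast.csInf_eq ⟨⟨?_, _, combination_mem_smul_convexHull _ ha.1 ?_, ?_⟩, ?_⟩
  rotate_left 2
  · simpa using ha.2
  · rintro k ⟨hk, _, ⟨x, hx, rfl⟩, hv⟩
    obtain ⟨b, hb, hbs, rfl⟩ := exists_combination_of_mem_convexHull _ hx
    refine (hmin (fun j => k * b j) ⟨fun j => mul_nonneg hk.le (hb j), fun i => ?_⟩).trans ?_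
    · simpa [Finset.mul_sum, mul_assoc] using hv i
    · rw [← Finset.mul_sum]
      nlinarith
  all_goals
    refine (Finset.sum_nonneg fun j _ => ha.1 j).lt_of_ne' fun h => ?_
    rw [Finset.sum_eq_zero_iff_of_nonneg fun j _ => ha.1 j] at h
    obtain ⟨m, hm, hm'⟩ := ha.2 (Classical.arbitrary κ)
    simp only [h _ (Finset.mem_univ _), zero_mul, Finset.sum_const_zero] at hm'
    exact hm.ne (by exact_mod_cast hm')

/-- Let `f = (f_1,…,f_n) : 𝔽_q^n → 𝔽_q^n` be a polynomial map that
involves all `n` variables.  Then `μ_f` equals the minimum of `α_1 + ⋯ + α_m` over all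
tuples of nonnegative rationals `(α_1,…,α_m)` with every coordinate of
`α_1 D_1 + ⋯ + α_m D_m` a strictly positive integer; in particular the minimum is
attained. -/
theorem mu_eq_min_rational_combination
    (F : Type*) [Field F] [Fintype F]
    (n : ℕ) (hn : 0 < n) (f : Fin n → MvPolynomial (Fin n) F)
    -- the set of exponent vectors of the monomials of `f_1, …, f_n`
    (E : Finset (Fin n →₀ ℕ))
    (hE : E = Finset.univ.biUnion fun i => (f i).support)
    -- `f` involves all `n` variables
    (hall : ∀ i : Fin n, ∃ D ∈ E, 0 < D i)
    -- the Newton polytope `Δ(f)`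
    (Δ : Set (Fin n → ℝ))
    (hΔ : Δ = convexHull ℝ ({0} ∪ {x : Fin n → ℝ | ∃ D ∈ E, x = fun i => (D i : ℝ)}))
    -- the minimal dilation factor `μ_f`
    (μ : ℝ)
    (hμ : μ = sInf {k : ℝ | 0 < k ∧
        ∃ v ∈ k • Δ, ∀ i : Fin n, ∃ m : ℕ, 0 < m ∧ v i = m}) :
    ∃ α : (Fin n →₀ ℕ) → ℚ,
      (∀ D ∈ E, 0 ≤ α D) ∧
      (∀ i : Fin n, ∃ m : ℕ, 0 < m ∧ ∑ D ∈ E, α D * (D i : ℚ) = m) ∧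
      μ = ((∑ D ∈ E, α D : ℚ) : ℝ) ∧
      ∀ β : (Fin n →₀ ℕ) → ℚ,
        (∀ D ∈ E, 0 ≤ β D) →
        (∀ i : Fin n, ∃ m : ℕ, 0 < m ∧ ∑ D ∈ E, β D * (D i : ℚ) = m) →
        ∑ D ∈ E, α D ≤ ∑ D ∈ E, β D := by
  classical
  have : Nonempty (Fin n) := ⟨⟨0, hn⟩⟩
  set D : E → Fin n → ℕ := fun j i => (j : Fin n →₀ ℕ) i with hD
  have hrange : {x : Fin n → ℝ | ∃ D ∈ E, x = fun i => (D i : ℝ)} =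
      Set.range fun (j : E) i => (D j i : ℝ) := by
    ext x
    simp [hD, eq_comm]
  have hsum (β : (Fin n →₀ ℕ) → ℚ) (i : Fin n) (m : ℕ) (h : ∑ D ∈ E, β D * (D i : ℚ) = m) :
      ∑ j, (β (j : E) : ℝ) * (D j i : ℝ) = m := by
    rw [← Finset.sum_coe_sort] at h
    exact_mod_cast h
  have hmem (β : (Fin n →₀ ℕ) → ℚ) (h0 : ∀ D ∈ E, 0 ≤ β D)
      (h : ∀ i : Fin n, ∃ m : ℕ, 0 < m ∧ ∑ D ∈ E, β D * (D i : ℚ) = m) :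
      (fun j : E => (β j : ℝ)) ∈ positiveIntegralCombinations D := by
    refine ⟨fun j => Rat.cast_nonneg.2 (h0 j j.2), fun i => ?_⟩
    obtain ⟨m, hm, hm'⟩ := h i
    exact ⟨m, hm, hsum β i m hm'⟩
  obtain ⟨r, hr, hmin⟩ := exists_rat_min_positiveIntegralCombinations D
    ⟨_, hmem (fun _ => 1) (fun _ _ => zero_le_one) fun i => by
      obtain ⟨d, hd, hdi⟩ := hall i
      exact ⟨∑ D ∈ E, D i, hdi.trans_le
        (Finset.single_le_sum (f := fun D : Fin n →₀ ℕ => D i) (fun _ _ => Nat.zero_le _) hd),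
        by simp⟩⟩
  obtain ⟨α, hα⟩ : ∃ α : (Fin n →₀ ℕ) → ℚ, ∀ j : E, α j = r j :=
    ⟨fun d => if h : d ∈ E then r ⟨d, h⟩ else 0, fun j => by simp⟩
  have hαsum : ∑ D ∈ E, α D = ∑ j, r j := by
    rw [← Finset.sum_coe_sort]
    simp only [hα]
  refine ⟨α, fun d hd => ?_, fun i => ?_, ?_, fun β hβ hβi => ?_⟩
  · rw [hα ⟨d, hd⟩]
    exact Rat.cast_nonneg.1 (hr.1 ⟨d, hd⟩)
  · obtain ⟨m, hm, hm'⟩ := hr.2 i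
    refine ⟨m, hm, ?_⟩
    rw [← Finset.sum_coe_sort]
    simp only [hα]
    beta_reduce at hm'
    exact_mod_cast hm'
  · rw [hμ, hΔ, hrange, sInf_dilation_eq D hr hmin, hαsum]
    push_cast
    rfl
  · have h := hmin _ (hmem β hβ hβi)
    rw [hαsum, ← Finset.sum_coe_sort E β]
    exact_mod_cast h
end

section
/- Let p be a prime, e ≥ 1, 0 ≤ t ≤ e, and let a_1,…,a_n be nonnegative integers with a_1 + ⋯ + a_n = p^e and a_i ≠ p^e for every i. If p^{e−t} divides every a_i and p^{e−t+1} does not divide every a_i, then p^t divides the multinomial coefficient p^e! / (a_1! ⋯ a_n!). -/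
/-- Singmaster.  Let `p` be a prime, `1 ≤ e`, `t ≤ e`, and let
`a_1, …, a_n` be nonnegative integers with `a_1 + ⋯ + a_n = p^e` and `a_i ≠ p^e` for all
`i`.  If `p^{e−t}` divides every `a_i` but `p^{e−t+1}` does not divide every `a_i`, then
`p^t` divides the multinomial coefficient `p^e! / (a_1! ⋯ a_n!)`. -/
theorem prime_pow_dvd_multinomial
    (p : ℕ) (hp : p.Prime) (e t n : ℕ) (he : 1 ≤ e) (ht : t ≤ e)
    (a : Fin n → ℕ)
    (hsum : ∑ i, a i = p ^ e)
    (hne : ∀ i, a i ≠ p ^ e)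
    (hdvd : ∀ i, p ^ (e - t) ∣ a i)
    (hndvd : ¬ ∀ i, p ^ (e - t + 1) ∣ a i) :
    p ^ t ∣ Nat.multinomial Finset.univ a := by
  obtain ⟨i, hi⟩ := not_forall.mp hndvd
  have hi_zero : a i ≠ 0 := fun h => hi (h ▸ dvd_zero _)
  have hle : a i ≤ p ^ e := hsum ▸ Finset.single_le_sum_of_canonicallyOrdered (Finset.mem_univ i)
  have hval : (a i).factorization p ≤ e - t := by
    by_contra! h
    exact hi ((hp.pow_dvd_iff_le_factorization hi_zero).mpr h)
  have hchoose : p ^ t ∣ (p ^ e).choose (a i) := by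
    rw [hp.pow_dvd_iff_le_factorization (Nat.choose_pos hle).ne',
      Nat.factorization_choose_prime_pow hp hle hi_zero]
    omega
  rw [← Finset.insert_erase (Finset.mem_univ i),
    Nat.multinomial_insert (Finset.notMem_erase i _), Finset.add_sum_erase _ _ (Finset.mem_univ i),
    hsum]
  exact hchoose.mul_right _
end

section
/- Let q be a prime power and k ≥ 1 an integer, and let f(x) = (x+1)·x^{q−1} ∈ 𝔽_{q^k}[x]. Then the value set of f satisfies |f(𝔽_{q^k})| = q^k − q^{k−1}, i.e. |V_f| = q^k − ⌈(q^k − 1)/q⌉, so the bound |V_f| ≤ q − (q−1)/deg f is sharp for every finite field. -/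
/-- A field of order `q ^ k` contains a primitive `(q - 1)`-st root of unity. -/
theorem exists_isPrimitiveRoot_sub_one {F : Type*} [Field F] [Fintype F] {q k : ℕ}
    (hF : Fintype.card F = q ^ k) : ∃ ζ : F, IsPrimitiveRoot ζ (q - 1) := by
  obtain ⟨g, hg⟩ := IsCyclic.exists_ofOrder_eq_natCard (α := Fˣ)
  have hcard : Nat.card Fˣ = q ^ k - 1 := by
    rw [Nat.card_units, Nat.card_eq_fintype_card, hF]
  have hdvd : q - 1 ∣ q ^ k - 1 := by simpa using Nat.sub_dvd_pow_sub_pow q 1 k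
  obtain ⟨d, hd⟩ := hdvd
  have hprim := IsPrimitiveRoot.orderOf g
  rw [hg, hcard] at hprim
  have hpos : 0 < q ^ k - 1 := hcard ▸ Nat.card_pos
  exact ⟨_, (hprim.pow hpos (hd.trans (mul_comm _ _))).map_of_injective
    (f := Units.coeHom F) Units.val_injective⟩

open Polynomial in
/-- Given a primitive `n`-th root of unity, every nonzero `n`-th power has exactly `n` roots. -/
theorem IsPrimitiveRoot.card_nthRootsFinset_pow {R : Type*} [CommRing R] [IsDomain R] {ζ : R}
    {n : ℕ} (h : IsPrimitiveRoot ζ n) {u : R} (hu : u ≠ 0) :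
    (nthRootsFinset n (u ^ n)).card = n := by
  classical
  rw [nthRootsFinset_def, Multiset.toFinset_card_of_nodup (h.nthRoots_nodup (pow_ne_zero n hu)),
    h.card_nthRoots, if_pos ⟨u, rfl⟩]

/-- The image of the additive map `z ↦ z ^ q - z` has index `q`. -/
theorem card_artinSchreier_range {F : Type*} [Field F] [Fintype F] {q : ℕ} (hq : 1 < q)
    {ζ : F} (hζ : IsPrimitiveRoot ζ (q - 1)) (hadd : ∀ x y : F, (x + y) ^ q = x ^ q + y ^ q) :
    q * (Set.range fun z : F => z ^ q - z).ncard = Fintype.card F := by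
  classical
  let φ : F →+ F := AddMonoidHom.mk' (fun z => z ^ q - z) fun x y => by
    rw [hadd]; ring
  have hker : Nat.card φ.ker = q := by
    have hset : (φ.ker : Set F) =
        (insert 0 (Polynomial.nthRootsFinset (q - 1) (1 : F)) : Finset F) := by
      ext z
      have hz : z ^ q - z = z * (z ^ (q - 1) - 1) := by
        rw [mul_sub, mul_one, mul_pow_sub_one (by omega)]
      simp [φ, AddMonoidHom.mem_ker, hz, Polynomial.mem_nthRootsFinset (show 0 < q - 1 by omega),
        sub_eq_zero]
    rw [← SetLike.coe_sort_coe, Nat.card_coe_set_eq, hset, Set.ncard_coe_finset,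
      Finset.card_insert_of_notMem, hζ.card_nthRootsFinset]
    · omega
    · simp [Polynomial.mem_nthRootsFinset (show 0 < q - 1 by omega),
        zero_pow (show q - 1 ≠ 0 by omega)]
  have hmul := φ.ker.card_mul_index
  rw [AddSubgroup.index_ker, hker, Nat.card_eq_fintype_card (α := F)] at hmul
  exact hmul

/-- The values missed by `(x + 1) x ^ (q - 1)` are the `(q - 1)`-st powers of the elements outside
the image of `z ↦ z ^ q - z`. -/
theorem compl_range_eq_image_pow {F : Type*} [Field F] [Finite F] {q : ℕ} (hq : 1 < q)
    (hadd : ∀ x y : F, (x + y) ^ q = x ^ q + y ^ q) :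
    (Set.range fun x : F => (x + 1) * x ^ (q - 1))ᶜ =
      (fun u : F => u ^ (q - 1)) '' (Set.range fun z : F => z ^ q - z)ᶜ := by
  have hq0 : q ≠ 0 := by omega
  have hq1 : q - 1 ≠ 0 := by omega
  have hpow (x : F) : x ^ q = x ^ (q - 1) * x := (pow_sub_one_mul hq0 x).symm
  ext b
  simp only [Set.mem_compl_iff, Set.mem_image, Set.mem_range, not_exists]
  constructor
  · intro hb
    have hval (y : F) (hy : b * y ^ q - y = 1) : False := by
      have hy0 : y ≠ 0 := by rintro rfl; simp [hq0] at hy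
      refine hb y⁻¹ ?_
      rw [inv_pow]
      have : y ^ (q - 1) ≠ 0 := pow_ne_zero _ hy0
      field_simp
      rw [hpow] at hy
      linear_combination -hy
    let L : F →+ F := AddMonoidHom.mk' (fun y => b * y ^ q - y) fun x y => by
      rw [hadd]; ring
    have hL : ¬ Function.Injective L := fun hinj => by
      obtain ⟨y, hy⟩ := Finite.surjective_of_injective hinj 1
      exact hval y hy
    rw [injective_iff_map_eq_zero] at hL
    push Not at hL
    obtain ⟨y, hy, hy0⟩ := hL
    have hby : b * y ^ (q - 1) = 1 := by
      have : (b * y ^ (q - 1) - 1) * y = 0 := by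
        rw [sub_mul, mul_assoc, ← hpow, one_mul]; exact hy
      exact sub_eq_zero.mp ((mul_eq_zero.mp this).resolve_right hy0)
    refine ⟨y⁻¹, fun z hz => hval (y * z) ?_, ?_⟩
    · have : b * y ^ q = y := by rw [hpow, ← mul_assoc, hby, one_mul]
      rw [mul_pow, ← mul_assoc, this, ← mul_sub, hz, mul_inv_cancel₀ hy0]
    · rw [inv_pow, eq_comm]
      exact eq_inv_of_mul_eq_one_left hby
  · rintro ⟨u, hu, rfl⟩ x hx
    have hu0 : u ≠ 0 := by rintro rfl; exact hu 0 (by simp [hq0])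
    have hx0 : x ≠ 0 := by
      rintro rfl
      exact pow_ne_zero (q - 1) hu0 (by simpa [hq1] using hx.symm)
    refine hu (u / x) ?_
    rw [div_pow, hpow u, hpow x, ← hx]
    have : x ^ (q - 1) ≠ 0 := pow_ne_zero _ hx0
    field_simp
    ring

/-- Raising to the power `q - 1` is `(q - 1)`-to-one outside the image of `z ↦ z ^ q - z`. -/
theorem card_compl_artinSchreier_range {F : Type*} [Field F] [Fintype F] {q : ℕ} (hq : 1 < q)
    {ζ : F} (hζ : IsPrimitiveRoot ζ (q - 1)) :
    (Set.range fun z : F => z ^ q - z)ᶜ.ncard = (q - 1) *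
      ((fun u : F => u ^ (q - 1)) '' (Set.range fun z : F => z ^ q - z)ᶜ).ncard := by
  classical
  have hq0 : q ≠ 0 := by omega
  have hpow (x : F) : x ^ q = x ^ (q - 1) * x := (pow_sub_one_mul hq0 x).symm
  rw [Set.ncard_eq_toFinset_card', Set.ncard_eq_toFinset_card', Set.toFinset_image,
    Finset.card_eq_sum_card_image (fun u : F => u ^ (q - 1)), mul_comm, ← smul_eq_mul,
    ← Finset.sum_const]
  refine Finset.sum_congr rfl fun b hb => ?_
  obtain ⟨u, hu, rfl⟩ := Finset.mem_image.mp hb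
  rw [Set.mem_toFinset] at hu
  have hu0 : u ≠ 0 := by rintro rfl; exact hu ⟨0, by simp [hq0]⟩
  refine Eq.trans (congrArg Finset.card ?_) (hζ.card_nthRootsFinset_pow hu0)
  ext v
  rw [Finset.mem_filter, Polynomial.mem_nthRootsFinset (by omega), Set.mem_toFinset,
    and_iff_right_iff_imp]
  rintro hv ⟨z, rfl⟩
  dsimp only at hv
  have hv0 : z ^ q - z ≠ 0 := fun h => by
    rw [h, zero_pow (by omega)] at hv
    exact pow_ne_zero _ hu0 hv.symm
  refine hu ⟨u / (z ^ q - z) * z, ?_⟩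
  have hc : (u / (z ^ q - z)) ^ q = u / (z ^ q - z) := by
    rw [hpow, div_pow, hv, div_self (pow_ne_zero _ hu0), one_mul]
  dsimp only
  rw [mul_pow, hc, ← mul_sub, div_mul_cancel₀ _ hv0]

/-- Cusick–Müller sharp example.  Let `q` be a prime power, `k ≥ 1`,
and `f(x) = (x+1)·x^{q−1} ∈ 𝔽_{q^k}[x]`.  Then `|f(𝔽_{q^k})| = q^k − q^{k−1}`, i.e.
`|V_f| = q^k − ⌈(q^k − 1)/q⌉` (so the bound `|V_f| ≤ q − (q−1)/deg f` is sharp for every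
finite field).  Here `⌈(q^k − 1)/q⌉ = (q^k − 1 + (q − 1))/q` in natural-number division. -/
theorem cusick_mueller_sharp
    (q k : ℕ) (hq : IsPrimePow q) (hk : 1 ≤ k)
    (F : Type*) [Field F] [Fintype F] (hF : Fintype.card F = q ^ k) :
    (Set.range fun x : F =>
        Polynomial.eval x ((Polynomial.X + 1) * Polynomial.X ^ (q - 1))).ncard
      = q ^ k - q ^ (k - 1) ∧
    (Set.range fun x : F =>
        Polynomial.eval x ((Polynomial.X + 1) * Polynomial.X ^ (q - 1))).ncard
      = q ^ k - (q ^ k - 1 + (q - 1)) / q := by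
  obtain ⟨p, n, hp, hn, rfl⟩ := hq
  have hp' : p.Prime := hp.nat_prime
  have : Fact p.Prime := ⟨hp'⟩
  have : CharP F p := charP_of_card_eq_prime_pow (f := n * k) (by rw [hF, pow_mul])
  have hadd (x y : F) : (x + y) ^ p ^ n = x ^ p ^ n + y ^ p ^ n := add_pow_char_pow x y p n
  have hq : 1 < p ^ n := Nat.one_lt_pow hn.ne' hp'.one_lt
  generalize p ^ n = q at *
  obtain ⟨ζ, hζ⟩ := exists_isPrimitiveRoot_sub_one hF
  obtain ⟨k, rfl⟩ := Nat.exists_eq_add_of_le' hk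
  have hW := card_artinSchreier_range hq hζ hadd
  have hT := card_compl_artinSchreier_range hq hζ
  rw [← compl_range_eq_image_pow hq hadd] at hT
  have hWc := Set.ncard_add_ncard_compl (Set.range fun z : F => z ^ q - z)
  have hVc := Set.ncard_add_ncard_compl (Set.range fun x : F => (x + 1) * x ^ (q - 1))
  rw [Nat.card_eq_fintype_card, hF] at hWc hVc
  rw [hF, pow_succ', Nat.mul_right_inj (by omega)] at hW
  have hmissed : (Set.range fun x : F => (x + 1) * x ^ (q - 1))ᶜ.ncard = q ^ k := by
    refine Nat.eq_of_mul_eq_mul_left (show 0 < q - 1 by omega) ?_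
    rw [← hT, Nat.sub_one_mul, ← pow_succ']
    omega
  have hceil : (q ^ (k + 1) - 1 + (q - 1)) / q = q ^ k := by
    have hpos : 0 < q ^ k := by positivity
    rw [pow_succ']
    have : q * q ^ k - 1 + (q - 1) = (q - 2) + q * q ^ k := by
      have : 0 < q * q ^ k := by positivity
      omega
    rw [this, Nat.add_mul_div_left _ _ (by omega), Nat.div_eq_of_lt (by omega), zero_add]
  simp only [Polynomial.eval_mul, Polynomial.eval_add, Polynomial.eval_X, Polynomial.eval_one,
    Polynomial.eval_pow, hceil, Nat.add_sub_cancel, and_self]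
  omega
end
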